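/- Let a > b be two natural numbers. Let (([0,1]^a)^ℤ, σ) and (([0,1]^b)^ℤ, σ) be the full shifts on the alphabets [0,1]^a and [0,1]^b respectively. Then for any equivariant continuous map π : ([0,1]^a)^ℤ → ([0,1]^b)^ℤ (i.e. π ∘ σ = σ ∘ π), the topological conditional entropy of π is infinite: h_top(π, σ) = +∞. -/

import Mathlib

open Filter Topology
open scoped ENNReal NNReal

noncomputable section

/-- Diameter (in `ℝ≥0∞`) of a set with respect to a distance function `ρ`. -/
def setEDiam {X : Type*} (ρ : X → X → ℝ) (E : Set X) : ℝ≥0∞ :=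
  ⨆ x ∈ E, ⨆ y ∈ E, ENNReal.ofReal (ρ x y)

/-- Openness with respect to a distance function `ρ`. -/
def ROpen {X : Type*} (ρ : X → X → ℝ) (U : Set X) : Prop :=
  ∀ x ∈ U, ∃ δ > 0, ∀ y, ρ x y < δ → y ∈ U

/-- `#(E, ρ, ε)`: the minimal number `n` of `ρ`-open sets of `ρ`-diameter `< ε` covering `E`
(`0` when `E = ∅`, since the empty family covers it). -/
def covNum {X : Type*} (ρ : X → X → ℝ) (ε : ℝ) (E : Set X) : ℕ :=
  sInf {n : ℕ | ∃ U : Fin n → Set X, (∀ i, ROpen ρ (U i)) ∧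
    (∀ i, setEDiam ρ (U i) < ENNReal.ofReal ε) ∧ E ⊆ ⋃ i, U i}

/-- The dynamical metric `d_N(x,y) = max_{0 ≤ n < N} d(Tⁿx, Tⁿy)`. -/
def dynDist {X : Type*} (T : X → X) (d : X → X → ℝ) (N : ℕ) (x y : X) : ℝ :=
  sSup {r : ℝ | ∃ n, n < N ∧ r = d (T^[n] x) (T^[n] y)}

/-- `sup_{y ∈ Y} log #(π⁻¹(y), ρ, ε)`. -/
def supLogCov {X Y : Type*} (π : X → Y) (ρ : X → X → ℝ) (ε : ℝ) : ℝ :=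
  ⨆ y : Y, Real.log (covNum ρ ε (π ⁻¹' {y}) : ℝ)

/-- `sup_{y ∈ Y} log #(π⁻¹(B_δ(y, ρY)), ρX, ε)` where `B_δ` is the closed `δ`-ball. -/
def supLogCovBall {X Y : Type*} (π : X → Y) (ρX : X → X → ℝ) (ρY : Y → Y → ℝ)
    (ε δ : ℝ) : ℝ :=
  ⨆ y : Y, Real.log (covNum ρX ε (π ⁻¹' {x | ρY x y ≤ δ}) : ℝ)

/-- Topological conditional entropy
`h_top(π, T) = lim_{ε→0} lim_{N→∞} (sup_y log #(π⁻¹(y), d_N, ε))/N`, as an extended real. -/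
def condEntropy {X Y : Type*} (π : X → Y) (T : X → X) (d : X → X → ℝ) : EReal :=
  Filter.limsup (fun ε : ℝ => Filter.liminf
      (fun N : ℕ => ((supLogCov π (dynDist T d N) ε / N : ℝ) : EReal)) Filter.atTop)
    (𝓝[>] (0 : ℝ))

/-- `lim_{N→∞} (sup_y log #(π⁻¹(y), d_N, ε))/(N log(1/ε))` (the limit exists by
subadditivity; it is realized here as a liminf). -/
def condMdimRate {X Y : Type*} (π : X → Y) (T : X → X) (d : X → X → ℝ) (ε : ℝ) : EReal :=
  Filter.liminf (fun N : ℕ =>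
    ((supLogCov π (dynDist T d N) ε / (N * Real.log (1 / ε)) : ℝ) : EReal)) Filter.atTop

/-- Lower conditional metric mean dimension of `π : (X,T,d) → Y`. -/
def lowerCondMdimM {X Y : Type*} (π : X → Y) (T : X → X) (d : X → X → ℝ) : EReal :=
  Filter.liminf (fun ε : ℝ => condMdimRate π T d ε) (𝓝[>] (0 : ℝ))

/-- Upper conditional metric mean dimension of `π : (X,T,d) → Y`. -/
def upperCondMdimM {X Y : Type*} (π : X → Y) (T : X → X) (d : X → X → ℝ) : EReal :=
  Filter.limsup (fun ε : ℝ => condMdimRate π T d ε) (𝓝[>] (0 : ℝ))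

/-- `lim_{N→∞} log #(X, d_N, ε)/(N log(1/ε))`. -/
def mdimMRate {X : Type*} (T : X → X) (d : X → X → ℝ) (ε : ℝ) : EReal :=
  Filter.liminf (fun N : ℕ =>
    ((Real.log (covNum (dynDist T d N) ε (Set.univ : Set X) : ℝ) /
      (N * Real.log (1 / ε)) : ℝ) : EReal)) Filter.atTop

/-- Lower metric mean dimension of `(X, T, d)`. -/
def lowerMdimM {X : Type*} (T : X → X) (d : X → X → ℝ) : EReal :=
  Filter.liminf (fun ε : ℝ => mdimMRate T d ε) (𝓝[>] (0 : ℝ))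

/-- Upper metric mean dimension of `(X, T, d)`. -/
def upperMdimM {X : Type*} (T : X → X) (d : X → X → ℝ) : EReal :=
  Filter.limsup (fun ε : ℝ => mdimMRate T d ε) (𝓝[>] (0 : ℝ))

/-- `widim_ε(X, ρ)`: the minimal `k` such that there are a finite simplicial complex of
dimension `≤ k` (realized in some `ℝ^m`) and a continuous `ε`-embedding `f : X → P`
(all fibers of `f` have `ρ`-diameter `< ε`). -/
def widim (X : Type*) [TopologicalSpace X] (ρ : X → X → ℝ) (ε : ℝ) : ℕ :=
  sInf {k : ℕ | ∃ (m : ℕ) (K : Geometry.SimplicialComplex ℝ (Fin m → ℝ)),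
    K.faces.Finite ∧ (∀ s ∈ K.faces, s.card ≤ k + 1) ∧
    ∃ f : X → K.space, Continuous f ∧
      ∀ p : K.space, setEDiam ρ (f ⁻¹' {p}) < ENNReal.ofReal ε}

/-- Mean dimension `mdim(X, T) = lim_{ε→0} lim_{N→∞} widim_ε(X, d_N)/N`. -/
def mdim (X : Type*) [TopologicalSpace X] (T : X → X) (d : X → X → ℝ) : EReal :=
  Filter.limsup (fun ε : ℝ => Filter.liminf
      (fun N : ℕ => (((widim X (dynDist T d N) ε : ℝ) / N : ℝ) : EReal)) Filter.atTop)
    (𝓝[>] (0 : ℝ))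

/-- The cube `[0,1]^a`. -/
abbrev Cube (a : ℕ) := Fin a → unitInterval

/-- The full shift space `([0,1]^a)^ℤ`. -/
abbrev FullShift (a : ℕ) := ℤ → Cube a

/-- The shift map `σ((x_n)_n) = (x_{n+1})_n`. -/
def shift {α : Type*} (x : ℤ → α) : ℤ → α := fun n => x (n + 1)

/-- The `ℓ^∞`-distance on the cube `[0,1]^a`. -/
def cubeDist {a : ℕ} (x y : Cube a) : ℝ :=
  ‖(fun i => (x i : ℝ)) - fun i => (y i : ℝ)‖

/-- The metric `D((x_n), (y_n)) = Σ_{n∈ℤ} 2^{-|n|} ‖x_n − y_n‖_∞` on the full shift. -/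
def shiftDist {a : ℕ} (x y : FullShift a) : ℝ :=
  ∑' n : ℤ, (2 : ℝ) ^ (-|n|) * cubeDist (x n) (y n)

end

/-- Nodes of the complete binary tree with `k` levels. -/
inductive TreeNode : ℕ → Type
  | root {k : ℕ} : TreeNode (k + 1)
  | child {k : ℕ} : Bool → TreeNode k → TreeNode (k + 1)

namespace TreeNode

instance : IsEmpty (TreeNode 0) := ⟨fun a => nomatch a⟩

/-- A nonempty tree is its root together with two subtrees. -/
def equivOption (k : ℕ) : TreeNode (k + 1) ≃ Option (Bool × TreeNode k) where
  toFun a := match a with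
    | root => none
    | child b a => some (b, a)
  invFun a := match a with
    | none => root
    | some (b, a) => child b a
  left_inv a := by cases a <;> rfl
  right_inv a := by rcases a with _ | ⟨b, a⟩ <;> rfl

instance finite : (k : ℕ) → Finite (TreeNode k)
  | 0 => inferInstance
  | k + 1 => by
    have := finite k
    exact Finite.of_equiv _ (equivOption k).symm

noncomputable instance (k : ℕ) : Fintype (TreeNode k) := Fintype.ofFinite _

noncomputable instance (k : ℕ) : DecidableEq (TreeNode k) := Classical.decEq _

/-- The tree automorphism swapping the two subtrees below each node marked by `g`. -/
def move : {k : ℕ} → (TreeNode k → Bool) → TreeNode k → TreeNode k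
  | _, _, root => root
  | _, g, child b a => child (b ^^ g root) (move (fun a => g (child b a)) a)

/-- Inverse of a marking of the tree, with respect to composition of automorphisms. -/
def invMark : {k : ℕ} → (TreeNode k → Bool) → TreeNode k → Bool
  | _, g, root => g root
  | _, g, child b a => invMark (fun a => g (child (b ^^ g root) a)) a

lemma move_false {k : ℕ} (a : TreeNode k) : move (fun _ => false) a = a := by
  induction a with
  | root => rfl
  | child b a ih => simp [move, ih]

lemma move_mul {k : ℕ} (g h : TreeNode k → Bool) (a : TreeNode k) :
    move (fun a => g a ^^ h (move g a)) a = move h (move g a) := by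
  induction a with
  | root => rfl
  | child b a ih =>
    simp only [move, Bool.xor_assoc]
    rw [ih (fun a => g (child b a)) (fun a => h (child (b ^^ g root) a))]

lemma invMark_xor {k : ℕ} (g : TreeNode k → Bool) (a : TreeNode k) :
    (invMark g a ^^ g (move (invMark g) a)) = false := by
  induction a with
  | root => simp [invMark, move]
  | child b a ih =>
    simp only [move, invMark]
    exact ih (fun a => g (child (b ^^ g root) a))

end TreeNode

/-- Automorphisms of the binary tree, encoded by the set of nodes where subtrees are swapped. -/
@[ext]
structure TreeGroup (k : ℕ) where
  /-- whether the two subtrees below a node are swapped -/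
  mark : TreeNode k → Bool

namespace TreeGroup

open TreeNode

variable {k : ℕ}

instance : Mul (TreeGroup k) := ⟨fun g h => ⟨fun a => g.mark a ^^ h.mark (move g.mark a)⟩⟩

instance : One (TreeGroup k) := ⟨⟨fun _ => false⟩⟩

instance : Inv (TreeGroup k) := ⟨fun g => ⟨invMark g.mark⟩⟩

lemma mul_mark (g h : TreeGroup k) (a : TreeNode k) :
    (g * h).mark a = (g.mark a ^^ h.mark (move g.mark a)) := rfl

lemma one_mark (a : TreeNode k) : (1 : TreeGroup k).mark a = false := rfl

lemma move_mul_mark (g h : TreeGroup k) (a : TreeNode k) :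
    move (g * h).mark a = move h.mark (move g.mark a) := move_mul g.mark h.mark a

lemma move_one_mark (a : TreeNode k) : move (1 : TreeGroup k).mark a = a := move_false a

instance : Group (TreeGroup k) :=
  { mul_assoc := fun g h l => by
      ext a
      simp only [mul_mark, move_mul_mark, Bool.xor_assoc]
    one_mul := fun g => by
      ext a
      simp only [mul_mark, one_mark, move_one_mark, Bool.false_xor]
    mul_one := fun g => by
      ext a
      simp only [mul_mark, one_mark, Bool.xor_false]
    inv_mul_cancel := fun g => by
      ext a
      exact invMark_xor g.mark a }

instance : Finite (TreeGroup k) := Finite.of_injective mark fun _ _ => TreeGroup.ext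

noncomputable instance : Fintype (TreeGroup k) := Fintype.ofFinite _

/-- Action of the tree group on families indexed by nodes: permute the nodes, and negate the
entries at marked nodes. -/
def act {X : Type*} [Neg X] (g : TreeGroup k) (c : TreeNode k → X) : TreeNode k → X :=
  fun a => if g.mark a then -c (move g.mark a) else c (move g.mark a)

lemma act_one {X : Type*} [Neg X] (c : TreeNode k → X) : act 1 c = c := by
  funext a
  simp [act, one_mark, move_one_mark]

lemma act_mul {X : Type*} [InvolutiveNeg X] (g h : TreeGroup k) (c : TreeNode k → X) :
    act (g * h) c = act g (act h c) := by
  funext a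
  simp only [act, mul_mark, move_mul_mark]
  cases g.mark a <;> cases h.mark (move g.mark a) <;> simp

/-- The restriction of a tree automorphism to a subtree below the root. -/
def sub (g : TreeGroup (k + 1)) (b : Bool) : TreeGroup k := ⟨fun a => g.mark (child b a)⟩

lemma act_root {X : Type*} [Neg X] (g : TreeGroup (k + 1)) (c : TreeNode (k + 1) → X) :
    act g c root = if g.mark root then -c root else c root := rfl

lemma act_child {X : Type*} [Neg X] (g : TreeGroup (k + 1)) (c : TreeNode (k + 1) → X) (b : Bool)
    (a : TreeNode k) :
    act g c (child b a) = act (g.sub b) (fun a => c (child (b ^^ g.mark root) a)) a := rfl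

lemma eq_one_of_act_eq {X : Type*} [InvolutiveNeg X] {k : ℕ} (g : TreeGroup k)
    (c : TreeNode k → X) (hc : ∀ a, c a ≠ -c a) (h : act g c = c) : g = 1 := by
  induction k with
  | zero => ext a; exact isEmptyElim a
  | succ k ih =>
    have h0 : g.mark root = false := by
      have := congrFun h root
      by_contra h1
      simp only [Bool.not_eq_false] at h1
      rw [act_root, h1] at this
      exact hc root (by simpa using this.symm)
    ext a
    cases a with
    | root => rw [h0, one_mark]
    | child b a =>
      have := ih (g.sub b) (fun a => c (child b a)) (fun a => hc _) (by
        funext a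
        simpa [act_child, h0] using congrFun h (child b a))
      exact congrFun (congrArg mark this) a

end TreeGroup

section Cov

variable {α W : Type*} [AddCommGroup W] [Module ℝ W]

/-- The convex hull of the values of `y` on `t` contains the origin. -/
def Cov (y : α → W) (t : Finset α) : Prop :=
  ∃ w : α → ℝ, (∀ i ∈ t, 0 ≤ w i) ∧ ∑ i ∈ t, w i = 1 ∧ ∑ i ∈ t, w i • y i = 0

lemma Cov.erase [DecidableEq α] {y : α → W} {t : Finset α} {w : α → ℝ}
    (h0 : ∀ i ∈ t, 0 ≤ w i) (h1 : ∑ i ∈ t, w i = 1) (h2 : ∑ i ∈ t, w i • y i = 0) {j : α}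
    (hj : j ∈ t) (hwj : w j = 0) : Cov y (t.erase j) := by
  refine ⟨w, fun i hi => h0 i (Finset.mem_of_mem_erase hi), ?_, ?_⟩
  · rw [← h1, ← Finset.add_sum_erase t w hj, hwj, zero_add]
  · rw [← h2, ← Finset.add_sum_erase t _ hj, hwj, zero_smul, zero_add]

lemma exists_neg_of_sum_eq_zero {t : Finset α} {μ : α → ℝ} (h : ∑ i ∈ t, μ i = 0) {i : α}
    (hi : i ∈ t) (hμ : μ i ≠ 0) : ∃ j ∈ t, μ j < 0 := by
  by_contra! hc
  exact hμ ((Finset.sum_eq_zero_iff_of_nonneg hc).1 h i hi)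

lemma exists_cov_erase [DecidableEq α] {y : α → W} {t : Finset α} {w μ : α → ℝ}
    (h0 : ∀ i ∈ t, 0 ≤ w i) (h1 : ∑ i ∈ t, w i = 1) (h2 : ∑ i ∈ t, w i • y i = 0)
    (m1 : ∑ i ∈ t, μ i = 0) (m2 : ∑ i ∈ t, μ i • y i = 0) (m3 : ∃ j ∈ t, μ j < 0) :
    ∃ j ∈ t, μ j < 0 ∧ Cov y (t.erase j) := by
  classical
  obtain ⟨j, hj, hmin⟩ := (t.filter (fun j => μ j < 0)).exists_min_image (fun j => w j / -μ j)
    (by obtain ⟨j, hj, hj'⟩ := m3; exact ⟨j, by simp [hj, hj']⟩)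
  simp only [Finset.mem_filter] at hj hmin
  refine ⟨j, hj.1, hj.2, ?_⟩
  have hc : 0 ≤ w j / -μ j := div_nonneg (h0 j hj.1) (by linarith [hj.2])
  set c := w j / -μ j with hcdef
  refine Cov.erase (w := fun i => w i + c * μ i) (fun i hi => ?_) ?_ ?_ hj.1 ?_
  · by_cases hi' : μ i < 0
    · have := hmin i ⟨hi, hi'⟩
      rw [le_div_iff₀ (by linarith)] at this
      linarith
    · have := mul_nonneg hc (not_lt.1 hi')
      linarith [h0 i hi]
  · rw [Finset.sum_add_distrib, ← Finset.mul_sum, h1, m1]; ring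
  · simp only [add_smul, mul_smul]
    rw [Finset.sum_add_distrib, ← Finset.smul_sum, h2, m2]; simp
  · rw [hcdef, div_mul_eq_mul_div, div_neg, mul_div_cancel_right₀ _ hj.2.ne, add_neg_cancel]

lemma Cov.exists_ker [FiniteDimensional ℝ W] (y : α → W) {s : Finset α}
    (hs : Module.finrank ℝ W + 1 < s.card) :
    ∃ μ : α → ℝ, ∑ i ∈ s, μ i = 0 ∧ ∑ i ∈ s, μ i • y i = 0 ∧ ∃ i ∈ s, μ i ≠ 0 := by
  by_contra! hc
  have hli : LinearIndepOn ℝ (fun i => (y i, (1 : ℝ))) (s : Set α) := by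
    rw [linearIndepOn_finset_iff]
    intro μ hμ
    have h1 := congrArg Prod.fst hμ
    have h2 := congrArg Prod.snd hμ
    simp only [Prod.fst_sum, Prod.snd_sum, Prod.smul_mk, smul_eq_mul, mul_one, Prod.fst_zero,
      Prod.snd_zero] at h1 h2
    exact hc μ h2 h1
  have := LinearIndependent.fintype_card_le_finrank hli
  simp at this
  omega

/-- A generic set of `dim W + 2` points has either no or exactly two facets whose convex hull
contains the origin. -/
lemma Cov.card_facets [DecidableEq α] [FiniteDimensional ℝ W] (y : α → W) {s : Finset α}
    (hs : s.card = Module.finrank ℝ W + 2)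
    (hnd : ∀ t ⊆ s, t.card ≤ Module.finrank ℝ W → ¬ Cov y t)
    {i : α} (hi : i ∈ s) (hci : Cov y (s.erase i)) :
    ∃ j ∈ s, j ≠ i ∧ ∀ l ∈ s, Cov y (s.erase l) ↔ l = i ∨ l = j := by
  classical
  have hnd2 : ∀ i ∈ s, ∀ j ∈ s.erase i, ¬ Cov y ((s.erase i).erase j) := by
    intro i hi j hj
    apply hnd
    · exact (Finset.erase_subset _ _).trans (Finset.erase_subset _ _)
    · rw [Finset.card_erase_of_mem hj, Finset.card_erase_of_mem hi]; omega
  -- weights of a covering facet, extended by zero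
  have hw : ∀ i ∈ s, Cov y (s.erase i) → ∃ w : α → ℝ, w i = 0 ∧ (∀ j ∈ s, j ≠ i → 0 < w j) ∧
      ∑ j ∈ s, w j = 1 ∧ ∑ j ∈ s, w j • y j = 0 := by
    rintro i hi ⟨w, h0, h1, h2⟩
    have hz : ∀ j ∈ s.erase i, Function.update w i 0 j = w j := fun j hj =>
      Function.update_of_ne (Finset.ne_of_mem_erase hj) _ _
    refine ⟨Function.update w i 0, by simp, fun j hj hji => ?_, ?_, ?_⟩
    · have hj' : j ∈ s.erase i := Finset.mem_erase.2 ⟨hji, hj⟩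
      rw [hz j hj']
      refine lt_of_le_of_ne (h0 j hj') fun h => hnd2 i hi j hj' (Cov.erase h0 h1 h2 hj' h.symm)
    · rw [← Finset.add_sum_erase _ _ hi, ← h1, Function.update_self, zero_add]
      exact Finset.sum_congr rfl hz
    · rw [← Finset.add_sum_erase _ _ hi, ← h2, Function.update_self, zero_smul, zero_add]
      exact Finset.sum_congr rfl fun j hj => by rw [hz j hj]
  -- a kernel vector vanishing at a covering vertex is zero
  have hker : ∀ i ∈ s, Cov y (s.erase i) → ∀ μ : α → ℝ, μ i = 0 → ∑ j ∈ s, μ j = 0 →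
      ∑ j ∈ s, μ j • y j = 0 → ∀ j ∈ s, μ j = 0 := by
    rintro i hi ⟨w, h0, h1, h2⟩ μ hμi hμ1 hμ2 j hj
    by_contra hne
    have hj' : j ∈ s.erase i := Finset.mem_erase.2 ⟨fun h => hne (h ▸ hμi), hj⟩
    rw [← Finset.add_sum_erase _ _ hi, hμi, zero_add] at hμ1
    rw [← Finset.add_sum_erase _ _ hi, hμi, zero_smul, zero_add] at hμ2
    obtain ⟨l, hl, -, hcl⟩ := exists_cov_erase h0 h1 h2 hμ1 hμ2
      (exists_neg_of_sum_eq_zero hμ1 hj' hne)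
    exact hnd2 i hi l hl hcl
  obtain ⟨w₁, hw1i, hw1, hw1s, hw1y⟩ := hw i hi hci
  have hex : ∃ j ∈ s, j ≠ i ∧ Cov y (s.erase j) := by
    obtain ⟨μ, m1, m2, j, hj, hμj⟩ := Cov.exists_ker y (s := s) (by omega)
    have hμi : μ i ≠ 0 := fun h => hμj (hker i hi hci μ h m1 m2 j hj)
    have h0 : ∀ j ∈ s, 0 ≤ w₁ j := fun j hj => by
      by_cases h : j = i
      · rw [h, hw1i]
      · exact (hw1 j hj h).le
    have key : ∀ μ : α → ℝ, 0 < μ i → ∑ j ∈ s, μ j = 0 → ∑ j ∈ s, μ j • y j = 0 →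
        ∃ j ∈ s, j ≠ i ∧ Cov y (s.erase j) := by
      intro μ hμ m1 m2
      obtain ⟨l, hl, hl2, hcl⟩ := exists_cov_erase h0 hw1s hw1y m1 m2
        (exists_neg_of_sum_eq_zero m1 hi hμ.ne')
      exact ⟨l, hl, fun h => by rw [h] at hl2; linarith, hcl⟩
    rcases lt_or_gt_of_ne hμi with h | h
    · exact key (fun i => -μ i) (by linarith) (by simp [m1]) (by simp [m2])
    · exact key μ h m1 m2
  obtain ⟨j, hj, hji, hcj⟩ := hex
  refine ⟨j, hj, hji, fun l hl => ⟨fun hcl => ?_, ?_⟩⟩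
  · by_contra! hne
    obtain ⟨w₂, hw2j, hw2, hw2s, hw2y⟩ := hw j hj hcj
    obtain ⟨w₃, hw3l, hw3, hw3s, hw3y⟩ := hw l hl hcl
    have hz := hker i hi hci (fun x => w₃ i * (w₂ x - w₁ x) - w₂ i * (w₃ x - w₁ x))
      (by simp only [hw1i]; ring)
      (by
        simp only [Finset.sum_sub_distrib, ← Finset.mul_sum]
        rw [hw1s, hw2s, hw3s]; ring)
      (by
        simp only [sub_smul, mul_smul, Finset.sum_sub_distrib, ← Finset.smul_sum]
        rw [hw1y, hw2y, hw3y]; simp)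
    have hzj := hz j hj
    have hzl := hz l hl
    simp only [hw2j, hw3l] at hzj hzl
    have a1 := hw2 i hi hji.symm
    have a2 := hw3 i hi hne.1.symm
    have a3 := hw1 j hj hji
    have a4 := hw3 j hj hne.2.symm
    have a5 := hw1 l hl hne.1
    have a6 := hw2 l hl hne.2
    have b1 : 0 < (w₂ i - w₃ i) * w₁ j := by nlinarith [mul_pos a1 a4]
    have b2 : 0 < (w₃ i - w₂ i) * w₁ l := by nlinarith [mul_pos a2 a6]
    have c1 := pos_of_mul_pos_left b1 a3.le
    have c2 := pos_of_mul_pos_left b2 a5.le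
    linarith
  · rintro (rfl | rfl) <;> assumption

end Cov

section Parity

open scoped Pointwise

lemma card_group_dvd_of_free {G β : Type*} [Group G] [Fintype G] [MulAction G β] (s : Finset β)
    (hinv : ∀ (g : G), ∀ x ∈ s, g • x ∈ s) (hfree : ∀ (g : G), ∀ x ∈ s, g • x = x → g = 1) :
    Fintype.card G ∣ s.card := by
  classical
  rw [Finset.card_eq_sum_card_image (fun x => (Quotient.mk (MulAction.orbitRel G β) x)) s]
  refine Finset.dvd_sum fun q hq => ?_
  obtain ⟨x, hx, rfl⟩ := Finset.mem_image.1 hq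
  have : s.filter (fun z => Quotient.mk (MulAction.orbitRel G β) z = Quotient.mk _ x) =
      (Finset.univ : Finset G).image (fun g => g • x) := by
    ext z
    simp only [Finset.mem_filter, Finset.mem_image, Finset.mem_univ, true_and]
    constructor
    · rintro ⟨-, h⟩
      exact Quotient.exact h
    · rintro ⟨g, rfl⟩
      exact ⟨hinv g x hx, Quotient.sound ⟨g, rfl⟩⟩
  rw [this, Finset.card_image_of_injective, Finset.card_univ]
  intro g h hgh
  have := hfree (h⁻¹ * g) x hx (by rw [mul_smul]; exact inv_smul_eq_iff.2 hgh)
  exact (inv_mul_eq_one.1 this).symm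

lemma Cov.smul {G α W : Type*} [DecidableEq α] [Group G] [MulAction G α] [AddCommGroup W]
    [Module ℝ W] {y : α → W} {t : Finset α} {g : G} {L : W →ₗ[ℝ] W}
    (hL : ∀ z ∈ t, y (g • z) = L (y z)) (h : Cov y t) : Cov y (g • t) := by
  obtain ⟨w, h0, h1, h2⟩ := h
  have hinj : Set.InjOn (fun z : α => g • z) (t : Set α) := (MulAction.injective g).injOn
  refine ⟨fun z => w (g⁻¹ • z), ?_, ?_, ?_⟩
  · intro i hi
    exact h0 _ (Finset.inv_smul_mem_iff.2 hi)
  · rw [Finset.smul_finset_def, Finset.sum_image hinj, ← h1]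
    simp
  · rw [Finset.smul_finset_def, Finset.sum_image hinj, ← L.map_zero, ← h2, map_sum]
    exact Finset.sum_congr rfl fun z hz => by simp [hL z hz]

/-- Parity count of covering simplices on the boundary of a pseudomanifold with a free group
action. -/
theorem two_mul_card_group_dvd_boundary {G α W : Type*} [DecidableEq α] [Group G] [Fintype G]
    [MulAction G α] [AddCommGroup W] [Module ℝ W] [FiniteDimensional ℝ W] (K : Finset α)
    (C : Finset α → Prop) (B : Finset α → Prop) [DecidablePred B] (y : α → W)
    (hCmono : ∀ s t, t ⊆ s → C s → C t) (hCinv : ∀ (g : G) t, C t → C (g • t))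
    (hfree : ∀ (g : G) t, t ⊆ K → t.Nonempty → C t → g • t = t → g = 1)
    (hK : ∀ (g : G), ∀ x ∈ K, g • x ∈ K)
    (hB : ∀ (g : G) t, t ⊆ K → C t → (B (g • t) ↔ B t))
    (hy : ∀ g : G, ∃ L : W →ₗ[ℝ] W, ∀ z ∈ K, y (g • z) = L (y z))
    (hnd : ∀ t ⊆ K, C t → t.card ≤ Module.finrank ℝ W → ¬ Cov y t)
    (hext : ∀ t ⊆ K, C t → t.card = Module.finrank ℝ W + 1 →
      {x : α | x ∈ K ∧ x ∉ t ∧ C (insert x t)}.ncard = if B t then 1 else 2)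
    (N : Finset (Finset α)) (hN : ∀ t, t ∈ N ↔
      t ⊆ K ∧ t.card = Module.finrank ℝ W + 1 ∧ C t ∧ Cov y t ∧ B t) :
    2 * Fintype.card G ∣ N.card := by
  classical
  set D := Module.finrank ℝ W with hD
  set T := (K.powersetCard (D + 1)).filter (fun t => C t ∧ Cov y t) with hT
  set S := (K.powersetCard (D + 2)).filter (fun s => C s ∧ ∃ i ∈ s, Cov y (s.erase i)) with hS
  have mT : ∀ t, t ∈ T ↔ t ⊆ K ∧ t.card = D + 1 ∧ C t ∧ Cov y t := by
    intro t; simp [hT, Finset.mem_powersetCard, and_assoc]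
  have mS : ∀ t, t ∈ S ↔ t ⊆ K ∧ t.card = D + 2 ∧ C t ∧ ∃ i ∈ t, Cov y (t.erase i) := by
    intro t; simp [hS, Finset.mem_powersetCard, and_assoc]
  have subK : ∀ (g : G) t, t ⊆ K → g • t ⊆ K := by
    intro g t ht x hx
    obtain ⟨z, hz, rfl⟩ := Finset.mem_smul_finset.1 hx
    exact hK g z (ht hz)
  have covinv : ∀ (g : G) t, t ⊆ K → Cov y t → Cov y (g • t) := by
    intro g t ht h
    obtain ⟨L, hL⟩ := hy g
    exact h.smul (fun z hz => hL z (ht hz))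
  have dvdS : Fintype.card G ∣ S.card := by
    refine card_group_dvd_of_free S (fun g s hs => ?_) fun g s hs => ?_
    · rw [mS] at hs ⊢
      obtain ⟨h1, h2, h3, i, hi, h4⟩ := hs
      refine ⟨subK g s h1, by rw [Finset.card_smul_finset, h2], hCinv g s h3, g • i,
        Finset.smul_mem_smul_finset hi, ?_⟩
      have he : (g • s).erase (g • i) = g • s.erase i := by
        rw [Finset.smul_finset_def, Finset.smul_finset_def,
          Finset.image_erase (MulAction.injective g)]
      rw [he]
      exact covinv g _ ((Finset.erase_subset _ _).trans h1) h4
    · rw [mS] at hs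
      exact hfree g s hs.1 (Finset.card_pos.1 (by omega)) hs.2.2.1
  have dvdT : Fintype.card G ∣ (T.filter (fun t => ¬ B t)).card := by
    refine card_group_dvd_of_free _ (fun g s hs => ?_) fun g s hs => ?_
    · simp only [Finset.mem_filter, mT] at hs ⊢
      obtain ⟨⟨h1, h2, h3, h4⟩, h5⟩ := hs
      exact ⟨⟨subK g s h1, by rw [Finset.card_smul_finset, h2], hCinv g s h3, covinv g s h1 h4⟩,
        by rwa [hB g s h1 h3]⟩
    · simp only [Finset.mem_filter, mT] at hs
      exact hfree g s hs.1.1 (Finset.card_pos.1 (by omega)) hs.1.2.2.1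
  have hdc := Finset.sum_card_bipartiteAbove_eq_sum_card_bipartiteBelow (s := S) (t := T)
    (fun s t => t ⊆ s)
  have hL : ∀ s ∈ S, (Finset.bipartiteAbove (fun s t => t ⊆ s) T s).card = 2 := by
    intro s hs
    rw [mS] at hs
    obtain ⟨h1, h2, h3, i, hi, h4⟩ := hs
    obtain ⟨j, hj, hji, hall⟩ := Cov.card_facets y h2
      (fun t ht hc => hnd t (ht.trans h1) (hCmono s t ht h3) hc) hi h4
    have : Finset.bipartiteAbove (fun s t => t ⊆ s) T s = {s.erase i, s.erase j} := by
      ext t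
      simp only [Finset.mem_bipartiteAbove, mT, Finset.mem_insert, Finset.mem_singleton]
      constructor
      · rintro ⟨⟨t1, t2, t3, t4⟩, t5⟩
        have : ∃ l ∈ s, t = s.erase l := by
          obtain ⟨l, hl⟩ := Finset.card_eq_one.1 (show (s \ t).card = 1 by
            rw [Finset.card_sdiff_of_subset t5]; omega)
          have hls : l ∈ s \ t := by rw [hl]; simp
          refine ⟨l, (Finset.mem_sdiff.1 hls).1, ?_⟩
          rw [← Finset.sdiff_singleton_eq_erase, ← hl, Finset.sdiff_sdiff_eq_self t5]
        obtain ⟨l, hl, rfl⟩ := this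
        rcases (hall l hl).1 t4 with rfl | rfl <;> simp
      · have : ∀ l ∈ s, Cov y (s.erase l) → (s.erase l ⊆ K ∧ (s.erase l).card = D + 1 ∧
            C (s.erase l) ∧ Cov y (s.erase l)) ∧ s.erase l ⊆ s := fun l hl hc =>
          ⟨⟨(Finset.erase_subset _ _).trans h1, by rw [Finset.card_erase_of_mem hl, h2]; omega,
            hCmono _ _ (Finset.erase_subset _ _) h3, hc⟩, Finset.erase_subset _ _⟩
        rintro (rfl | rfl)
        · exact this i hi h4
        · exact this j hj ((hall j hj).2 (Or.inr rfl))
    rw [this, Finset.card_pair]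
    intro h
    have := Finset.notMem_erase i s
    rw [h] at this
    exact this (Finset.mem_erase.2 ⟨hji.symm, hi⟩)
  have hR : ∀ t ∈ T, (Finset.bipartiteBelow (fun s t => t ⊆ s) S t).card =
      if B t then 1 else 2 := by
    intro t ht
    rw [mT] at ht
    obtain ⟨t1, t2, t3, t4⟩ := ht
    rw [← hext t t1 t3 t2]
    have : {x : α | x ∈ K ∧ x ∉ t ∧ C (insert x t)} =
        ((K.filter (fun x => x ∉ t ∧ C (insert x t)) : Finset α) : Set α) := by ext; simp
    rw [this, Set.ncard_coe_finset]
    symm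
    refine Finset.card_bij (fun x _ => insert x t) ?_ ?_ ?_
    · intro x hx
      simp only [Finset.mem_filter] at hx
      simp only [Finset.mem_bipartiteBelow, mS]
      refine ⟨⟨Finset.insert_subset hx.1 t1, by rw [Finset.card_insert_of_notMem hx.2.1, t2],
        hx.2.2, x, Finset.mem_insert_self _ _, ?_⟩, Finset.subset_insert _ _⟩
      rwa [Finset.erase_insert hx.2.1]
    · intro x hx z hz h
      simp only [Finset.mem_filter] at hx hz
      exact Finset.insert_inj hx.2.1 |>.1 h
    · intro s hs
      simp only [Finset.mem_bipartiteBelow, mS] at hs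
      obtain ⟨⟨s1, s2, s3, -⟩, s5⟩ := hs
      obtain ⟨l, hl⟩ := Finset.card_eq_one.1 (show (s \ t).card = 1 by
        rw [Finset.card_sdiff_of_subset s5]; omega)
      have hls : l ∈ s \ t := by rw [hl]; simp
      have hst : insert l t = s := by
        rw [Finset.insert_eq, ← hl, Finset.sdiff_union_of_subset s5]
      have hls' := Finset.mem_sdiff.1 hls
      refine ⟨l, ?_, hst⟩
      simp only [Finset.mem_filter]
      exact ⟨s1 hls'.1, hls'.2, by rwa [hst]⟩
  rw [Finset.sum_congr rfl hL, Finset.sum_congr rfl hR, Finset.sum_ite] at hdc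
  simp only [Finset.sum_const, smul_eq_mul, mul_one] at hdc
  have hNT : T.filter B = N := by
    ext t
    simp only [Finset.mem_filter, mT, hN]
    tauto
  rw [hNT] at hdc
  have e1 : 2 * Fintype.card G ∣ S.card * 2 := by rw [mul_comm]; exact Nat.mul_dvd_mul_right dvdS 2
  have e2 : 2 * Fintype.card G ∣ (T.filter (fun t => ¬ B t)).card * 2 := by
    rw [mul_comm]; exact Nat.mul_dvd_mul_right dvdT 2
  rw [hdc] at e1
  exact (Nat.dvd_add_left e2).1 e1

end Parity

section Generic

open scoped Pointwise

variable {W : Type*} [NormedAddCommGroup W] [NormedSpace ℝ W] [FiniteDimensional ℝ W]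

lemma exists_near_notMem_span (A : Finset W) (p : W) {δ : ℝ} (hδ : 0 < δ) :
    ∃ v, ‖v - p‖ < δ ∧ ∀ B ⊆ A, B.card < Module.finrank ℝ W →
      v ∉ Submodule.span ℝ (B : Set W) := by
  classical
  have hd : Dense (⋂ B ∈ ((A.powerset.filter (fun B => B.card < Module.finrank ℝ W) :
      Finset (Finset W)) : Set (Finset W)), ((Submodule.span ℝ ((B : Finset W) : Set W) :
        Set W))ᶜ) := by
    refine dense_biInter_of_isOpen (fun B _ => ?_) (Finset.countable_toSet _) fun B hB => ?_
    · exact (Submodule.closed_of_finiteDimensional _).isOpen_compl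
    · rw [← interior_eq_empty_iff_dense_compl, ← Set.not_nonempty_iff_eq_empty]
      intro hne
      have htop := Submodule.eq_top_of_nonempty_interior' _ hne
      have h1 := finrank_span_finset_le_card (R := ℝ) B
      rw [Set.finrank, htop, finrank_top] at h1
      simp at hB
      omega
  obtain ⟨v, hv, hv'⟩ := hd.exists_dist_lt p hδ
  refine ⟨v, by rwa [← dist_eq_norm, dist_comm], fun B hB hc => ?_⟩
  simp only [Set.mem_iInter] at hv
  exact hv B (by simp [hB, hc])

/-- Equivariant perturbation of a map on a finite free `G`-set into general position. -/
theorem exists_equivariant_generic {G α : Type*} [Group G] [MulAction G α]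
    (L : G → W →ₗ[ℝ] W) (hL1 : ∀ v, L 1 v = v) (hLmul : ∀ g h v, L (g * h) v = L g (L h v))
    (hLnorm : ∀ g v, ‖L g v‖ ≤ ‖v‖) (B₀ : Finset W) (hB₀ : ∀ g, ∀ v ∈ B₀, L g v ∈ B₀)
    (ψ : α → W) {δ : ℝ} (hδ : 0 < δ) (P : Finset α) (hP : ∀ (g : G), ∀ z ∈ P, g • z ∈ P)
    (hfree : ∀ (g : G), ∀ z ∈ P, g • z = z → g = 1)
    (hψ : ∀ (g : G), ∀ z ∈ P, ψ (g • z) = L g (ψ z)) :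
    ∃ y : α → W, (∀ (g : G), ∀ z ∈ P, y (g • z) = L g (y z)) ∧ (∀ z ∈ P, ‖y z - ψ z‖ < δ) ∧
      ∀ t ⊆ P, (∀ x ∈ t, ∀ g : G, g • x ∈ t → g • x = x) → ∀ B ⊆ B₀,
        t.card + B.card ≤ Module.finrank ℝ W → ∀ w : α → ℝ,
        ∑ z ∈ t, w z • y z ∈ Submodule.span ℝ (B : Set W) → ∀ z ∈ t, w z = 0 := by
  classical
  induction P using Finset.strongInduction with
  | H P ih =>
  rcases P.eq_empty_or_nonempty with rfl | ⟨x, hx⟩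
  · exact ⟨fun _ => 0, by simp, by simp, fun t ht _ B _ _ w _ z hz => absurd (ht hz) (by simp)⟩
  set P' := P.filter (fun z => ¬ ∃ g : G, g • x = z) with hP'
  have hP'sub : P' ⊆ P := Finset.filter_subset _ _
  have hss : P' ⊂ P := Finset.ssubset_iff_subset_ne.2 ⟨hP'sub, fun h => by
    have : x ∈ P' := h ▸ hx
    simp only [hP', Finset.mem_filter] at this
    exact this.2 ⟨1, one_smul _ _⟩⟩
  have hP'inv : ∀ (g : G), ∀ z ∈ P', g • z ∈ P' := by
    intro g z hz
    simp only [hP', Finset.mem_filter] at hz ⊢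
    refine ⟨hP g z hz.1, fun ⟨h, hh⟩ => hz.2 ⟨g⁻¹ * h, ?_⟩⟩
    rw [mul_smul, hh, inv_smul_smul]
  obtain ⟨y', hy1, hy2, hy3⟩ := ih P' hss hP'inv (fun g z hz => hfree g z (hP'sub hz))
    (fun g z hz => hψ g z (hP'sub hz))
  obtain ⟨v, hv, hvA⟩ := exists_near_notMem_span (B₀ ∪ P'.image y') (ψ x) hδ
  set y : α → W := fun z => if h : ∃ g : G, g • x = z then L h.choose v else y' z with hy
  have yx : ∀ g : G, y (g • x) = L g v := by
    intro g
    have h : ∃ h : G, h • x = g • x := ⟨g, rfl⟩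
    have h2 : h.choose = g := by
      have h3 := hfree (g⁻¹ * h.choose) x hx (by rw [mul_smul, h.choose_spec, inv_smul_smul])
      exact (inv_mul_eq_one.1 h3).symm
    simp only [hy, dif_pos h, h2]
  have yP' : ∀ z ∈ P', y z = y' z := by
    intro z hz
    simp only [hP', Finset.mem_filter] at hz
    simp only [hy, dif_neg hz.2]
  have hcase : ∀ z ∈ P, z ∈ P' ∨ ∃ g : G, g • x = z := by
    intro z hz
    by_cases h : ∃ g : G, g • x = z
    · exact Or.inr h
    · exact Or.inl (by simp only [hP', Finset.mem_filter]; exact ⟨hz, h⟩)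
  refine ⟨y, ?_, ?_, ?_⟩
  · intro g z hz
    rcases hcase z hz with h | ⟨h, rfl⟩
    · rw [yP' z h, yP' _ (hP'inv g z h), hy1 g z h]
    · rw [← mul_smul, yx, yx, hLmul]
  · intro z hz
    rcases hcase z hz with h | ⟨h, rfl⟩
    · rw [yP' z h]; exact hy2 z h
    · rw [yx, hψ h x hx, ← map_sub]
      exact (hLnorm _ _).trans_lt hv
  · intro t ht horb B hB hcard w hw
    have hold : ∀ s ⊆ t, s ⊆ P' → ∑ z ∈ s, w z • y z ∈ Submodule.span ℝ (B : Set W) →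
        ∀ z ∈ s, w z = 0 := by
      intro s hst hsP hs
      refine hy3 s hsP (fun a ha g hg => horb a (hst ha) g (hst hg)) B hB
        ((Nat.add_le_add_right (Finset.card_le_card hst) _).trans hcard) w ?_
      rwa [Finset.sum_congr rfl fun z hz => by rw [← yP' z (hsP hz)]]
    by_cases hex : ∃ g : G, g • x ∈ t
    · obtain ⟨g, hg⟩ := hex
      have hsP : t.erase (g • x) ⊆ P' := by
        intro z hz
        rcases hcase z (ht (Finset.mem_of_mem_erase hz)) with h | ⟨h, rfl⟩
        · exact h
        · exfalso
          have := horb _ hg (h * g⁻¹) (by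
            rw [mul_smul, inv_smul_smul]; exact Finset.mem_of_mem_erase hz)
          rw [mul_smul, inv_smul_smul] at this
          exact Finset.ne_of_mem_erase hz this
      rw [← Finset.add_sum_erase _ _ hg] at hw
      have hwg : w (g • x) = 0 := by
        by_contra hne
        set S : Finset W := B ∪ (t.erase (g • x)).image y' with hS
        have hScard : S.card < Module.finrank ℝ W := by
          have h1 : S.card ≤ _ := Finset.card_union_le B ((t.erase (g • x)).image y')
          have h2 := Finset.card_image_le (s := t.erase (g • x)) (f := y')
          have h3 := Finset.card_erase_lt_of_mem hg
          omega
        have hmem : L g v ∈ Submodule.span ℝ (S : Set W) := by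
          have hsum : ∑ z ∈ t.erase (g • x), w z • y z ∈ Submodule.span ℝ (S : Set W) := by
            refine Submodule.sum_mem _ fun z hz => Submodule.smul_mem _ _ ?_
            rw [yP' z (hsP hz)]
            exact Submodule.subset_span (by
              simp only [hS, Finset.coe_union, Finset.coe_image]
              exact Or.inr ⟨z, hz, rfl⟩)
          have hw' : w (g • x) • y (g • x) + ∑ z ∈ t.erase (g • x), w z • y z ∈
              Submodule.span ℝ (S : Set W) :=
            Submodule.span_mono (by simp [hS]) hw
          have := (Submodule.add_mem_iff_left _ hsum).1 hw'
          rw [yx] at this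
          exact (Submodule.smul_mem_iff _ hne).1 this
        have hmem' : v ∈ Submodule.span ℝ ((S.image (L g⁻¹) : Finset W) : Set W) := by
          have := Submodule.mem_map_of_mem (f := L g⁻¹) hmem
          rw [← hLmul, inv_mul_cancel, hL1, Submodule.map_span] at this
          simpa using this
        refine hvA _ ?_ (Finset.card_image_le.trans_lt hScard) hmem'
        intro u hu
        obtain ⟨u', hu', rfl⟩ := Finset.mem_image.1 hu
        rcases Finset.mem_union.1 hu' with h | h
        · exact Finset.mem_union_left _ (hB₀ _ _ (hB h))
        · obtain ⟨z, hz, rfl⟩ := Finset.mem_image.1 h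
          refine Finset.mem_union_right _ (Finset.mem_image.2 ⟨g⁻¹ • z, hP'inv _ _ (hsP hz), ?_⟩)
          exact hy1 _ _ (hsP hz)
      rw [hwg, zero_smul, zero_add] at hw
      have := hold _ (Finset.erase_subset _ _) hsP hw
      intro z hz
      by_cases h : z = g • x
      · rw [h, hwg]
      · exact this z (Finset.mem_erase.2 ⟨h, hz⟩)
    · refine hold t subset_rfl (fun z hz => ?_) hw
      rcases hcase z (ht hz) with h | ⟨h, rfl⟩
      · exact h
      · exact absurd ⟨h, hz⟩ hex

end Generic

section Khalimsky

variable {ι : Type*}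

/-- The Khalimsky order on integer points: even coordinates are vertices, odd ones are edges. -/
def Kle (x y : ι → ℤ) : Prop := ∀ i, x i = y i ∨ (Odd (y i) ∧ |x i - y i| = 1)

lemma Kle.refl (x : ι → ℤ) : Kle x x := fun _ => Or.inl rfl

lemma even_of_abs_sub_eq_one {u v : ℤ} (hv : Odd v) (h : |u - v| = 1) : Even u := by
  rcases (abs_eq (by norm_num)).1 h with h | h
  · obtain ⟨m, rfl⟩ := hv; exact ⟨m + 1, by omega⟩
  · obtain ⟨m, rfl⟩ := hv; exact ⟨m, by omega⟩

lemma Kle.eq_of_even {x y : ι → ℤ} (h : Kle x y) {i : ι} (hi : Even (y i)) : x i = y i := by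
  rcases h i with h | ⟨h, -⟩
  · exact h
  · exact absurd hi (Int.not_even_iff_odd.2 h)

lemma Kle.eq_of_odd {x y : ι → ℤ} (h : Kle x y) {i : ι} (hi : Odd (x i)) : x i = y i := by
  rcases h i with h | ⟨h, h'⟩
  · exact h
  · exact absurd (even_of_abs_sub_eq_one h h') (Int.not_even_iff_odd.2 hi)

lemma Kle.odd {x y : ι → ℤ} (h : Kle x y) {i : ι} (hi : Odd (x i)) : Odd (y i) :=
  h.eq_of_odd hi ▸ hi

lemma Kle.trans {x y z : ι → ℤ} (h : Kle x y) (h' : Kle y z) : Kle x z := by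
  intro i
  rcases h i with h1 | ⟨h1, h2⟩
  · rw [h1]; exact h' i
  · rw [← h'.eq_of_odd h1]; exact Or.inr ⟨h1, h2⟩

lemma Kle.abs_sub_le {x y : ι → ℤ} (h : Kle x y) (i : ι) : |x i - y i| ≤ 1 := by
  rcases h i with h | h
  · simp [h]
  · exact h.2.le

lemma kle_update [DecidableEq ι] {x : ι → ℤ} {i : ι} {v : ℤ} (hv : Odd v) (h : |x i - v| = 1) :
    Kle x (Function.update x i v) := by
  intro j
  by_cases hj : j = i
  · subst hj; right; simpa using ⟨hv, h⟩
  · left; rw [Function.update_of_ne hj]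

lemma update_kle [DecidableEq ι] {x : ι → ℤ} {i : ι} {v : ℤ} (hv : Odd (x i))
    (h : |v - x i| = 1) : Kle (Function.update x i v) x := by
  intro j
  by_cases hj : j = i
  · subst hj; right; simpa using ⟨hv, h⟩
  · left; rw [Function.update_of_ne hj]

variable [Fintype ι]

/-- The number of odd coordinates, which is the dimension of the corresponding cell. -/
def krank (x : ι → ℤ) : ℕ := (Finset.univ.filter (fun i => Odd (x i))).card

lemma Kle.krank_eq [DecidableEq ι] {x y : ι → ℤ} (h : Kle x y) :
    krank y = krank x + (Finset.univ.filter (fun i => x i ≠ y i)).card := by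
  rw [krank, krank, ← Finset.card_union_of_disjoint]
  · congr 1
    ext i
    simp only [Finset.mem_filter, Finset.mem_union, Finset.mem_univ, true_and]
    constructor
    · intro hi
      by_cases hx : x i = y i
      · exact Or.inl (hx ▸ hi)
      · exact Or.inr hx
    · rintro (hi | hi)
      · exact h.odd hi
      · exact ((h i).resolve_left hi).1
  · rw [Finset.disjoint_filter]
    intro i _ hi hne
    exact hne (h.eq_of_odd hi)

lemma Kle.krank_le {x y : ι → ℤ} (h : Kle x y) : krank x ≤ krank y := by
  classical
  have := h.krank_eq; omega

lemma Kle.eq_of_krank_le {x y : ι → ℤ} (h : Kle x y) (hr : krank y ≤ krank x) : x = y := by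
  classical
  have h1 := h.krank_eq
  have h2 : (Finset.univ.filter (fun i => x i ≠ y i)).card = 0 := by omega
  rw [Finset.card_eq_zero, Finset.filter_eq_empty_iff] at h2
  funext i
  by_contra hne
  exact h2 (Finset.mem_univ i) hne

lemma Kle.exists_update [DecidableEq ι] {x y : ι → ℤ} (h : Kle x y)
    (hr : krank y = krank x + 1) :
    ∃ i, Even (x i) ∧ Odd (y i) ∧ |x i - y i| = 1 ∧ (∀ j, j ≠ i → x j = y j) := by
  have h1 := h.krank_eq
  obtain ⟨i, hi⟩ := Finset.card_eq_one.1
    (show (Finset.univ.filter (fun i => x i ≠ y i)).card = 1 by omega)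
  have hi' : ∀ j, x j ≠ y j ↔ j = i := fun j => by
    have := congrArg (j ∈ ·) hi
    simpa using this
  obtain ⟨h2, h3⟩ := (h i).resolve_left ((hi' i).2 rfl)
  exact ⟨i, even_of_abs_sub_eq_one h2 h3, h2, h3, fun j hj => not_not.1 fun hne =>
    hj ((hi' j).1 hne)⟩

lemma krank_update_odd [DecidableEq ι] {x : ι → ℤ} {i : ι} {v : ℤ} (hx : Even (x i))
    (hv : Odd v) : krank (Function.update x i v) = krank x + 1 := by
  have : Finset.univ.filter (fun j => Odd (Function.update x i v j)) =
      insert i (Finset.univ.filter (fun j => Odd (x j))) := by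
    ext j
    by_cases hj : j = i
    · subst hj; simp [hv]
    · simp [hj]
  rw [krank, this, Finset.card_insert_of_notMem (by simpa using hx), krank]

lemma krank_update_even [DecidableEq ι] {x : ι → ℤ} {i : ι} {v : ℤ} (hx : Odd (x i))
    (hv : Even v) : krank x = krank (Function.update x i v) + 1 := by
  rw [← krank_update_odd (x := Function.update x i v) (i := i) (by simpa using hv) hx]
  simp

/-- The diamond property of the Khalimsky order. -/
lemma Kle.ncard_between {x y : ι → ℤ} (h : Kle x y) (hr : krank y = krank x + 2) :
    {z | Kle x z ∧ Kle z y ∧ krank z = krank x + 1}.ncard = 2 := by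
  classical
  have h1 := h.krank_eq
  obtain ⟨i, j, hij, he⟩ := Finset.card_eq_two.1
    (show (Finset.univ.filter (fun i => x i ≠ y i)).card = 2 by omega)
  have he' : ∀ l, x l ≠ y l ↔ l = i ∨ l = j := fun l => by
    have := congrArg (l ∈ ·) he
    simpa using this
  obtain ⟨hi2, hi3⟩ := (h i).resolve_left ((he' i).2 (Or.inl rfl))
  obtain ⟨hj2, hj3⟩ := (h j).resolve_left ((he' j).2 (Or.inr rfl))
  have hset : {z | Kle x z ∧ Kle z y ∧ krank z = krank x + 1} =
      {Function.update x i (y i), Function.update x j (y j)} := by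
    ext z
    simp only [Set.mem_ofPred_eq, Set.mem_insert_iff, Set.mem_singleton_iff]
    constructor
    · rintro ⟨hxz, hzy, hz⟩
      obtain ⟨l, hl1, hl2, hl3, hl4⟩ := hxz.exists_update hz
      have hly : z l = y l := hzy.eq_of_odd hl2
      have hzl : z = Function.update x l (y l) := by
        funext m
        by_cases hm : m = l
        · subst hm; simp [hly]
        · rw [Function.update_of_ne hm, hl4 m hm]
      have hne : x l ≠ y l := by
        intro h
        rw [hly, h] at hl3
        simp at hl3
      rcases (he' l).1 hne with rfl | rfl
      · exact Or.inl hzl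
      · exact Or.inr hzl
    · have key : ∀ i, Odd (y i) → |x i - y i| = 1 → Kle x (Function.update x i (y i)) ∧
          Kle (Function.update x i (y i)) y ∧
          krank (Function.update x i (y i)) = krank x + 1 := by
        intro i h1 h2
        refine ⟨kle_update h1 h2, fun m => ?_, krank_update_odd (even_of_abs_sub_eq_one h1 h2) h1⟩
        by_cases hm : m = i
        · subst hm; left; simp
        · rw [Function.update_of_ne hm]; exact h m
      rintro (rfl | rfl)
      · exact key i hi2 hi3
      · exact key j hj2 hj3
  rw [hset, Set.ncard_pair]
  intro he
  have := congrFun he i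
  rw [Function.update_self, Function.update_of_ne hij] at this
  exact (he' i).2 (Or.inl rfl) this.symm

end Khalimsky

section GridComplex

variable {A : Type*} {d : ℕ}

/-- Vertices of the grid structure on `[0,1] × (∂[-1,1]^(d+1))^A`, with mesh `1/(2L)`. -/
def InGrid (L : ℤ) (z : Option (A × Fin (d + 1)) → ℤ) : Prop :=
  (z none = 0 ∨ z none = 1) ∧
    ∀ a, (∀ i, |z (some (a, i))| ≤ 2 * L) ∧ ∃ i, |z (some (a, i))| = 2 * L

/-- Number of even coordinates at a node. -/
def evenCount (z : Option (A × Fin (d + 1)) → ℤ) (a : A) : ℕ :=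
  (Finset.univ.filter (fun i => Even (z (some (a, i))))).card

lemma krank_add_sum_evenCount [Fintype A] (z : Option (A × Fin (d + 1)) → ℤ) :
    krank z + ∑ a, evenCount z a =
      (if Odd (z none) then 1 else 0) + Fintype.card A * (d + 1) := by
  have h1 : krank z = (if Odd (z none) then 1 else 0) +
      ∑ a, (Finset.univ.filter (fun i => Odd (z (some (a, i))))).card := by
    simp only [krank, Finset.card_filter]
    rw [Fintype.sum_option, Fintype.sum_prod_type]
  have h2 : ∀ a, (Finset.univ.filter (fun i => Odd (z (some (a, i))))).card + evenCount z a
      = d + 1 := by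
    intro a
    rw [evenCount]
    simp only [← Int.not_odd_iff_even]
    rw [Finset.card_filter_add_card_filter_not]
    simp
  rw [h1, add_assoc, ← Finset.sum_add_distrib, Finset.sum_congr rfl fun a _ => h2 a]
  simp

lemma InGrid.even_none {L : ℤ} {z : Option (A × Fin (d + 1)) → ℤ} (hz : InGrid L z) :
    Odd (z none) ↔ z none = 1 := by
  rcases hz.1 with h | h <;> simp [h]

lemma even_of_abs_eq {L v : ℤ} (h : |v| = 2 * L) : Even v :=
  even_abs.1 (h ▸ even_two_mul L)

lemma InGrid.one_le_evenCount {L : ℤ} {z : Option (A × Fin (d + 1)) → ℤ} (hz : InGrid L z)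
    (a : A) : 1 ≤ evenCount z a := by
  obtain ⟨i, hi⟩ := (hz.2 a).2
  exact Finset.card_pos.2 ⟨i, by simpa using even_of_abs_eq hi⟩

lemma InGrid.krank_le [Fintype A] {L : ℤ} {z : Option (A × Fin (d + 1)) → ℤ} (hz : InGrid L z) :
    krank z ≤ Fintype.card A * d + 1 := by
  have h1 := krank_add_sum_evenCount z
  have h2 : ∑ _a : A, 1 ≤ ∑ a, evenCount z a := Finset.sum_le_sum fun a _ => hz.one_le_evenCount a
  simp only [Finset.sum_const, Finset.card_univ, smul_eq_mul, mul_one] at h2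
  have h3 : (if Odd (z none) then 1 else 0) ≤ 1 := by split_ifs <;> omega
  rw [mul_add, mul_one] at h1
  omega

/-- A cell of maximal node dimension has exactly one even coordinate at each node. -/
lemma InGrid.evenCount_eq_one [Fintype A] {L : ℤ} {z : Option (A × Fin (d + 1)) → ℤ}
    (hz : InGrid L z)
    (hr : Fintype.card A * d + (if Odd (z none) then 1 else 0) ≤ krank z) (a : A) :
    evenCount z a = 1 := by
  have h1 := krank_add_sum_evenCount z
  have h2 : ∑ _a : A, 1 ≤ ∑ a, evenCount z a := Finset.sum_le_sum fun a _ => hz.one_le_evenCount a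
  have h4 : ∑ _a : A, 1 = ∑ a, evenCount z a := by
    refine le_antisymm h2 ?_
    simp only [Finset.sum_const, Finset.card_univ, smul_eq_mul, mul_one]
    rw [mul_add, mul_one] at h1
    omega
  exact ((Finset.sum_eq_sum_iff_of_le fun a _ => hz.one_le_evenCount a).1 h4 a
    (Finset.mem_univ a)).symm

lemma InGrid.abs_lt_of_odd {L : ℤ} {z : Option (A × Fin (d + 1)) → ℤ} (hz : InGrid L z) {a : A}
    {i : Fin (d + 1)} (ho : Odd (z (some (a, i)))) : |z (some (a, i))| < 2 * L := by
  refine lt_of_le_of_ne ((hz.2 a).1 i) fun h => ?_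
  exact (Int.not_even_iff_odd.2 ho) (even_of_abs_eq h)

/-- A point below a grid point is a grid point. -/
lemma InGrid.of_kle {L : ℤ} {x z : Option (A × Fin (d + 1)) → ℤ} (hz : InGrid L z)
    (h : Kle x z) (h0 : x none = 0 ∨ x none = 1) : InGrid L x := by
  refine ⟨h0, fun a => ⟨fun i => ?_, ?_⟩⟩
  · rcases h (some (a, i)) with h1 | ⟨h1, h2⟩
    · rw [h1]; exact (hz.2 a).1 i
    · have := hz.abs_lt_of_odd h1
      have h3 := abs_sub_abs_le_abs_sub (x (some (a, i))) (z (some (a, i)))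
      omega
  · obtain ⟨i, hi⟩ := (hz.2 a).2
    exact ⟨i, by rw [h.eq_of_even (even_of_abs_eq hi), hi]⟩

variable [Fintype A] [DecidableEq A]

lemma ncard_odd_updates {ι : Type*} [DecidableEq ι] (x : ι → ℤ) (i : ι) :
    ({Function.update x i (x i - 1), Function.update x i (x i + 1)} : Set (ι → ℤ)).ncard = 2 := by
  rw [Set.ncard_pair]
  intro h
  have := congrFun h i
  simp only [Function.update_self] at this
  omega

lemma abs_sub_eq_one_iff {u v : ℤ} : |u - v| = 1 ↔ v = u - 1 ∨ v = u + 1 := by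
  rw [abs_eq (by norm_num)]; omega

/-- Ways of extending a chain downwards below a one-dimensional cell. -/
lemma InGrid.ncard_below {L : ℤ} {y : Option (A × Fin (d + 1)) → ℤ} (hy : InGrid L y)
    (hr : krank y = 1) :
    {x | InGrid L x ∧ Kle x y ∧ krank x = 0}.ncard = if y none = 1 then 1 else 2 := by
  obtain ⟨i, hi⟩ := Finset.card_eq_one.1
    (show (Finset.univ.filter (fun i => Odd (y i))).card = 1 from hr)
  have hi' : ∀ j, Odd (y j) ↔ j = i := fun j => by
    have := congrArg (j ∈ ·) hi
    simpa using this
  have ho : Odd (y i) := (hi' i).2 rfl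
  have char : ∀ x, Kle x y ∧ krank x = 0 ↔
      x = Function.update y i (y i - 1) ∨ x = Function.update y i (y i + 1) := by
    intro x
    constructor
    · rintro ⟨h1, h2⟩
      obtain ⟨j, hj1, hj2, hj3, hj4⟩ := h1.exists_update (by omega)
      obtain rfl := (hi' j).1 hj2
      have hx : x = Function.update y j (x j) := by
        funext l
        by_cases hl : l = j
        · subst hl; simp
        · rw [Function.update_of_ne hl, hj4 l hl]
      rw [abs_sub_comm] at hj3
      rcases abs_sub_eq_one_iff.1 hj3 with h | h <;> rw [h] at hx
      · exact Or.inl hx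
      · exact Or.inr hx
    · have key : ∀ v, Even v → |v - y i| = 1 → Kle (Function.update y i v) y ∧
          krank (Function.update y i v) = 0 := fun v hv h =>
        ⟨update_kle ho h, by have := krank_update_even ho hv; omega⟩
      rintro (rfl | rfl)
      · exact key _ (ho.sub_odd odd_one) (by simp)
      · exact key _ (ho.add_odd odd_one) (by simp)
  split_ifs with h0
  · have hin : none = i := (hi' none).1 (by rw [h0]; exact odd_one)
    subst hin
    have : {x | InGrid L x ∧ Kle x y ∧ krank x = 0} = {Function.update y none (y none - 1)} := by
      ext x
      simp only [Set.mem_ofPred_eq, Set.mem_singleton_iff, char]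
      constructor
      · rintro ⟨h1, rfl | rfl⟩
        · rfl
        · have := h1.1
          simp [h0] at this
      · rintro rfl
        refine ⟨hy.of_kle ((char _).2 (Or.inl rfl)).1 ?_, Or.inl rfl⟩
        simp [h0]
    rw [this, Set.ncard_singleton]
  · have hin : none ≠ i := fun h => h0 (hy.even_none.1 (h ▸ ho))
    rw [← ncard_odd_updates y i]
    congr 1
    ext x
    simp only [Set.mem_ofPred_eq, char, Set.mem_insert_iff, Set.mem_singleton_iff]
    refine ⟨fun h => h.2, fun h => ⟨hy.of_kle ((char x).2 h).1 ?_, h⟩⟩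
    have : x none = y none := by
      rcases h with rfl | rfl <;> rw [Function.update_of_ne hin]
    rw [this]; exact hy.1

/-- Ways of extending a chain upwards above a cell of codimension one. -/
lemma InGrid.ncard_above {L : ℤ} (hL : 1 ≤ L) {y : Option (A × Fin (d + 1)) → ℤ}
    (hy : InGrid L y) (hr : krank y = Fintype.card A * d) :
    {x | InGrid L x ∧ Kle y x ∧ krank x = Fintype.card A * d + 1}.ncard =
      if y none = 0 then 1 else 2 := by
  have top : ∀ x : Option (A × Fin (d + 1)) → ℤ, InGrid L x →
      krank x = Fintype.card A * d + 1 → ∀ a, evenCount x a = 1 := by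
    intro x hx hr a
    refine hx.evenCount_eq_one ?_ a
    split_ifs <;> omega
  rcases hy.1 with h0 | h1
  · rw [if_pos h0]
    have hone := hy.evenCount_eq_one (by rw [if_neg (by rw [h0]; decide)]; omega)
    have : {x | InGrid L x ∧ Kle y x ∧ krank x = Fintype.card A * d + 1} =
        {Function.update y none 1} := by
      ext x
      simp only [Set.mem_ofPred_eq, Set.mem_singleton_iff]
      constructor
      · rintro ⟨hx, hyx, hrx⟩
        obtain ⟨c, hc1, hc2, hc3, hc4⟩ := hyx.exists_update (by omega)
        rcases c with _ | ⟨a, i⟩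
        · funext l
          by_cases hl : l = none
          · subst hl; simpa using hx.even_none.1 hc2
          · rw [Function.update_of_ne hl, hc4 l hl]
        · exfalso
          obtain ⟨i', hi'⟩ := (hx.2 a).2
          have he := even_of_abs_eq hi'
          have hne : i' ≠ i := by
            rintro rfl
            exact Int.not_even_iff_odd.2 hc2 he
          have he2 : Even (y (some (a, i'))) := by
            rw [hc4 _ (by simpa using hne)]; exact he
          exact hne (Finset.card_le_one.1 (hone a).le i' (by simpa using he2) i
            (by simpa using hc1))
      · rintro rfl
        refine ⟨⟨Or.inr (by simp), fun a => ?_⟩, kle_update odd_one (by simp [h0]), ?_⟩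
        · simpa using hy.2 a
        · rw [krank_update_odd (by simp [h0]) odd_one, hr]
    rw [this, Set.ncard_singleton]
  · rw [if_neg (by omega)]
    have hsum := krank_add_sum_evenCount y
    rw [if_pos (by rw [h1]; exact odd_one), hr, mul_add, mul_one] at hsum
    obtain ⟨a, ha⟩ : ∃ a, evenCount y a ≠ 1 := by
      by_contra! hc
      rw [Finset.sum_congr rfl fun a _ => hc a] at hsum
      simp at hsum
    have ha2 : evenCount y a = 2 := by
      have hge := hy.one_le_evenCount a
      have h2 : evenCount y a + (Fintype.card A - 1) ≤ ∑ a, evenCount y a := by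
        rw [← Finset.add_sum_erase _ _ (Finset.mem_univ a)]
        refine Nat.add_le_add_left ?_ _
        calc Fintype.card A - 1 = ∑ _x ∈ Finset.univ.erase a, 1 := by
              rw [Finset.sum_const, Finset.card_erase_of_mem (Finset.mem_univ a)]; simp
          _ ≤ _ := Finset.sum_le_sum fun b _ => hy.one_le_evenCount b
      have : 0 < Fintype.card A := Fintype.card_pos_iff.2 ⟨a⟩
      omega
    obtain ⟨i, j, hij, he, hiL⟩ : ∃ i j : Fin (d + 1), i ≠ j ∧
        (∀ l, Even (y (some (a, l))) ↔ l = i ∨ l = j) ∧ |y (some (a, i))| = 2 * L := by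
      obtain ⟨i, j, hij, he⟩ := Finset.card_eq_two.1 ha2
      have he' : ∀ l, Even (y (some (a, l))) ↔ l = i ∨ l = j := fun l => by
        have := congrArg (l ∈ ·) he
        simpa using this
      obtain ⟨l, hl⟩ := (hy.2 a).2
      rcases (he' l).1 (even_of_abs_eq hl) with rfl | rfl
      · exact ⟨l, j, hij, he', hl⟩
      · exact ⟨l, i, hij.symm, fun m => by rw [he']; tauto, hl⟩
    have hei := (he i).2 (Or.inl rfl)
    have hej := (he j).2 (Or.inr rfl)
    have hjb := (hy.2 a).1 j
    set p : Option (A × Fin (d + 1)) := some (a, i) with hp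
    set q : Option (A × Fin (d + 1)) := some (a, j) with hq
    have hpq : p ≠ q := by simpa [hp, hq] using hij
    have char : ∀ x, (InGrid L x ∧ Kle y x ∧ krank x = Fintype.card A * d + 1) ↔ ∃ v,
        (x = Function.update y p v ∧ |y p - v| = 1 ∧ |v| ≤ 2 * L ∧ |y q| = 2 * L) ∨
        (x = Function.update y q v ∧ |y q - v| = 1 ∧ |v| ≤ 2 * L) := by
      intro x
      constructor
      · rintro ⟨hx, hyx, hrx⟩
        obtain ⟨c, hc1, hc2, hc3, hc4⟩ := hyx.exists_update (by omega)
        have hxu : x = Function.update y c (x c) := by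
          funext l
          by_cases hl : l = c
          · subst hl; simp
          · rw [Function.update_of_ne hl, hc4 l hl]
        obtain ⟨l, hl⟩ : ∃ l, c = some (a, l) := by
          by_contra! hc
          have h3 := top x hx hrx a
          have h4 : evenCount x a = evenCount y a := by
            have h5 : ∀ l, y (some (a, l)) = x (some (a, l)) := fun l => hc4 _ (hc l).symm
            simp only [evenCount, h5]
          omega
        subst hl
        refine ⟨x (some (a, l)), ?_⟩
        have hb := (hx.2 a).1 l
        rcases (he l).1 hc1 with rfl | rfl
        · refine Or.inl ⟨hxu, hc3, hb, ?_⟩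
          obtain ⟨m, hm⟩ := (hx.2 a).2
          have hml : m ≠ l := by
            rintro rfl
            exact Int.not_even_iff_odd.2 hc2 (even_of_abs_eq hm)
          have hym : x (some (a, m)) = y (some (a, m)) := (hc4 _ (by simpa using hml)).symm
          rw [hym] at hm
          obtain rfl := ((he m).1 (even_of_abs_eq hm)).resolve_left hml
          exact hm
        · exact Or.inr ⟨hxu, hc3, hb⟩
      · have key : ∀ l m : Fin (d + 1), l ≠ m → Even (y (some (a, l))) →
            |y (some (a, m))| = 2 * L → ∀ v, |y (some (a, l)) - v| = 1 → |v| ≤ 2 * L →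
            InGrid L (Function.update y (some (a, l)) v) ∧
            Kle y (Function.update y (some (a, l)) v) ∧
            krank (Function.update y (some (a, l)) v) = Fintype.card A * d + 1 := by
          intro l m hlm hel hm v hv hvL
          have hvo : Odd v := by
            rcases abs_sub_eq_one_iff.1 hv with rfl | rfl
            · exact hel.sub_odd odd_one
            · exact hel.add_odd odd_one
          refine ⟨⟨?_, fun b => ⟨fun l' => ?_, ?_⟩⟩, kle_update hvo hv, ?_⟩
          · simpa using hy.1
          · by_cases h : some (b, l') = some (a, l)
            · rw [h, Function.update_self]; exact hvL
            · rw [Function.update_of_ne h]; exact (hy.2 b).1 l'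
          · by_cases hb : b = a
            · subst hb
              refine ⟨m, ?_⟩
              rw [Function.update_of_ne (by simpa using hlm.symm)]; exact hm
            · obtain ⟨l', hl'⟩ := (hy.2 b).2
              refine ⟨l', ?_⟩
              rw [Function.update_of_ne (by simp [hb])]; exact hl'
          · rw [krank_update_odd hel hvo, hr]
        rintro ⟨v, ⟨rfl, h2, h3, h4⟩ | ⟨rfl, h2, h3⟩⟩
        · exact key i j hij hei h4 v h2 h3
        · exact key j i hij.symm hej hiL v h2 h3
    have inward : ∀ u : ℤ, |u| = 2 * L → ∃ v, ∀ w, (|u - w| = 1 ∧ |w| ≤ 2 * L) ↔ w = v := by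
      intro u hu
      rcases (abs_eq (by omega)).1 hu with rfl | rfl
      · exact ⟨2 * L - 1, fun w => by rw [abs_sub_eq_one_iff, abs_le]; omega⟩
      · exact ⟨-(2 * L) + 1, fun w => by rw [abs_sub_eq_one_iff, abs_le]; omega⟩
    by_cases hqL : |y q| = 2 * L
    · obtain ⟨v, hv⟩ := inward _ hiL
      obtain ⟨w, hw⟩ := inward _ hqL
      have hv1 := ((hv v).2 rfl).1
      have : {x | InGrid L x ∧ Kle y x ∧ krank x = Fintype.card A * d + 1} =
          {Function.update y p v, Function.update y q w} := by
        ext x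
        simp only [Set.mem_ofPred_eq, Set.mem_insert_iff, Set.mem_singleton_iff]
        rw [char]
        constructor
        · rintro ⟨u, ⟨rfl, h2, h3, -⟩ | ⟨rfl, h2, h3⟩⟩
          · rw [(hv u).1 ⟨h2, h3⟩]; exact Or.inl rfl
          · rw [(hw u).1 ⟨h2, h3⟩]; exact Or.inr rfl
        · rintro (rfl | rfl)
          · exact ⟨v, Or.inl ⟨rfl, ((hv v).2 rfl).1, ((hv v).2 rfl).2, hqL⟩⟩
          · exact ⟨w, Or.inr ⟨rfl, (hw w).2 rfl⟩⟩
      rw [this, Set.ncard_pair]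
      intro h
      have := congrFun h p
      rw [Function.update_self, Function.update_of_ne hpq] at this
      rw [this] at hv1
      simp at hv1
    · have hlt : |y q| < 2 * L := lt_of_le_of_ne hjb hqL
      have hpar := hej.two_dvd
      rw [← ncard_odd_updates y q]
      congr 1
      ext x
      simp only [Set.mem_ofPred_eq, Set.mem_insert_iff, Set.mem_singleton_iff]
      rw [char]
      rw [abs_lt] at hlt
      constructor
      · rintro ⟨u, ⟨-, -, -, h⟩ | ⟨rfl, h2, h3⟩⟩
        · exact absurd h hqL
        · rcases abs_sub_eq_one_iff.1 h2 with rfl | rfl <;> simp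
      · rintro (rfl | rfl)
        · exact ⟨_, Or.inr ⟨rfl, by simp, by rw [abs_le]; omega⟩⟩
        · exact ⟨_, Or.inr ⟨rfl, by simp, by rw [abs_le]; omega⟩⟩

end GridComplex

section GridChain

/-- Finite chains for the Khalimsky order. -/
def KChain {ι : Type*} (t : Finset (ι → ℤ)) : Prop := ∀ x ∈ t, ∀ y ∈ t, Kle x y ∨ Kle y x

lemma KChain.mono {ι : Type*} {s t : Finset (ι → ℤ)} (hts : t ⊆ s) (hs : KChain s) : KChain t :=
  fun x hx y hy => hs x (hts hx) y (hts hy)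

lemma kle_of_krank_le {ι : Type*} [Fintype ι] {x y : ι → ℤ} (h : Kle x y ∨ Kle y x)
    (hr : krank x ≤ krank y) : Kle x y := by
  rcases h with h | h
  · exact h
  · rw [h.eq_of_krank_le hr]; exact Kle.refl _

lemma KChain.eq_of_krank_eq {ι : Type*} [Fintype ι] {t : Finset (ι → ℤ)} (ht : KChain t)
    {x y : ι → ℤ} (hx : x ∈ t) (hy : y ∈ t) (hr : krank x = krank y) : x = y :=
  (kle_of_krank_le (ht x hx y hy) hr.le).eq_of_krank_le hr.ge

variable {A : Type*} [Fintype A] [DecidableEq A] {d : ℕ}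

/-- Number of extensions of a codimension-one chain of the grid: boundary chains lie in one of the
two ends of the interval factor. -/
lemma KChain.ncard_extensions {L : ℤ} (hL : 1 ≤ L)
    {t : Finset (Option (A × Fin (d + 1)) → ℤ)} (ht : ∀ x ∈ t, InGrid L x) (hc : KChain t)
    (hcard : t.card = Fintype.card A * d + 1)
    [Decidable ((∀ x ∈ t, x none = 0) ∨ ∀ x ∈ t, x none = 1)] :
    {x | InGrid L x ∧ x ∉ t ∧ KChain (insert x t)}.ncard =
      if (∀ x ∈ t, x none = 0) ∨ (∀ x ∈ t, x none = 1) then 1 else 2 := by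
  classical
  set D := Fintype.card A * d with hD
  have hinj : Set.InjOn krank (t : Set (Option (A × Fin (d + 1)) → ℤ)) :=
    fun x hx y hy h => hc.eq_of_krank_eq hx hy h
  have himg : t.image krank ⊆ Finset.range (D + 2) := by
    intro r hr
    obtain ⟨x, hx, rfl⟩ := Finset.mem_image.1 hr
    have := (ht x hx).krank_le
    simp only [Finset.mem_range]; omega
  obtain ⟨j, hj⟩ := Finset.card_eq_one.1
    (show (Finset.range (D + 2) \ t.image krank).card = 1 by
      rw [Finset.card_sdiff_of_subset himg, Finset.card_image_of_injOn hinj, hcard]; simp)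
  have hj' : ∀ r, (r < D + 2 ∧ ∀ x ∈ t, krank x ≠ r) ↔ r = j := fun r => by
    have := congrArg (r ∈ ·) hj
    simpa using this
  obtain ⟨hjD, hjt⟩ := (hj' j).2 rfl
  have hex : ∀ r, r < D + 2 → r ≠ j → ∃ x ∈ t, krank x = r := by
    intro r hr hrj
    by_contra! h
    exact hrj ((hj' r).1 ⟨hr, h⟩)
  have hset : {x | InGrid L x ∧ x ∉ t ∧ KChain (insert x t)} =
      {x | InGrid L x ∧ krank x = j ∧ ∀ u ∈ t, Kle u x ∨ Kle x u} := by
    ext x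
    simp only [Set.mem_ofPred_eq]
    constructor
    · rintro ⟨h1, h2, h3⟩
      have hcmp : ∀ u ∈ t, Kle u x ∨ Kle x u := fun u hu =>
        h3 u (Finset.mem_insert_of_mem hu) x (Finset.mem_insert_self _ _)
      refine ⟨h1, (hj' _).1 ⟨by have := h1.krank_le; omega, fun u hu hux => h2 ?_⟩, hcmp⟩
      rw [← (kle_of_krank_le (hcmp u hu) hux.le).eq_of_krank_le hux.ge]
      exact hu
    · rintro ⟨h1, h2, h3⟩
      refine ⟨h1, fun hx => hjt x hx h2, ?_⟩
      intro u hu v hv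
      rcases Finset.mem_insert.1 hu with rfl | hu' <;> rcases Finset.mem_insert.1 hv with rfl | hv'
      · exact Or.inl (Kle.refl _)
      · exact (h3 v hv').symm
      · exact h3 u hu'
      · exact hc u hu' v hv'
  rw [hset]
  -- the chain contains points of low and high rank unless they are missing
  have hlow : j ≠ 0 → ¬ ∀ x ∈ t, x none = 1 := by
    intro hj0 hall
    obtain ⟨u, hu, hu0⟩ := hex 0 (by omega) hj0.symm
    have : none ∉ Finset.univ.filter (fun i => Odd (u i)) := by
      rw [Finset.card_eq_zero.1 hu0]; simp
    exact this (by simp [hall u hu])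
  have hhigh : j ≠ D + 1 → ¬ ∀ x ∈ t, x none = 0 := by
    intro hj0 hall
    obtain ⟨u, hu, hu0⟩ := hex (D + 1) (by omega) hj0.symm
    have h1 := krank_add_sum_evenCount u
    have h2 : ∑ _a : A, 1 ≤ ∑ a, evenCount u a :=
      Finset.sum_le_sum fun a _ => (ht u hu).one_le_evenCount a
    rw [if_neg (by rw [hall u hu]; decide), mul_add, mul_one] at h1
    simp only [Finset.sum_const, Finset.card_univ, smul_eq_mul, mul_one] at h2
    omega
  by_cases hj0 : j = 0
  · subst hj0
    obtain ⟨y, hy, hyr⟩ := hex 1 (by omega) (by omega)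
    have hyle : ∀ u ∈ t, Kle y u := by
      intro u hu
      refine kle_of_krank_le (hc y hy u hu) ?_
      have := hjt u hu
      omega
    have : {x | InGrid L x ∧ krank x = 0 ∧ ∀ u ∈ t, Kle u x ∨ Kle x u} =
        {x | InGrid L x ∧ Kle x y ∧ krank x = 0} := by
      ext x
      simp only [Set.mem_ofPred_eq]
      constructor
      · rintro ⟨h1, h2, h3⟩
        exact ⟨h1, kle_of_krank_le (h3 y hy).symm (by omega), h2⟩
      · rintro ⟨h1, h2, h3⟩
        exact ⟨h1, h3, fun u hu => Or.inr (h2.trans (hyle u hu))⟩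
    rw [this, (ht y hy).ncard_below hyr]
    congr 1
    rw [eq_iff_iff]
    constructor
    · intro h
      refine Or.inr fun u hu => ?_
      rw [← (hyle u hu).eq_of_odd (by rw [h]; exact odd_one), h]
    · rintro (h | h)
      · exact absurd h (hhigh (by omega))
      · exact h y hy
  by_cases hj1 : j = D + 1
  · subst hj1
    obtain ⟨y, hy, hyr⟩ := hex D (by omega) (by omega)
    have hyle : ∀ u ∈ t, Kle u y := by
      intro u hu
      refine kle_of_krank_le (hc u hu y hy) ?_
      have := hjt u hu
      have := (ht u hu).krank_le
      omega
    have : {x | InGrid L x ∧ krank x = D + 1 ∧ ∀ u ∈ t, Kle u x ∨ Kle x u} =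
        {x | InGrid L x ∧ Kle y x ∧ krank x = D + 1} := by
      ext x
      simp only [Set.mem_ofPred_eq]
      constructor
      · rintro ⟨h1, h2, h3⟩
        exact ⟨h1, kle_of_krank_le (h3 y hy) (by omega), h2⟩
      · rintro ⟨h1, h2, h3⟩
        exact ⟨h1, h3, fun u hu => Or.inl ((hyle u hu).trans h2)⟩
    rw [this, (ht y hy).ncard_above hL hyr]
    congr 1
    rw [eq_iff_iff]
    constructor
    · intro h
      refine Or.inl fun u hu => ?_
      rw [(hyle u hu).eq_of_even (by rw [h]; decide), h]
    · rintro (h | h)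
      · exact h y hy
      · exact absurd h (hlow (by omega))
  · rw [if_neg (not_or.2 ⟨hhigh hj1, hlow hj0⟩)]
    obtain ⟨y, hy, hyr⟩ := hex (j - 1) (by omega) (by omega)
    obtain ⟨z, hz, hzr⟩ := hex (j + 1) (by omega) (by omega)
    have hyz : Kle y z := kle_of_krank_le (hc y hy z hz) (by omega)
    rw [← hyz.ncard_between (by omega)]
    congr 1
    ext x
    simp only [Set.mem_ofPred_eq]
    constructor
    · rintro ⟨h1, h2, h3⟩
      exact ⟨kle_of_krank_le (h3 y hy) (by omega), kle_of_krank_le (h3 z hz).symm (by omega),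
        by omega⟩
    · rintro ⟨h1, h2, h3⟩
      refine ⟨(ht z hz).of_kle h2 ?_, by omega, fun u hu => ?_⟩
      · rcases h2 none with h | h
        · rw [h]; exact (ht z hz).1
        · rw [← h1.eq_of_even (even_of_abs_sub_eq_one h.1 h.2)]; exact (ht y hy).1
      · rcases lt_or_ge (krank u) j with h | h
        · exact Or.inl ((kle_of_krank_le (hc u hu y hy) (by omega)).trans h1)
        · have := hjt u hu
          exact Or.inr (h2.trans (kle_of_krank_le (hc z hz u hu) (by omega)))

end GridChain

section TreeGrid

open TreeNode TreeGroup

variable {k d : ℕ}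

lemma TreeGroup.move_injective (g : TreeGroup k) : Function.Injective (move g.mark) := by
  intro a b h
  have key : ∀ a, move g⁻¹.mark (move g.mark a) = a := fun a => by
    rw [← move_mul_mark, mul_inv_cancel, move_one_mark]
  rw [← key a, h, key b]

lemma TreeGroup.act_apply {X : Type*} [Neg X] (g : TreeGroup k) (c : TreeNode k → X)
    (a : TreeNode k) : act g c a = if g.mark a then -c (move g.mark a) else c (move g.mark a) := rfl

instance gridAction : MulAction (TreeGroup k) (Option (TreeNode k × Fin (d + 1)) → ℤ) where
  smul g z := fun o => match o with
    | none => z none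
    | some (a, i) => act g (fun b => z (some (b, i))) a
  one_smul z := by
    funext o
    rcases o with _ | ⟨a, i⟩
    · rfl
    · exact congrFun (act_one _) a
  mul_smul g h z := by
    funext o
    rcases o with _ | ⟨a, i⟩
    · rfl
    · exact congrFun (act_mul g h _) a

lemma grid_smul_none (g : TreeGroup k) (z : Option (TreeNode k × Fin (d + 1)) → ℤ) :
    (g • z) none = z none := rfl

lemma grid_smul_eq (g : TreeGroup k) (z : Option (TreeNode k × Fin (d + 1)) → ℤ)
    (a : TreeNode k) (i : Fin (d + 1)) :
    (g • z) (some (a, i)) =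
      if g.mark a then -z (some (move g.mark a, i)) else z (some (move g.mark a, i)) := rfl

lemma InGrid.smul {L : ℤ} {z : Option (TreeNode k × Fin (d + 1)) → ℤ} (hz : InGrid L z)
    (g : TreeGroup k) : InGrid L (g • z) := by
  have : ∀ a i, |(g • z) (some (a, i))| = |z (some (move g.mark a, i))| := by
    intro a i
    rw [grid_smul_eq]
    split_ifs <;> simp
  refine ⟨hz.1, fun a => ?_⟩
  simp only [this]
  exact hz.2 _

lemma Kle.smul {x y : Option (TreeNode k × Fin (d + 1)) → ℤ} (h : Kle x y) (g : TreeGroup k) :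
    Kle (g • x) (g • y) := by
  intro o
  rcases o with _ | ⟨a, i⟩
  · exact h none
  · rw [grid_smul_eq, grid_smul_eq]
    have := h (some (move g.mark a, i))
    split_ifs
    · rw [neg_inj, odd_neg, ← abs_neg]
      convert this using 4
      ring
    · exact this

lemma krank_smul_le (g : TreeGroup k) (z : Option (TreeNode k × Fin (d + 1)) → ℤ) :
    krank (g • z) ≤ krank z := by
  refine Finset.card_le_card_of_injOn (Option.map fun p => (move g.mark p.1, p.2)) ?_ ?_
  · intro o ho
    rcases o with _ | ⟨a, i⟩
    · simpa [grid_smul_none] using ho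
    · simp only [Finset.coe_filter, Finset.mem_univ, true_and, Set.mem_ofPred_eq,
        grid_smul_eq] at ho
      simp only [Finset.coe_filter, Finset.mem_univ, true_and, Set.mem_ofPred_eq, Option.map_some]
      split_ifs at ho
      · simpa using ho
      · exact ho
  · refine (Option.map_injective ?_).injOn
    rintro ⟨a, i⟩ ⟨b, j⟩ h
    simp only [Prod.mk.injEq] at h
    rw [g.move_injective h.1, h.2]

lemma grid_free {L : ℤ} (hL : 1 ≤ L) {z : Option (TreeNode k × Fin (d + 1)) → ℤ}
    (hz : InGrid L z) {g : TreeGroup k} (h : g • z = z) : g = 1 := by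
  refine eq_one_of_act_eq g (fun a i => z (some (a, i))) (fun a ha => ?_) ?_
  · obtain ⟨i, hi⟩ := (hz.2 a).2
    have h1 := congrFun ha i
    simp only [Pi.neg_apply] at h1
    have : z (some (a, i)) = 0 := by omega
    rw [this] at hi
    simp at hi
    omega
  · funext a i
    have := congrFun h (some (a, i))
    rw [grid_smul_eq] at this
    rw [act_apply]
    split_ifs at this ⊢ <;> exact this

lemma grid_smul_eq_of_comparable {x : Option (TreeNode k × Fin (d + 1)) → ℤ} {g : TreeGroup k}
    (h : Kle (g • x) x ∨ Kle x (g • x)) : g • x = x := by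
  have h1 : krank x ≤ krank (g • x) := by
    have := krank_smul_le g⁻¹ (g • x)
    rwa [inv_smul_smul] at this
  have h2 := krank_smul_le g x
  exact (kle_of_krank_le h h2).eq_of_krank_le h1

/-- Lexicographic negativity of an integer vector. -/
def LexNeg (v : Fin (d + 1) → ℤ) : Prop := ∃ i, v i < 0 ∧ ∀ j < i, v j = 0

lemma lexNeg_neg {v : Fin (d + 1) → ℤ} (hv : v ≠ 0) : LexNeg (-v) ↔ ¬ LexNeg v := by
  obtain ⟨i, hi, hmin⟩ : ∃ i, v i ≠ 0 ∧ ∀ j < i, v j = 0 := by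
    classical
    obtain ⟨i, hi⟩ := Function.ne_iff.1 hv
    obtain ⟨m, hm, hmin⟩ := (Finset.univ.filter (fun i => v i ≠ 0)).exists_minimal
      ⟨i, by simpa using hi⟩
    refine ⟨m, by simpa using hm, fun j hj => ?_⟩
    by_contra hne
    exact absurd (hmin (by simpa using hne) hj.le) (not_le.2 hj)
  have key : ∀ u : Fin (d + 1) → ℤ, u i ≠ 0 → (∀ j < i, u j = 0) → (LexNeg u ↔ u i < 0) := by
    intro u hu h
    constructor
    · rintro ⟨l, hl, hl'⟩
      rcases lt_trichotomy l i with h1 | rfl | h1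
      · exact absurd (h l h1) hl.ne
      · exact hl
      · exact absurd (hl' i h1) hu
    · exact fun h' => ⟨i, h', h⟩
  rw [key v hi hmin, key (-v) (by simpa using hi) (fun j hj => by simp [hmin j hj])]
  simp only [Pi.neg_apply]
  omega

open Classical in
/-- The marking of the nodes at which a grid point is lexicographically negative. -/
noncomputable def signMark (z : Option (TreeNode k × Fin (d + 1)) → ℤ) : TreeGroup k :=
  ⟨fun a => decide (LexNeg fun i => z (some (a, i)))⟩

lemma signMark_smul {L : ℤ} (hL : 1 ≤ L) {z : Option (TreeNode k × Fin (d + 1)) → ℤ}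
    (hz : InGrid L z) (g : TreeGroup k) : signMark (g • z) = g * signMark z := by
  classical
  ext a
  rw [mul_mark]
  have hne : (fun i => z (some (move g.mark a, i))) ≠ 0 := by
    intro h
    obtain ⟨i, hi⟩ := (hz.2 (move g.mark a)).2
    have := congrFun h i
    simp only [Pi.zero_apply] at this
    rw [this] at hi
    simp at hi
    omega
  by_cases hg : g.mark a = true
  · have he : (fun i => (g • z) (some (a, i))) = -fun i => z (some (move g.mark a, i)) := by
      funext i
      simp [grid_smul_eq, hg]
    have := lexNeg_neg hne
    rw [← he] at this
    rw [hg, Bool.true_xor]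
    exact (decide_eq_decide.2 this).trans decide_not
  · have he : (fun i => (g • z) (some (a, i))) = fun i => z (some (move g.mark a, i)) := by
      funext i
      simp [grid_smul_eq, hg]
    rw [Bool.not_eq_true] at hg
    rw [hg, Bool.false_xor]
    exact decide_eq_decide.2 (by rw [he])

/-- The action of the tree group on real configurations, as linear maps. -/
def actLin (d : ℕ) (g : TreeGroup k) : (TreeNode k → Fin d → ℝ) →ₗ[ℝ] (TreeNode k → Fin d → ℝ) where
  toFun := act g
  map_add' u v := by
    funext a i
    simp only [act_apply, Pi.add_apply]
    split_ifs
    · simp; ring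
    · rfl
  map_smul' c v := by
    funext a i
    simp only [act_apply, Pi.smul_apply, RingHom.id_apply]
    split_ifs <;> simp

lemma actLin_apply (g : TreeGroup k) (v : TreeNode k → Fin d → ℝ) : actLin d g v = act g v := rfl

lemma norm_actLin_le (g : TreeGroup k) (v : TreeNode k → Fin d → ℝ) : ‖actLin d g v‖ ≤ ‖v‖ := by
  rw [pi_norm_le_iff_of_nonneg (norm_nonneg _)]
  intro a
  rw [actLin_apply, act_apply]
  split_ifs
  · rw [norm_neg]; exact norm_le_pi_norm v _
  · exact norm_le_pi_norm v _

end TreeGrid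

section BaseMap

open TreeNode TreeGroup

lemma sum_mul_pos_of_weights {α : Type*} {t : Finset α} {w c : α → ℝ} (h0 : ∀ i ∈ t, 0 ≤ w i)
    (h1 : ∑ i ∈ t, w i = 1) (hc : ∀ i ∈ t, 0 < c i) : 0 < ∑ i ∈ t, w i * c i := by
  obtain ⟨i, hi, hwi⟩ : ∃ i ∈ t, w i ≠ 0 := by
    by_contra! h
    rw [Finset.sum_eq_zero h] at h1
    exact zero_ne_one h1
  exact Finset.sum_pos' (fun j hj => mul_nonneg (h0 j hj) (hc j hj).le)
    ⟨i, hi, mul_pos (lt_of_le_of_ne (h0 i hi) hwi.symm) (hc i hi)⟩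

lemma mem_upperSet_iff_of_card {P : Type*} [Fintype P] {D : ℕ} (e : P ≃ Fin D) {O : Finset P}
    (hO : ∀ p ∈ O, ∀ p', e p ≤ e p' → p' ∈ O) (p : P) : p ∈ O ↔ D ≤ e p + O.card := by
  classical
  constructor
  · intro hp
    have : (Finset.Ici (e p)).map e.symm.toEmbedding ⊆ O := by
      intro p' hp'
      simp only [Finset.mem_map_equiv, Equiv.symm_symm, Finset.mem_Ici] at hp'
      exact hO p hp p' hp'
    have h := Finset.card_le_card this
    rw [Finset.card_map, Fin.card_Ici] at h
    omega
  · intro h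
    by_contra hp
    have : O ⊆ (Finset.Ioi (e p)).map e.symm.toEmbedding := by
      intro p' hp'
      simp only [Finset.mem_map_equiv, Equiv.symm_symm, Finset.mem_Ioi]
      by_contra hle
      exact hp (hO p' hp' p (not_lt.1 hle))
    have h := Finset.card_le_card this
    rw [Finset.card_map, Fin.card_Ioi] at h
    have := (e p).2
    omega

lemma lexNeg_iff_of_ne {d : ℕ} {v : Fin (d + 1) → ℤ} (hv : v 0 ≠ 0) : LexNeg v ↔ v 0 < 0 := by
  constructor
  · rintro ⟨i, hi, hi'⟩
    by_cases h : i = 0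
    · exact h ▸ hi
    · exact absurd (hi' 0 (Fin.pos_of_ne_zero h)) hv
  · exact fun h => ⟨0, h, fun j hj => absurd hj (Fin.not_lt_zero j)⟩

variable {k d D : ℕ} (e : TreeNode k × Fin d ≃ Fin D)

/-- Distinct values in `(0,1)`, indexed by the coordinates at all nodes. -/
noncomputable def distinctValues (a : TreeNode k) (i : Fin d) : ℝ := ((e (a, i) : ℕ) + 1) / (D + 1)

lemma distinctValues_pos (a : TreeNode k) (i : Fin d) : 0 < distinctValues e a i := by
  unfold distinctValues; positivity

lemma distinctValues_lt_one (a : TreeNode k) (i : Fin d) : distinctValues e a i < 1 := by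
  unfold distinctValues
  rw [div_lt_one (by positivity)]
  have := (e (a, i)).2
  have : ((e (a, i) : ℕ) : ℝ) < D := by exact_mod_cast this
  linarith

/-- An equivariant piecewise linear map with exactly one orbit of zeros, all of them regular: it
forgets the first coordinate at each node and subtracts a fixed point with distinct coordinates. -/
noncomputable def baseMap (z : Option (TreeNode k × Fin (d + 1)) → ℤ) : TreeNode k → Fin d → ℝ :=
  (fun a i => (z (some (a, i.succ)) : ℝ)) - act (signMark z) (distinctValues e)

lemma baseMap_smul {L : ℤ} (hL : 1 ≤ L) {z : Option (TreeNode k × Fin (d + 1)) → ℤ}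
    (hz : InGrid L z) (g : TreeGroup k) : baseMap e (g • z) = actLin d g (baseMap e z) := by
  rw [baseMap, signMark_smul hL hz, act_mul, baseMap, map_sub, actLin_apply, actLin_apply]
  congr 1
  funext a i
  rw [grid_smul_eq, act_apply]
  split_ifs <;> simp

lemma signMark_mark_eq {z : Option (TreeNode k × Fin (d + 1)) → ℤ} {a : TreeNode k}
    (h : z (some (a, 0)) ≠ 0) : (signMark z).mark a = true ↔ z (some (a, 0)) < 0 := by
  simp only [signMark, decide_eq_true_eq]
  exact lexNeg_iff_of_ne (v := fun i => z (some (a, i))) h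

/-- The vertices of the simplex carrying the zero of `baseMap` with sign pattern `η`. -/
def stdPoint (L : ℤ) (η : TreeGroup k) (c : ℕ) : Option (TreeNode k × Fin (d + 1)) → ℤ
  | none => 0
  | some (a, i) => Fin.cases (if η.mark a then -(2 * L) else 2 * L)
      (fun i => if D ≤ e (move η.mark a, i) + c then (if η.mark a then -1 else 1) else 0) i

lemma stdPoint_zero (L : ℤ) (η : TreeGroup k) (c : ℕ) (a : TreeNode k) :
    stdPoint e L η c (some (a, 0)) = if η.mark a then -(2 * L) else 2 * L := rfl

lemma stdPoint_succ (L : ℤ) (η : TreeGroup k) (c : ℕ) (a : TreeNode k) (i : Fin d) :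
    stdPoint e L η c (some (a, i.succ)) =
      if D ≤ e (move η.mark a, i) + c then (if η.mark a then -1 else 1) else 0 := rfl

/-- The simplex carrying the zero of `baseMap` with sign pattern `η`. -/
noncomputable def stdChain (L : ℤ) (η : TreeGroup k) :
    Finset (Option (TreeNode k × Fin (d + 1)) → ℤ) := by
  classical exact (Finset.range (D + 1)).image (stdPoint e L η)

lemma mem_stdChain {L : ℤ} {η : TreeGroup k} {z : Option (TreeNode k × Fin (d + 1)) → ℤ} :
    z ∈ stdChain e L η ↔ ∃ c < D + 1, stdPoint e L η c = z := by
  classical simp [stdChain]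

lemma krank_eq_card_succ {z : Option (TreeNode k × Fin (d + 1)) → ℤ} (h0 : Even (z none))
    (hz : ∀ a, Even (z (some (a, 0)))) :
    krank z = (Finset.univ.filter (fun p : TreeNode k × Fin d =>
      Odd (z (some (p.1, p.2.succ))))).card := by
  rw [krank]
  symm
  refine Finset.card_bij (fun p _ => some (p.1, p.2.succ)) ?_ ?_ ?_
  · intro p hp
    simpa using hp
  · rintro ⟨a, i⟩ _ ⟨b, j⟩ _ h
    simpa using h
  · intro o ho
    simp only [Finset.mem_filter, Finset.mem_univ, true_and] at ho
    rcases o with _ | ⟨a, i⟩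
    · exact absurd h0 (Int.not_even_iff_odd.2 ho)
    · refine Fin.cases (fun ho => ?_) (fun i ho => ?_) i ho
      · exact absurd (hz a) (Int.not_even_iff_odd.2 ho)
      · exact ⟨(a, i), by simpa using ho, rfl⟩

/-- The enumeration of coordinates, transported by a tree automorphism. -/
noncomputable def moveEnum (η : TreeGroup k) : TreeNode k × Fin d ≃ Fin D :=
  (Equiv.prodCongr (Equiv.ofBijective _ (Finite.injective_iff_bijective.1 η.move_injective))
    (Equiv.refl _)).trans e

lemma moveEnum_apply (η : TreeGroup k) (p : TreeNode k × Fin d) :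
    moveEnum e η p = e (move η.mark p.1, p.2) := rfl

/-- Chains in the lower end whose convex hull is mapped onto the origin by `baseMap`. -/
theorem covering_chain_baseMap {L : ℤ} (hL : 1 ≤ L)
    {t : Finset (Option (TreeNode k × Fin (d + 1)) → ℤ)} (ht : ∀ z ∈ t, InGrid L z)
    (h0 : ∀ z ∈ t, z none = 0) (hc : KChain t) (hcov : Cov (baseMap e) t) :
    D + 1 ≤ t.card ∧ ∃ η, t ⊆ stdChain e L η := by
  classical
  obtain ⟨w, hw0, hw1, hw⟩ := hcov
  have hdiff : ∀ x ∈ t, ∀ y ∈ t, ∀ o, |x o - y o| ≤ 1 := by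
    intro x hx y hy o
    rcases hc x hx y hy with h | h
    · exact h.abs_sub_le o
    · rw [abs_sub_comm]; exact h.abs_sub_le o
  have hcoord : ∀ a i, ∑ z ∈ t, w z *
      ((z (some (a, Fin.succ i)) : ℝ) - act (signMark z) (distinctValues e) a i) = 0 := by
    intro a i
    have := congrFun (congrFun hw a) i
    simpa [baseMap, Finset.sum_apply] using this
  have hact : ∀ (g : TreeGroup k) a i, |act g (distinctValues e) a i| < 1 := by
    intro g a i
    rw [act_apply]
    have h1 := distinctValues_pos e (move g.mark a) i
    have h2 := distinctValues_lt_one e (move g.mark a) i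
    split_ifs
    · rw [Pi.neg_apply, abs_neg, abs_of_pos h1]; exact h2
    · rw [abs_of_pos h1]; exact h2
  have hsmall : ∀ z ∈ t, ∀ a (i : Fin d), |z (some (a, i.succ))| ≤ 1 := by
    intro z hz a i
    by_contra! hlt
    rcases lt_abs.1 hlt with h | h
    · have := sum_mul_pos_of_weights hw0 hw1 (c := fun z => (z (some (a, Fin.succ i)) : ℝ) -
        act (signMark z) (distinctValues e) a i) (fun x hx => by
          have h1 := abs_le.1 (hdiff z hz x hx (some (a, i.succ)))
          have h2 : (1 : ℝ) ≤ x (some (a, i.succ)) := by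
            have : 1 ≤ x (some (a, i.succ)) := by omega
            exact_mod_cast this
          have h3 := abs_lt.1 (hact (signMark x) a i)
          linarith)
      exact this.ne' (hcoord a i)
    · have := sum_mul_pos_of_weights hw0 hw1 (c := fun z => -((z (some (a, Fin.succ i)) : ℝ) -
        act (signMark z) (distinctValues e) a i)) (fun x hx => by
          have h1 := abs_le.1 (hdiff z hz x hx (some (a, i.succ)))
          have h2 : (x (some (a, i.succ)) : ℝ) ≤ -1 := by
            have : x (some (a, i.succ)) ≤ -1 := by omega
            exact_mod_cast this
          have h3 := abs_lt.1 (hact (signMark x) a i)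
          linarith)
      simp only [mul_neg, Finset.sum_neg_distrib] at this
      linarith [hcoord a i]
  have hheight : ∀ z ∈ t, ∀ a, |z (some (a, 0))| = 2 * L := by
    intro z hz a
    obtain ⟨i, hi⟩ := ((ht z hz).2 a).2
    refine Fin.cases (fun hi => hi) (fun i hi => ?_) i hi
    have := hsmall z hz a i
    omega
  have htne : t.Nonempty := by
    rw [Finset.nonempty_iff_ne_empty]
    rintro rfl
    simp at hw1
  obtain ⟨z₀, hz₀⟩ := htne
  set η := signMark z₀ with hη
  have hne0 : ∀ z ∈ t, ∀ a, z (some (a, 0)) ≠ 0 := by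
    intro z hz a h
    have := hheight z hz a
    rw [h] at this
    simp at this
    omega
  have hheq : ∀ z ∈ t, ∀ a, z (some (a, 0)) = if η.mark a then -(2 * L) else 2 * L := by
    intro z hz a
    have h1 := hheight z hz a
    have h2 := hheight z₀ hz₀ a
    have h3 := abs_le.1 (hdiff z hz z₀ hz₀ (some (a, 0)))
    have h4 := signMark_mark_eq (hne0 z₀ hz₀ a)
    rw [abs_eq (by omega)] at h1 h2
    split_ifs with hm
    · have := h4.1 hm
      omega
    · have : ¬ z₀ (some (a, 0)) < 0 := fun h => hm (h4.2 h)
      omega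
  have hsign : ∀ z ∈ t, signMark z = η := by
    intro z hz
    ext a
    rw [Bool.eq_iff_iff, hη, signMark_mark_eq (hne0 z hz a), signMark_mark_eq (hne0 z₀ hz₀ a),
      hheq z hz, hheq z₀ hz₀]
  set s : TreeNode k → ℤ := fun a => if η.mark a then -1 else 1 with hs
  have hss : ∀ a, s a * s a = 1 := by intro a; simp only [hs]; split_ifs <;> norm_num
  set r : TreeNode k × Fin d → ℝ := fun p => distinctValues e (move η.mark p.1) p.2 with hr
  have hsum : ∀ a i, ∑ z ∈ t, w z * ((s a : ℝ) * z (some (a, Fin.succ i))) = r (a, i) := by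
    intro a i
    have h1 := hcoord a i
    simp only [mul_sub, Finset.sum_sub_distrib] at h1
    have h3 : ∑ z ∈ t, w z * act (signMark z) (distinctValues e) a i =
        act η (distinctValues e) a i := by
      have : ∀ z ∈ t, w z * act (signMark z) (distinctValues e) a i =
        w z * act η (distinctValues e) a i := fun z hz => by rw [hsign z hz]
      rw [Finset.sum_congr rfl this, ← Finset.sum_mul, hw1, one_mul]
    rw [sub_eq_zero, h3, act_apply] at h1
    have h2 : ∑ z ∈ t, w z * ((s a : ℝ) * z (some (a, Fin.succ i))) =
        s a * ∑ z ∈ t, w z * z (some (a, Fin.succ i)) := by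
      rw [Finset.mul_sum]
      exact Finset.sum_congr rfl fun z _ => by ring
    rw [h2, h1]
    simp only [hs, hr]
    split_ifs <;> simp
  have hvals : ∀ z ∈ t, ∀ a (i : Fin d), z (some (a, i.succ)) = 0 ∨ z (some (a, i.succ)) = s a := by
    intro z hz a i
    obtain ⟨x, hx, hxp⟩ : ∃ x ∈ t, 0 < s a * x (some (a, i.succ)) := by
      by_contra! hcon
      have h1 : ∑ z ∈ t, w z * ((s a : ℝ) * z (some (a, Fin.succ i))) ≤ 0 := by
        refine Finset.sum_nonpos fun x hx => mul_nonpos_of_nonneg_of_nonpos (hw0 x hx) ?_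
        exact_mod_cast hcon x hx
      rw [hsum] at h1
      exact absurd h1 (not_le.2 (distinctValues_pos e _ _))
    have h1 := abs_le.1 (hsmall z hz a i)
    have h2 := abs_le.1 (hsmall x hx a i)
    have h3 := abs_le.1 (hdiff z hz x hx (some (a, i.succ)))
    simp only [hs] at hxp ⊢
    split_ifs at hxp ⊢ <;> omega
  have hodd : ∀ z ∈ t, ∀ a (i : Fin d), z (some (a, i.succ)) ≠ 0 ↔ Odd (z (some (a, i.succ))) := by
    intro z hz a i
    rcases hvals z hz a i with h | h
    · rw [h]; decide
    · rw [h]; simp only [hs]; split_ifs <;> decide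
  have hmeas : ∀ p : TreeNode k × Fin d,
      ∑ z ∈ t with z (some (p.1, p.2.succ)) ≠ 0, w z = r p := by
    rintro ⟨a, i⟩
    rw [← hsum a i, Finset.sum_filter]
    refine Finset.sum_congr rfl fun z hz => ?_
    rcases hvals z hz a i with h | h
    · simp [h]
    · have h1 : s a ≠ 0 := fun h0 => by have := hss a; rw [h0] at this; simp at this
      have h2 : (s a : ℝ) * s a = 1 := by exact_mod_cast hss a
      rw [h, if_pos h1, h2, mul_one]
  have hrle : ∀ p p', moveEnum e η p ≤ moveEnum e η p' ↔ r p ≤ r p' := by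
    intro p p'
    simp only [hr, distinctValues]
    rw [div_le_div_iff_of_pos_right (by positivity), add_le_add_iff_right, Nat.cast_le]
    rfl
  have hnest : ∀ p p' : TreeNode k × Fin d, moveEnum e η p ≤ moveEnum e η p' → ∀ z ∈ t,
      z (some (p.1, p.2.succ)) ≠ 0 → z (some (p'.1, p'.2.succ)) ≠ 0 := by
    intro p p' hpp z hz h1
    by_contra h2
    have hsub : t.filter (fun z => z (some (p'.1, p'.2.succ)) ≠ 0) ⊆
        t.filter (fun z => z (some (p.1, p.2.succ)) ≠ 0) := by
      intro x hx
      simp only [Finset.mem_filter] at hx ⊢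
      refine ⟨hx.1, ?_⟩
      rcases hc x hx.1 z hz with h | h
      · exact absurd h2 ((hodd z hz _ _).2 (h.odd ((hodd x hx.1 _ _).1 hx.2)))
      · exact (hodd x hx.1 _ _).2 (h.odd ((hodd z hz _ _).1 h1))
    have hle := Finset.sum_le_sum_of_subset_of_nonneg hsub
      (f := w) fun x hx _ => hw0 x (Finset.mem_filter.1 hx).1
    rw [hmeas, hmeas] at hle
    have heq : p = p' := (moveEnum e η).injective (le_antisymm hpp ((hrle p' p).2 hle))
    subst heq
    exact h1 h2
  have hkr : ∀ z ∈ t, krank z = (Finset.univ.filter (fun p : TreeNode k × Fin d =>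
      z (some (p.1, p.2.succ)) ≠ 0)).card := by
    intro z hz
    rw [krank_eq_card_succ (by rw [h0 z hz]; decide)
      (fun a => even_of_abs_eq (hheight z hz a))]
    congr 1
    ext p
    simp [(hodd z hz p.1 p.2).symm]
  have hmem : ∀ z ∈ t, ∀ p : TreeNode k × Fin d, z (some (p.1, p.2.succ)) ≠ 0 ↔
      D ≤ moveEnum e η p + krank z := by
    intro z hz p
    rw [hkr z hz, ← mem_upperSet_iff_of_card (moveEnum e η)]
    · simp
    · intro p hp p' hpp
      simp only [Finset.mem_filter, Finset.mem_univ, true_and] at hp ⊢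
      exact hnest p p' hpp z hz hp
  have hcardP : Fintype.card (TreeNode k × Fin d) = D := by
    rw [Fintype.card_congr e, Fintype.card_fin]
  have hkD : ∀ z ∈ t, krank z ≤ D := by
    intro z hz
    rw [hkr z hz, ← hcardP]
    exact Finset.card_le_univ _
  have hmu : ∀ c ≤ D + 1, ∑ z ∈ t with c ≤ krank z, w z = (D + 1 - c) / (D + 1) := by
    intro c hcD
    have hD0 : (D : ℝ) + 1 ≠ 0 := by positivity
    rcases Nat.eq_zero_or_pos c with rfl | hc0
    · simp [hw1, div_self hD0]
    rcases Nat.lt_or_ge D c with hlt | hge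
    · obtain rfl : c = D + 1 := by omega
      rw [Finset.filter_false_of_mem fun z hz => by have := hkD z hz; omega]
      simp
    · set p := (moveEnum e η).symm ⟨D - c, by omega⟩ with hp
      have hep : (moveEnum e η p : ℕ) = D - c := by rw [hp, Equiv.apply_symm_apply]
      have h1 : ∑ z ∈ t with c ≤ krank z, w z =
          ∑ z ∈ t with z (some (p.1, p.2.succ)) ≠ 0, w z := by
        refine Finset.sum_congr (Finset.filter_congr fun z hz => ?_) fun _ _ => rfl
        rw [hmem z hz, hep]
        omega
      rw [h1, hmeas]
      simp only [hr, distinctValues]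
      rw [← moveEnum_apply, hep, Nat.cast_sub hge]
      ring
  have hall : ∀ c ≤ D, ∃ z ∈ t, krank z = c := by
    intro c hcD
    by_contra! hcon
    have h1 := hmu c (by omega)
    have h2 := hmu (c + 1) (by omega)
    have h3 : ∑ z ∈ t with c ≤ krank z, w z = ∑ z ∈ t with c + 1 ≤ krank z, w z := by
      refine Finset.sum_congr (Finset.filter_congr fun z hz => ?_) fun _ _ => rfl
      have := hcon z hz
      omega
    rw [h1, h2, div_left_inj' (by positivity)] at h3
    push_cast at h3
    linarith
  refine ⟨?_, η, ?_⟩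
  · have : Finset.range (D + 1) ⊆ t.image krank := by
      intro c hc
      obtain ⟨z, hz, hzc⟩ := hall c (by simpa [Nat.lt_succ_iff] using hc)
      exact Finset.mem_image.2 ⟨z, hz, hzc⟩
    have := (Finset.card_le_card this).trans Finset.card_image_le
    simpa using this
  · intro z hz
    rw [mem_stdChain]
    refine ⟨krank z, by have := hkD z hz; omega, ?_⟩
    funext o
    rcases o with _ | ⟨a, i⟩
    · exact (h0 z hz).symm
    · refine Fin.cases ?_ (fun i => ?_) i
      · rw [stdPoint_zero, hheq z hz]
      · rw [stdPoint_succ]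
        have h1 := hmem z hz (a, i)
        rw [moveEnum_apply] at h1
        split_ifs with h2 h3
        · rw [(hvals z hz a i).resolve_left (h1.2 h2)]; simp [hs, h3]
        · rw [(hvals z hz a i).resolve_left (h1.2 h2)]; simp [hs, h3]
        · exact (not_not.1 fun h => h2 (h1.1 h)).symm

end BaseMap

section StdChain

open TreeNode TreeGroup

variable {k d D : ℕ} (e : TreeNode k × Fin d ≃ Fin D)

lemma inGrid_stdPoint {L : ℤ} (hL : 1 ≤ L) (η : TreeGroup k) (c : ℕ) :
    InGrid L (stdPoint e L η c) := by
  refine ⟨Or.inl rfl, fun a => ⟨fun i => ?_, 0, ?_⟩⟩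
  · refine Fin.cases ?_ (fun i => ?_) i
    · rw [stdPoint_zero]
      split_ifs <;> rw [abs_le] <;> omega
    · rw [stdPoint_succ]
      split_ifs <;> rw [abs_le] <;> omega
  · rw [stdPoint_zero]
    split_ifs
    · rw [abs_neg, abs_of_nonneg (by omega)]
    · rw [abs_of_nonneg (by omega)]

lemma kle_stdPoint (L : ℤ) (η : TreeGroup k) {c c' : ℕ} (h : c ≤ c') :
    Kle (stdPoint e L η c) (stdPoint e L η c') := by
  rintro (_ | ⟨a, i⟩)
  · exact Or.inl rfl
  · refine Fin.cases (Or.inl ?_) (fun i => ?_) i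
    · rw [stdPoint_zero, stdPoint_zero]
    · rw [stdPoint_succ, stdPoint_succ]
      by_cases h1 : D ≤ e (move η.mark a, i) + c
      · rw [if_pos h1, if_pos (h1.trans (by omega))]
        exact Or.inl rfl
      · rw [if_neg h1]
        by_cases h2 : D ≤ e (move η.mark a, i) + c'
        · rw [if_pos h2]
          right
          split_ifs <;> decide
        · rw [if_neg h2]
          exact Or.inl rfl

lemma stdPoint_injOn (L : ℤ) (η : TreeGroup k) :
    Set.InjOn (stdPoint e L η) (Finset.range (D + 1) : Set ℕ) := by
  have key : ∀ c c', c < c' → c' < D + 1 → stdPoint e L η c ≠ stdPoint e L η c' := by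
    intro c c' h h' heq
    obtain ⟨p, hp⟩ := (moveEnum e η).surjective ⟨D - c', by omega⟩
    have hp' : (e (move η.mark p.1, p.2) : ℕ) = D - c' := by
      rw [← moveEnum_apply, hp]
    have := congrFun heq (some (p.1, p.2.succ))
    rw [stdPoint_succ, stdPoint_succ, hp', if_neg (by omega), if_pos (by omega)] at this
    split_ifs at this
    · simp at this
  intro c hc c' hc' h
  simp only [Finset.coe_range, Set.mem_Iio] at hc hc'
  rcases lt_trichotomy c c' with h1 | h1 | h1
  · exact absurd h (key c c' h1 hc')
  · exact h1
  · exact absurd h.symm (key c' c h1 hc)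

lemma signMark_stdPoint {L : ℤ} (hL : 1 ≤ L) (η : TreeGroup k) (c : ℕ) :
    signMark (stdPoint e L η c) = η := by
  ext a
  have h : stdPoint e L η c (some (a, 0)) ≠ 0 := by
    rw [stdPoint_zero]; split_ifs <;> omega
  rw [Bool.eq_iff_iff, signMark_mark_eq h, stdPoint_zero]
  split_ifs with h1
  · simp only [h1, iff_true]; omega
  · simp only [h1]; constructor
    · intro; omega
    · intro h; exact absurd h (by simp)

lemma card_stdChain (L : ℤ) (η : TreeGroup k) : (stdChain e L η).card = D + 1 := by
  classical
  rw [stdChain, Finset.card_image_of_injOn (by convert stdPoint_injOn e L η), Finset.card_range]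

lemma kChain_stdChain (L : ℤ) (η : TreeGroup k) : KChain (stdChain e L η) := by
  intro x hx y hy
  obtain ⟨c, -, rfl⟩ := (mem_stdChain e).1 hx
  obtain ⟨c', -, rfl⟩ := (mem_stdChain e).1 hy
  rcases le_total c c' with h | h
  · exact Or.inl (kle_stdPoint e L η h)
  · exact Or.inr (kle_stdPoint e L η h)

lemma stdChain_injective {L : ℤ} (hL : 1 ≤ L) : Function.Injective (stdChain e L) := by
  intro η η' h
  have h1 : stdPoint e L η 0 ∈ stdChain e L η' := by
    rw [← h, mem_stdChain]
    exact ⟨0, by omega, rfl⟩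
  obtain ⟨c, -, hc⟩ := (mem_stdChain e).1 h1
  rw [← signMark_stdPoint e hL η 0, ← hc, signMark_stdPoint e hL]

lemma cov_stdChain {L : ℤ} (hL : 1 ≤ L) (η : TreeGroup k) :
    Cov (baseMap e) (stdChain e L η) := by
  classical
  have hD : (D : ℝ) + 1 ≠ 0 := by positivity
  refine ⟨fun _ => 1 / (D + 1), fun _ _ => by positivity, ?_, ?_⟩
  · rw [Finset.sum_const, card_stdChain, nsmul_eq_mul]
    push_cast
    field_simp
  · rw [← Finset.smul_sum]
    convert smul_zero _
    rw [stdChain, Finset.sum_image (by convert stdPoint_injOn e L η)]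
    funext a i
    rw [Finset.sum_apply, Finset.sum_apply]
    have h1 : ∀ c, baseMap e (stdPoint e L η c) a i = (if η.mark a then -1 else 1) *
        ((if D ≤ e (move η.mark a, i) + c then 1 else 0) -
          distinctValues e (move η.mark a) i) := by
      intro c
      rw [baseMap, Pi.sub_apply, Pi.sub_apply, signMark_stdPoint e hL, act_apply, stdPoint_succ]
      split_ifs <;> simp [sub_eq_add_neg, add_comm]
    simp only [h1]
    rw [← Finset.mul_sum, Finset.sum_sub_distrib, Finset.sum_const, Finset.card_range,
      Finset.sum_boole]
    have h2 : (Finset.range (D + 1)).filter (fun c => D ≤ e (move η.mark a, i) + c) =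
        Finset.Ico (D - e (move η.mark a, i)) (D + 1) := by
      ext c
      simp only [Finset.mem_filter, Finset.mem_range, Finset.mem_Ico]
      omega
    have h3 := (e (move η.mark a, i)).2
    rw [h2, Nat.card_Ico, show D + 1 - (D - (e (move η.mark a, i) : ℕ)) =
      (e (move η.mark a, i) : ℕ) + 1 by omega]
    simp only [distinctValues, Pi.zero_apply, nsmul_eq_mul]
    push_cast
    rw [mul_div_cancel₀ _ hD, sub_self, mul_zero]

end StdChain

section TreeCombinatorics

open TreeNode TreeGroup
open scoped Pointwise

variable {k d : ℕ}

lemma finite_inGrid (L : ℤ) : {z : Option (TreeNode k × Fin (d + 1)) → ℤ | InGrid L z}.Finite := by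
  classical
  refine (Set.finite_Icc (fun _ => -(2 * |L| + 1)) (fun _ => 2 * |L| + 1)).subset ?_
  intro z hz
  have hL := le_abs_self L
  have hL' := abs_nonneg L
  have : ∀ o, -(2 * |L| + 1) ≤ z o ∧ z o ≤ 2 * |L| + 1 := by
    rintro (_ | ⟨a, i⟩)
    · rcases hz.1 with h | h <;> rw [h] <;> constructor <;> omega
    · have := abs_le.1 ((hz.2 a).1 i)
      constructor <;> omega
  exact ⟨fun o => (this o).1, fun o => (this o).2⟩

/-- Every equivariant assignment of vectors to the grid points has, up to a small perturbation,
a chain whose convex hull is mapped onto the origin. -/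
theorem exists_chain_covering {L : ℤ} (hL : 1 ≤ L)
    (ψ : (Option (TreeNode k × Fin (d + 1)) → ℤ) → TreeNode k → Fin d → ℝ)
    (hψ : ∀ (g : TreeGroup k) z, InGrid L z → ψ (g • z) = act g (ψ z)) {δ : ℝ} (hδ : 0 < δ) :
    ∃ (t : Finset (Option (TreeNode k × Fin (d + 1)) → ℤ))
      (y : (Option (TreeNode k × Fin (d + 1)) → ℤ) → TreeNode k → Fin d → ℝ),
      (∀ z ∈ t, InGrid L z) ∧ KChain t ∧ (∀ z ∈ t, ‖y z - ψ z‖ < δ) ∧ Cov y t := by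
  classical
  set D := Fintype.card (TreeNode k) * d with hD
  have hfin : Module.finrank ℝ (TreeNode k → Fin d → ℝ) = D := by
    simp [hD, Module.finrank_pi_fintype]
  have e : TreeNode k × Fin d ≃ Fin D := Fintype.equivFinOfCardEq (by simp [hD])
  set K := (finite_inGrid (k := k) (d := d) L).toFinset with hK
  have mK : ∀ z, z ∈ K ↔ InGrid L z := by simp [hK]
  set P := K.filter (fun z => z none = 1) with hP
  set K₀ := K.filter (fun z => z none = 0) with hK₀
  set B₀ := K₀.image (baseMap e) with hB₀
  have gridinv : ∀ (g : TreeGroup k), ∀ z ∈ K, g • z ∈ K := fun g z hz =>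
    (mK _).2 (((mK z).1 hz).smul g)
  obtain ⟨y₁, hy₁, hy₁ψ, hgen⟩ := exists_equivariant_generic (actLin d) (act_one) (act_mul)
    norm_actLin_le B₀ (by
      intro g v hv
      obtain ⟨z, hz, rfl⟩ := Finset.mem_image.1 hv
      rw [hK₀, Finset.mem_filter] at hz
      refine Finset.mem_image.2 ⟨g • z, ?_, baseMap_smul e hL ((mK z).1 hz.1) g⟩
      exact Finset.mem_filter.2 ⟨gridinv g z hz.1, hz.2⟩)
    ψ hδ P (by
      intro g z hz
      rw [hP, Finset.mem_filter] at hz ⊢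
      exact ⟨gridinv g z hz.1, hz.2⟩)
    (fun g z hz h => grid_free hL ((mK z).1 (Finset.mem_filter.1 hz).1) h)
    (fun g z hz => hψ g z ((mK z).1 (Finset.mem_filter.1 hz).1))
  set y : (Option (TreeNode k × Fin (d + 1)) → ℤ) → TreeNode k → Fin d → ℝ :=
    fun z => if z none = 1 then y₁ z else baseMap e z with hy
  have hcovcongr : ∀ (u v : (Option (TreeNode k × Fin (d + 1)) → ℤ) → TreeNode k → Fin d → ℝ) t,
      (∀ z ∈ t, u z = v z) → Cov u t → Cov v t := by
    rintro u v t h ⟨w, h0, h1, h2⟩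
    exact ⟨w, h0, h1, by rw [← h2]; exact Finset.sum_congr rfl fun z hz => by rw [h z hz]⟩
  by_contra hcon
  push Not at hcon
  set B : Finset (Option (TreeNode k × Fin (d + 1)) → ℤ) → Prop :=
    fun t => (∀ x ∈ t, x none = 0) ∨ (∀ x ∈ t, x none = 1) with hB
  set N := (K.powersetCard (D + 1)).filter (fun t => KChain t ∧ Cov y t ∧ B t) with hN
  have mN : ∀ t, t ∈ N ↔ t ⊆ K ∧
      t.card = Module.finrank ℝ (TreeNode k → Fin d → ℝ) + 1 ∧ KChain t ∧ Cov y t ∧ B t := by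
    intro t
    rw [hfin, hN, Finset.mem_filter, Finset.mem_powersetCard, and_assoc]
  have hNeq : N = Finset.univ.image (stdChain e L) := by
    ext t
    rw [mN, hfin]
    constructor
    · rintro ⟨htK, hcard, hc, hcov, h | h⟩
      · obtain ⟨-, η, hη⟩ := covering_chain_baseMap e hL (fun z hz => (mK z).1 (htK hz)) h hc
          (hcovcongr y _ t (fun z hz => by simp [hy, h z hz]) hcov)
        refine Finset.mem_image.2 ⟨η, Finset.mem_univ _, ?_⟩
        exact (Finset.eq_of_subset_of_card_le hη (by rw [card_stdChain, hcard])).symm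
      · exact absurd (hcovcongr y y₁ t (fun z hz => by simp [hy, h z hz]) hcov)
          (hcon t y₁ (fun z hz => (mK z).1 (htK hz)) hc
            (fun z hz => hy₁ψ z (Finset.mem_filter.2 ⟨htK hz, h z hz⟩)))
    · intro ht
      obtain ⟨η, -, rfl⟩ := Finset.mem_image.1 ht
      have h0 : ∀ z ∈ stdChain e L η, z none = 0 := by
        intro z hz
        obtain ⟨c, -, rfl⟩ := (mem_stdChain e).1 hz
        rfl
      refine ⟨fun z hz => ?_, card_stdChain e L η, kChain_stdChain e L η,
        hcovcongr _ y _ (fun z hz => by simp [hy, h0 z hz]) (cov_stdChain e hL η), Or.inl h0⟩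
      obtain ⟨c, -, rfl⟩ := (mem_stdChain e).1 hz
      exact (mK _).2 (inGrid_stdPoint e hL η c)
  have hdvd := two_mul_card_group_dvd_boundary (G := TreeGroup k) K KChain B y
    (fun s t hts hs => KChain.mono hts hs)
    (by
      intro g t ht x hx z hz
      obtain ⟨x', hx', rfl⟩ := Finset.mem_smul_finset.1 hx
      obtain ⟨z', hz', rfl⟩ := Finset.mem_smul_finset.1 hz
      exact (ht x' hx' z' hz').imp (fun h => h.smul g) fun h => h.smul g)
    (by
      rintro g t htK ⟨x, hx⟩ hc hgt
      have hgx : g • x ∈ t := by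
        rw [← hgt]; exact Finset.smul_mem_smul_finset hx
      exact grid_free hL ((mK x).1 (htK hx)) (grid_smul_eq_of_comparable (hc _ hgx _ hx)))
    gridinv
    (by
      intro g t _ _
      simp only [hB, Finset.mem_smul_finset, forall_exists_index, and_imp,
        forall_apply_eq_imp_iff₂, grid_smul_none])
    (by
      intro g
      refine ⟨actLin d g, fun z hz => ?_⟩
      simp only [hy, grid_smul_none]
      split_ifs with h
      · exact hy₁ g z (Finset.mem_filter.2 ⟨hz, h⟩)
      · exact baseMap_smul e hL ((mK z).1 hz) g)
    (by
      rintro t htK hc hcard ⟨w, hw0, hw1, hw2⟩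
      rw [hfin] at hcard
      set t₁ := t.filter (fun z => z none = 1) with ht₁
      set t₀ := t.filter (fun z => ¬ z none = 1) with ht₀
      have hct : t₁.card + t₀.card = t.card := Finset.card_filter_add_card_filter_not _
      have hz0 : ∀ z ∈ t₀, z none = 0 := by
        intro z hz
        rw [ht₀, Finset.mem_filter] at hz
        exact ((mK z).1 (htK hz.1)).1.resolve_right hz.2
      have hsum : ∑ z ∈ t₁, w z • y₁ z + ∑ z ∈ t₀, w z • baseMap e z = 0 := by
        rw [← hw2, ← Finset.sum_filter_add_sum_filter_not t (fun z => z none = 1)]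
        congr 1
        · exact Finset.sum_congr rfl fun z hz => by simp [hy, (Finset.mem_filter.1 hz).2]
        · exact Finset.sum_congr rfl fun z hz => by simp [hy, (Finset.mem_filter.1 hz).2]
      have hzero : ∀ z ∈ t₁, w z = 0 := by
        refine hgen t₁ ?_ ?_ (t₀.image (baseMap e)) ?_ ?_ w ?_
        · exact Finset.filter_subset_filter _ htK
        · intro x hx g hgx
          exact grid_smul_eq_of_comparable
            (hc _ (Finset.mem_filter.1 hgx).1 _ (Finset.mem_filter.1 hx).1)
        · exact Finset.image_subset_image fun z hz => Finset.mem_filter.2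
            ⟨htK (Finset.mem_filter.1 hz).1, hz0 z hz⟩
        · rw [hfin]
          have := Finset.card_image_le (s := t₀) (f := baseMap e)
          omega
        · rw [eq_neg_of_add_eq_zero_left hsum]
          refine Submodule.neg_mem _ (Submodule.sum_mem _ fun z hz => Submodule.smul_mem _ _ ?_)
          exact Submodule.subset_span (by simpa using ⟨z, hz, rfl⟩)
      have hcov : Cov (baseMap e) t₀ := by
        refine ⟨w, fun z hz => hw0 z (Finset.mem_filter.1 hz).1, ?_, ?_⟩
        · rw [← hw1, ← Finset.sum_filter_add_sum_filter_not t (fun z => z none = 1),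
            Finset.sum_eq_zero hzero, zero_add]
        · rwa [Finset.sum_eq_zero fun z hz => by rw [hzero z hz, zero_smul], zero_add] at hsum
      have := (covering_chain_baseMap e hL
        (fun z hz => (mK z).1 (htK (Finset.mem_filter.1 hz).1)) hz0
        (hc.mono (Finset.filter_subset _ _)) hcov).1
      rw [← ht₀] at this
      omega)
    (by
      intro t htK hc hcard
      rw [hfin] at hcard
      simp only [mK]
      exact KChain.ncard_extensions hL (fun x hx => (mK x).1 (htK hx)) hc hcard)
    N mN
  rw [hNeq, Finset.card_image_of_injective _ (stdChain_injective e hL), Finset.card_univ] at hdvd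
  have h1 := Nat.le_of_dvd Fintype.card_pos hdvd
  have h2 : 0 < Fintype.card (TreeGroup k) := Fintype.card_pos
  omega

end TreeCombinatorics

section TreeZero

open TreeNode TreeGroup

variable {k d : ℕ}

/-- The point of the product of cube boundaries represented by a grid point. -/
noncomputable def gridPoint (L : ℕ) (z : Option (TreeNode k × Fin (d + 1)) → ℤ) :
    TreeNode k → Fin (d + 1) → ℝ := fun a i => z (some (a, i)) / (2 * L)

lemma gridPoint_smul (L : ℕ) (g : TreeGroup k) (z : Option (TreeNode k × Fin (d + 1)) → ℤ) :
    gridPoint L (g • z) = act g (gridPoint L z) := by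
  funext a i
  rw [gridPoint, grid_smul_eq, act_apply]
  split_ifs
  · simp [gridPoint, neg_div]
  · rfl

lemma norm_gridPoint {L : ℕ} (hL : 1 ≤ L) {z : Option (TreeNode k × Fin (d + 1)) → ℤ}
    (hz : InGrid (L : ℤ) z) (a : TreeNode k) : ‖gridPoint L z a‖ = 1 := by
  have hL0 : (0 : ℝ) < 2 * L := by positivity
  have habs : ∀ i, ‖gridPoint L z a i‖ = ((|z (some (a, i))| : ℤ) : ℝ) / (2 * L) := by
    intro i
    rw [gridPoint, Real.norm_eq_abs, abs_div, abs_of_pos hL0, Int.cast_abs]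
  refine le_antisymm ((pi_norm_le_iff_of_nonneg zero_le_one).2 fun i => ?_) ?_
  · rw [habs, div_le_one hL0]
    exact_mod_cast (hz.2 a).1 i
  · obtain ⟨i, hi⟩ := (hz.2 a).2
    have h := norm_le_pi_norm (gridPoint L z a) i
    rw [habs, hi] at h
    push_cast at h
    rwa [div_self hL0.ne'] at h

/-- A Borsuk–Ulam theorem for the group of automorphisms of a binary tree. -/
theorem exists_tree_zero (Ψ : (TreeNode k → Fin (d + 1) → ℝ) → TreeNode k → Fin d → ℝ)
    (hcont : Continuous Ψ) (hact : ∀ (g : TreeGroup k) c, Ψ (act g c) = act g (Ψ c)) :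
    ∃ c, (∀ a, ‖c a‖ = 1) ∧ Ψ c = 0 := by
  classical
  by_contra! hcon
  set M : Set (TreeNode k → Fin (d + 1) → ℝ) := {c | ∀ a, ‖c a‖ = 1} with hM
  have hMc : IsCompact M := by
    have h : M = Set.pi Set.univ fun _ => Metric.sphere 0 1 := by
      ext c; simp [hM, Set.mem_pi]
    rw [h]
    exact isCompact_univ_pi fun _ => isCompact_sphere _ _
  obtain ⟨η, hη, hηM⟩ : ∃ η > 0, ∀ c ∈ M, η ≤ ‖Ψ c‖ := by
    rcases M.eq_empty_or_nonempty with h | h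
    · exact ⟨1, one_pos, by simp [h]⟩
    · obtain ⟨c, hc, hmin⟩ := hMc.exists_isMinOn h hcont.norm.continuousOn
      exact ⟨‖Ψ c‖, norm_pos_iff.2 (hcon c hc), fun c' hc' => hmin hc'⟩
  have huc := hMc.uniformContinuousOn_of_continuous hcont.continuousOn
  rw [Metric.uniformContinuousOn_iff] at huc
  obtain ⟨ρ, hρ, hρM⟩ := huc (η / 3) (by positivity)
  obtain ⟨n, hn⟩ := exists_nat_gt (1 / ρ)
  set L := n + 1 with hL
  have hL1 : 1 ≤ L := by omega
  have hL0 : (0 : ℝ) < 2 * L := by positivity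
  have hLρ : 1 / (2 * (L : ℝ)) < ρ := by
    rw [div_lt_iff₀ hρ] at hn
    rw [div_lt_iff₀ hL0, hL]
    push_cast
    nlinarith [Nat.cast_nonneg (α := ℝ) n]
  obtain ⟨t, y, htgrid, htc, hty, w, hw0, hw1, hw2⟩ :=
    exists_chain_covering (L := (L : ℤ)) (by exact_mod_cast hL1) (fun z => Ψ (gridPoint L z))
      (fun g z _ => by rw [gridPoint_smul, hact]) (δ := η / 3) (by positivity)
  have htne : t.Nonempty := by
    rw [Finset.nonempty_iff_ne_empty]
    rintro rfl
    simp at hw1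
  obtain ⟨z₀, hz₀⟩ := htne
  have hmem : ∀ z ∈ t, gridPoint L z ∈ M := fun z hz => norm_gridPoint hL1 (htgrid z hz)
  have hnear : ∀ z ∈ t, ‖Ψ (gridPoint L z₀) - y z‖ ≤ 2 * η / 3 := by
    intro z hz
    have hdist : dist (gridPoint L z₀) (gridPoint L z) < ρ := by
      refine lt_of_le_of_lt ?_ hLρ
      refine (dist_pi_le_iff (by positivity)).2 fun a => (dist_pi_le_iff (by positivity)).2
        fun i => ?_
      have habs : |z₀ (some (a, i)) - z (some (a, i))| ≤ 1 := by
        rcases htc z₀ hz₀ z hz with h | h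
        · exact h.abs_sub_le _
        · rw [abs_sub_comm]; exact h.abs_sub_le _
      rw [Real.dist_eq, gridPoint, gridPoint, ← sub_div, abs_div, abs_of_pos hL0]
      gcongr
      exact_mod_cast habs
    have h1 := hρM _ (hmem z₀ hz₀) _ (hmem z hz) hdist
    have h2 := hty z hz
    rw [dist_eq_norm] at h1
    have h3 := norm_sub_le_norm_sub_add_norm_sub (Ψ (gridPoint L z₀)) (Ψ (gridPoint L z)) (y z)
    rw [norm_sub_rev (Ψ (gridPoint L z)) (y z)] at h3
    linarith
  have hsum : Ψ (gridPoint L z₀) = ∑ z ∈ t, w z • (Ψ (gridPoint L z₀) - y z) := by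
    simp only [smul_sub]
    rw [Finset.sum_sub_distrib, hw2, sub_zero, ← Finset.sum_smul, hw1, one_smul]
  have hle : ‖Ψ (gridPoint L z₀)‖ ≤ 2 * η / 3 := by
    rw [hsum]
    refine (norm_sum_le _ _).trans ?_
    calc ∑ z ∈ t, ‖w z • (Ψ (gridPoint L z₀) - y z)‖ ≤ ∑ z ∈ t, w z * (2 * η / 3) := by
          refine Finset.sum_le_sum fun z hz => ?_
          rw [norm_smul, Real.norm_of_nonneg (hw0 z hz)]
          exact mul_le_mul_of_nonneg_left (hnear z hz) (hw0 z hz)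
      _ = 2 * η / 3 := by rw [← Finset.sum_mul, hw1, one_mul]
  have := hηM _ (hmem z₀ hz₀)
  linarith

end TreeZero

section BalancedTree

open TreeNode TreeGroup

/-- Negate according to a boolean label. -/
def boolSign {X : Type*} [Neg X] (b : Bool) (u : X) : X := if b then -u else u

lemma sum_cons_bool {k : ℕ} {X : Type*} [AddCommMonoid X] (f : (Fin (k + 1) → Bool) → X) :
    ∑ s, f s = ∑ s, f (Fin.cons false s : Fin (k + 1) → Bool) +
      ∑ s, f (Fin.cons true s : Fin (k + 1) → Bool) := by
  rw [← (Fin.consEquiv (fun _ : Fin (k + 1) => Bool)).sum_comp, Fintype.sum_prod_type,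
    Fintype.sum_bool, add_comm]
  rfl

variable {E V : Type*} [NormedAddCommGroup E] [AddCommGroup V]

/-- The sum of a functional over all the leaves below a node; a family of vectors at the nodes
labels the edges by opposite vectors. -/
def leafSum (F : (ℕ → E) → V) : (k : ℕ) → ℕ → (ℕ → E) → (TreeNode k → E) → V
  | 0, _, p, _ => F p
  | k + 1, l, p, c =>
    leafSum F k (l + 1) (Function.update p l (c root)) (fun a => c (child false a)) +
      leafSum F k (l + 1) (Function.update p l (-c root)) (fun a => c (child true a))

/-- The equivariant map comparing, at each node, the sums over the leaves on the two sides. -/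
def balanceMap (F : (ℕ → E) → V) (O : ℕ → (ℕ → E) → E → V) :
    (k : ℕ) → ℕ → (ℕ → E) → (TreeNode k → E) → TreeNode k → V
  | k + 1, l, p, c, root =>
    leafSum F k (l + 1) (Function.update p l (c root)) (fun a => c (child false a)) -
      leafSum F k (l + 1) (Function.update p l (-c root)) (fun a => c (child true a)) +
      O l p (c root)
  | k + 1, l, p, c, child b a =>
    balanceMap F O k (l + 1) (Function.update p l (boolSign b (c root)))
      (fun a => c (child b a)) a

/-- The sequence of vectors along the path to a leaf. -/
def leafPath : (k : ℕ) → ℕ → (ℕ → E) → (TreeNode k → E) → (Fin k → Bool) → ℕ → E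
  | 0, _, p, _, _ => p
  | k + 1, l, p, c, s => leafPath k (l + 1) (Function.update p l (boolSign (s 0) (c root)))
      (fun a => c (child (s 0) a)) (Fin.tail s)

lemma leafSum_act (F : (ℕ → E) → V) {k : ℕ} (l : ℕ) (p : ℕ → E) (g : TreeGroup k)
    (c : TreeNode k → E) : leafSum F k l p (act g c) = leafSum F k l p c := by
  induction k generalizing l p with
  | zero => rfl
  | succ k ih =>
    have h : ∀ b, (fun a => act g c (child b a)) =
        act (g.sub b) fun a => c (child (b ^^ g.mark root) a) := fun b => funext fun a => rfl
    simp only [leafSum, h, ih, act_root]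
    cases g.mark root
    · rfl
    · simp [add_comm]

lemma balanceMap_act (F : (ℕ → E) → V) (O : ℕ → (ℕ → E) → E → V)
    (hO : ∀ l p u, O l p (-u) = -O l p u) {k : ℕ} (l : ℕ) (p : ℕ → E) (g : TreeGroup k)
    (c : TreeNode k → E) :
    balanceMap F O k l p (act g c) = act g (balanceMap F O k l p c) := by
  induction k generalizing l p with
  | zero => exact funext fun a => isEmptyElim a
  | succ k ih =>
    have h : ∀ b, (fun a => act g c (child b a)) =
        act (g.sub b) fun a => c (child (b ^^ g.mark root) a) := fun b => funext fun a => rfl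
    funext a
    cases a with
    | root =>
      simp only [balanceMap, h, leafSum_act, act_root]
      cases g.mark root
      · rfl
      · simp [hO]
        abel
    | child b a =>
      rw [act_child]
      simp only [balanceMap, h, ih, act_root]
      have h2 : boolSign b (if g.mark root then -c root else c root) =
          boolSign (b ^^ g.mark root) (c root) := by
        cases b <;> cases g.mark root <;> simp [boolSign]
      rw [h2]

lemma leafPath_of_lt {k : ℕ} (l : ℕ) (p : ℕ → E) (c : TreeNode k → E) (s : Fin k → Bool) {j : ℕ}
    (hj : j < l) : leafPath k l p c s j = p j := by
  induction k generalizing l p with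
  | zero => rfl
  | succ k ih =>
    rw [leafPath, ih _ _ _ _ (by omega), Function.update_of_ne (by omega)]

lemma leafPath_self {k : ℕ} (l : ℕ) (p : ℕ → E) (c : TreeNode (k + 1) → E)
    (s : Fin (k + 1) → Bool) : leafPath (k + 1) l p c s l = boolSign (s 0) (c root) := by
  rw [leafPath, leafPath_of_lt _ _ _ _ (by omega), Function.update_self]

lemma norm_boolSign (b : Bool) (u : E) : ‖boolSign b u‖ = ‖u‖ := by
  cases b <;> simp [boolSign]

lemma norm_leafPath {k : ℕ} (l : ℕ) (p : ℕ → E) (c : TreeNode k → E) (hc : ∀ a, ‖c a‖ = 1)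
    (s : Fin k → Bool) {j : ℕ} (hj : j < k) : ‖leafPath k l p c s (l + j)‖ = 1 := by
  induction k generalizing l p j with
  | zero => omega
  | succ k ih =>
    rcases j with _ | j
    · have h := leafPath_self l p c s
      rw [Nat.add_zero l, h, norm_boolSign, hc]
    · rw [leafPath, show l + (j + 1) = l + 1 + j by ring]
      exact ih _ _ _ (fun a => hc _) _ (by omega)

lemma leafSum_eq_zero {ι : Type*} {F : (ℕ → E) → ι → ℝ} {i : ι} (hF : ∀ p, F p i = 0) {k : ℕ}
    (l : ℕ) (p : ℕ → E) (c : TreeNode k → E) : leafSum F k l p c i = 0 := by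
  induction k generalizing l p with
  | zero => exact hF p
  | succ k ih => simp [leafSum, ih]

section Zero

variable {ι : Type*} {F : (ℕ → E) → ι → ℝ} {O : ℕ → (ℕ → E) → E → ι → ℝ}

lemma balanceMap_root_eq_zero (hdisj : ∀ i, (∀ p, F p i = 0) ∨ ∀ l p u, O l p u i = 0) {k : ℕ}
    {l : ℕ} {p : ℕ → E} {c : TreeNode (k + 1) → E} (h : balanceMap F O (k + 1) l p c = 0) :
    leafSum F k (l + 1) (Function.update p l (c root)) (fun a => c (child false a)) =
      leafSum F k (l + 1) (Function.update p l (-c root)) (fun a => c (child true a)) ∧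
    O l p (c root) = 0 := by
  have h1 := congrFun h root
  simp only [balanceMap, Pi.zero_apply] at h1
  constructor
  · funext i
    rcases hdisj i with hi | hi
    · rw [leafSum_eq_zero hi, leafSum_eq_zero hi]
    · have := congrFun h1 i
      simp only [Pi.add_apply, Pi.sub_apply, hi, Pi.zero_apply, add_zero] at this
      exact sub_eq_zero.1 this
  · funext i
    rcases hdisj i with hi | hi
    · have := congrFun h1 i
      simpa [leafSum_eq_zero hi] using this
    · exact hi _ _ _

lemma balanceMap_child_eq_zero {k : ℕ} {l : ℕ} {p : ℕ → E} {c : TreeNode (k + 1) → E}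
    (h : balanceMap F O (k + 1) l p c = 0) (b : Bool) :
    balanceMap F O k (l + 1) (Function.update p l (boolSign b (c root)))
      (fun a => c (child b a)) = 0 :=
  funext fun a => congrFun h (child b a)

lemma leafSum_eq_smul (hdisj : ∀ i, (∀ p, F p i = 0) ∨ ∀ l p u, O l p u i = 0) {k : ℕ}
    {l : ℕ} {p : ℕ → E} {c : TreeNode k → E} (h : balanceMap F O k l p c = 0)
    (s : Fin k → Bool) : leafSum F k l p c = (2 : ℝ) ^ k • F (leafPath k l p c s) := by
  induction k generalizing l p with
  | zero => simp [leafSum, leafPath]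
  | succ k ih =>
    have h1 := (balanceMap_root_eq_zero hdisj h).1
    have h2 := ih (balanceMap_child_eq_zero h (s 0)) (Fin.tail s)
    rw [leafSum, leafPath, pow_succ, mul_comm, mul_smul, ← h2, two_smul]
    cases hs : s 0
    · rw [← h1]; rfl
    · rw [h1]; rfl

lemma constraint_leafPath (hdisj : ∀ i, (∀ p, F p i = 0) ∨ ∀ l p u, O l p u i = 0)
    (hO : ∀ l p u, O l p (-u) = -O l p u)
    (hOdep : ∀ l p p' u, (∀ j < l, p j = p' j) → O l p u = O l p' u) {k : ℕ}
    {l : ℕ} {p : ℕ → E} {c : TreeNode k → E} (h : balanceMap F O k l p c = 0)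
    (s : Fin k → Bool) {j : ℕ} (hj : j < k) :
    O (l + j) (leafPath k l p c s) (leafPath k l p c s (l + j)) = 0 := by
  induction k generalizing l p j with
  | zero => omega
  | succ k ih =>
    rcases j with _ | j
    · have h1 := (balanceMap_root_eq_zero hdisj h).2
      have h2 := leafPath_self l p c s
      rw [Nat.add_zero l, h2, hOdep l _ p _ fun j hj => leafPath_of_lt l p c s hj]
      cases s 0
      · exact h1
      · simp [boolSign, hO, h1]
    · rw [leafPath, show l + (j + 1) = l + 1 + j by ring]
      exact ih (balanceMap_child_eq_zero h (s 0)) (Fin.tail s) (by omega)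

end Zero

lemma sum_prod_leafPath_le (w : ℕ → (ℕ → E) → E → ℝ) {q : ℝ}
    (hw0 : ∀ l p u, 0 ≤ w l p u) (hwdep : ∀ l p p' u, (∀ j < l, p j = p' j) → w l p u = w l p' u)
    (hwq : ∀ l p u, ‖u‖ = 1 → w l p u + w l p (-u) ≤ q) {k : ℕ} (l : ℕ) (p : ℕ → E)
    (c : TreeNode k → E) (hc : ∀ a, ‖c a‖ = 1) :
    ∑ s, ∏ j ∈ Finset.range k, w (l + j) (leafPath k l p c s) (leafPath k l p c s (l + j)) ≤
      q ^ k := by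
  induction k generalizing l p with
  | zero => simp
  | succ k ih =>
    have hq : 0 ≤ q := (add_nonneg (hw0 _ _ _) (hw0 _ _ _)).trans (hwq l p _ (hc root))
    have key : ∀ b, ∑ s : Fin k → Bool, ∏ j ∈ Finset.range (k + 1),
        w (l + j) (leafPath (k + 1) l p c (Fin.cons b s : Fin (k + 1) → Bool))
          (leafPath (k + 1) l p c (Fin.cons b s : Fin (k + 1) → Bool) (l + j)) ≤
        w l p (boolSign b (c root)) * q ^ k := by
      intro b
      have h1 := ih (l + 1) (Function.update p l (boolSign b (c root)))
        (fun a => c (child b a)) fun a => hc _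
      refine le_trans (le_of_eq ?_) (mul_le_mul_of_nonneg_left h1 (hw0 l p _))
      rw [Finset.mul_sum]
      refine Finset.sum_congr rfl fun s _ => ?_
      rw [Finset.prod_range_succ', mul_comm]
      congr 1
      · have h2 := leafPath_self l p c (Fin.cons b s : Fin (k + 1) → Bool)
        rw [Nat.add_zero l, h2, hwdep l _ p _ fun j hj => leafPath_of_lt l p c _ hj,
          Fin.cons_zero]
      · refine Finset.prod_congr rfl fun j _ => ?_
        rw [show l + (j + 1) = l + 1 + j by ring]
        simp only [leafPath, Fin.cons_zero, Fin.tail_cons]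
    rw [sum_cons_bool, pow_succ, mul_comm (q ^ k)]
    refine (add_le_add (key false) (key true)).trans ?_
    rw [← add_mul]
    exact mul_le_mul_of_nonneg_right (hwq l p _ (hc root)) (pow_nonneg hq k)

section Continuity

variable [TopologicalSpace V] [IsTopologicalAddGroup V]

lemma continuous_leafSum {F : (ℕ → E) → V} (hF : Continuous F) (k l : ℕ) :
    Continuous fun x : (ℕ → E) × (TreeNode k → E) => leafSum F k l x.1 x.2 := by
  induction k generalizing l with
  | zero => exact hF.comp continuous_fst
  | succ k ih =>
    have h : ∀ b (v : (ℕ → E) × (TreeNode (k + 1) → E) → E), Continuous v →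
        Continuous fun x : (ℕ → E) × (TreeNode (k + 1) → E) =>
          leafSum F k (l + 1) (Function.update x.1 l (v x)) fun a => x.2 (child b a) :=
      fun b v hv => (ih (l + 1)).comp ((continuous_fst.update l hv).prodMk (by fun_prop))
    exact (h false (fun x => x.2 root) (by fun_prop)).add
      (h true (fun x => -x.2 root) (by fun_prop))

lemma continuous_balanceMap {F : (ℕ → E) → V} (hF : Continuous F) {O : ℕ → (ℕ → E) → E → V}
    (hO : ∀ l, Continuous fun x : (ℕ → E) × E => O l x.1 x.2) (k l : ℕ) :
    Continuous fun x : (ℕ → E) × (TreeNode k → E) => balanceMap F O k l x.1 x.2 := by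
  induction k generalizing l with
  | zero => exact continuous_pi fun a => isEmptyElim a
  | succ k ih =>
    have h : ∀ b (v : (ℕ → E) × (TreeNode (k + 1) → E) → E), Continuous v →
        Continuous fun x : (ℕ → E) × (TreeNode (k + 1) → E) =>
          leafSum F k (l + 1) (Function.update x.1 l (v x)) fun a => x.2 (child b a) :=
      fun b v hv => (continuous_leafSum hF k (l + 1)).comp
        ((continuous_fst.update l hv).prodMk (by fun_prop))
    refine continuous_pi fun a => ?_
    cases a with
    | root =>
      refine ((h false (fun x => x.2 root) (by fun_prop)).sub
        (h true (fun x => -x.2 root) (by fun_prop))).add ?_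
      exact (hO l).comp (continuous_fst.prodMk (by fun_prop))
    | child b a =>
      have hb : Continuous fun x : (ℕ → E) × (TreeNode (k + 1) → E) =>
          boolSign b (x.2 root) := by
        cases b
        · exact (continuous_apply root).comp continuous_snd
        · exact ((continuous_apply root).comp continuous_snd).neg
      exact (continuous_apply a).comp ((ih (l + 1)).comp
        ((continuous_fst.update l hb).prodMk (by fun_prop)))

end Continuity

/-- Existence of a binary tree of unit vectors on whose leaves a given functional is constant,
subject to odd constraints along the paths. -/
theorem exists_balanced_tree {d : ℕ} (k : ℕ) {F : (ℕ → Fin (d + 1) → ℝ) → Fin d → ℝ}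
    {O : ℕ → (ℕ → Fin (d + 1) → ℝ) → (Fin (d + 1) → ℝ) → Fin d → ℝ} (hF : Continuous F)
    (hOcont : ∀ l, Continuous fun x : (ℕ → Fin (d + 1) → ℝ) × (Fin (d + 1) → ℝ) => O l x.1 x.2)
    (hdisj : ∀ i, (∀ p, F p i = 0) ∨ ∀ l p u, O l p u i = 0)
    (hO : ∀ l p u, O l p (-u) = -O l p u)
    (hOdep : ∀ l p p' u, (∀ j < l, p j = p' j) → O l p u = O l p' u) :
    ∃ P : (Fin k → Bool) → ℕ → Fin (d + 1) → ℝ,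
      (∀ s s', F (P s) = F (P s')) ∧ (∀ s, ∀ j < k, ‖P s j‖ = 1) ∧
      (∀ s, ∀ j < k, O j (P s) (P s j) = 0) ∧
      ∀ (w : ℕ → (ℕ → Fin (d + 1) → ℝ) → (Fin (d + 1) → ℝ) → ℝ) (q : ℝ),
        (∀ l p u, 0 ≤ w l p u) → (∀ l p p' u, (∀ j < l, p j = p' j) → w l p u = w l p' u) →
        (∀ l p u, ‖u‖ = 1 → w l p u + w l p (-u) ≤ q) →
        ∑ s, ∏ j ∈ Finset.range k, w j (P s) (P s j) ≤ q ^ k := by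
  obtain ⟨c, hc, h0⟩ := exists_tree_zero (balanceMap F O k 0 0)
    ((continuous_balanceMap hF hOcont k 0).comp (Continuous.prodMk_right 0))
    (fun g c => balanceMap_act F O hO 0 0 g c)
  refine ⟨leafPath k 0 0 c, fun s s' => ?_, fun s j hj => ?_, fun s j hj => ?_,
    fun w q hw0 hwdep hwq => ?_⟩
  · have h1 := leafSum_eq_smul hdisj h0 s
    rw [leafSum_eq_smul hdisj h0 s'] at h1
    exact (smul_right_injective _ (pow_ne_zero k two_ne_zero) h1).symm
  · simpa using norm_leafPath 0 0 c hc s hj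
  · simpa using constraint_leafPath hdisj hO hOdep h0 s hj
  · simpa using sum_prod_leafPath_le w hw0 hwdep hwq 0 0 c hc

end BalancedTree

section MultiscaleWalk

variable {H : Type*} [NormedAddCommGroup H] [InnerProductSpace ℝ H] {r : ℕ}

/-- Step size of the multiscale walk: it is divided by nine after every block of `r` steps. -/
noncomputable def stepSize (r l : ℕ) : ℝ := 1 / 2 * (1 / 9) ^ (l / r)

/-- Position of the multiscale walk with directions `v` after `t` steps. -/
noncomputable def walk (r : ℕ) (v : ℕ → H) (t : ℕ) : H := ∑ l ∈ Finset.range t, stepSize r l • v l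

lemma stepSize_block (hr : 0 < r) (σ : ℕ) {j : ℕ} (hj : j < r) :
    stepSize r (r * σ + j) = 1 / 2 * (1 / 9) ^ σ := by
  rw [stepSize, Nat.mul_add_div hr, Nat.div_eq_of_lt hj, add_zero]

lemma walk_block (hr : 0 < r) (v : ℕ → H) (σ : ℕ) :
    walk r v (r * (σ + 1)) =
      walk r v (r * σ) + (1 / 2 * (1 / 9 : ℝ) ^ σ) • ∑ j : Fin r, v (r * σ + j) := by
  rw [walk, Nat.mul_succ, Finset.sum_range_add, ← walk, Finset.smul_sum, Finset.sum_range]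
  congr 1
  exact Finset.sum_congr rfl fun j _ => by rw [stepSize_block hr σ j.2]

lemma Orthonormal.norm_sum_eq {v : Fin r → H} (hv : Orthonormal ℝ v) :
    ‖∑ j, v j‖ = √r := by
  have h := hv.inner_sum (fun _ => 1) (fun _ => 1) Finset.univ
  simp only [one_smul, map_one, mul_one, Finset.sum_const, Finset.card_univ, Fintype.card_fin,
    nsmul_eq_mul] at h
  rw [real_inner_self_eq_norm_sq] at h
  rw [← h, Real.sqrt_sq (norm_nonneg _)]

lemma norm_walk_sub_le (hr : 0 < r) {v : ℕ → H} {S τ : ℕ} (hτ : τ ≤ S)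
    (hv : ∀ σ < S, Orthonormal ℝ fun j : Fin r => v (r * σ + j)) :
    ‖walk r v (r * S) - walk r v (r * τ)‖ ≤ 9 / 16 * √r * ((1 / 9) ^ τ - (1 / 9) ^ S) := by
  induction S, hτ using Nat.le_induction with
  | base => simp
  | succ S hS ih =>
    have h1 := ih fun σ hσ => hv σ (by omega)
    rw [walk_block hr, add_sub_right_comm]
    refine (norm_add_le _ _).trans ?_
    rw [norm_smul, (hv S (by omega)).norm_sum_eq, Real.norm_of_nonneg (by positivity), pow_succ]
    linarith

/-- A point close to the end of the walk is recognized at every scale by the directions. -/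
lemma sum_sq_inner_le (hr : 0 < r) {v : ℕ → H} {S : ℕ}
    (hv : ∀ σ < S, Orthonormal ℝ fun j : Fin r => v (r * σ + j)) {x : H}
    (hx : ‖x - walk r v (r * S)‖ ≤ 9 / 16 * √r * (1 / 9) ^ S) {σ : ℕ} (hσ : σ < S) :
    ∑ j : Fin r, (1 - inner ℝ (x - walk r v (r * σ)) (v (r * σ + j)) /
      (1 / 2 * (1 / 9) ^ σ)) ^ 2 ≤ (r : ℝ) / 64 := by
  set c : ℝ := 1 / 2 * (1 / 9) ^ σ with hc
  have hc0 : 0 < c := by positivity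
  have hon := hv σ hσ
  have hnorm : ‖x - walk r v (r * (σ + 1))‖ ≤ √r * c / 8 := by
    have h1 := norm_walk_sub_le hr (τ := σ + 1) hσ hv
    have h2 := norm_add_le (x - walk r v (r * S)) (walk r v (r * S) - walk r v (r * (σ + 1)))
    rw [sub_add_sub_cancel] at h2
    refine h2.trans ((add_le_add hx h1).trans (le_of_eq ?_))
    rw [hc, pow_succ]
    ring
  have hin : ∀ j : Fin r, 1 - inner ℝ (x - walk r v (r * σ)) (v (r * σ + j)) / c =
      -(inner ℝ (v (r * σ + j)) (x - walk r v (r * (σ + 1))) / c) := by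
    intro j
    have h1 : inner ℝ (v (r * σ + j)) (∑ i : Fin r, v (r * σ + i)) = (1 : ℝ) := by
      have := hon.inner_right_fintype (fun _ => 1) j
      simpa using this
    rw [walk_block hr, ← sub_sub, inner_sub_right, inner_smul_right, h1, real_inner_comm, ← hc]
    field_simp
    ring
  have hbes := hon.sum_inner_products_le (x - walk r v (r * (σ + 1))) (s := Finset.univ)
  simp only [hin, neg_sq, div_pow]
  rw [← Finset.sum_div, div_le_iff₀ (by positivity)]
  simp only [Real.norm_eq_abs, sq_abs] at hbes
  refine hbes.trans ((pow_le_pow_left₀ (norm_nonneg _) hnorm 2).trans (le_of_eq ?_))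
  rw [div_pow, mul_pow, Real.sq_sqrt (Nat.cast_nonneg r)]
  ring

/-- Weight measuring how well a direction agrees with the displacement to a target. -/
noncomputable def walkWeight (r : ℕ) (x : H) (l : ℕ) (v : ℕ → H) (u : H) : ℝ :=
  Real.exp (-2 * (1 - inner ℝ (x - walk r v (r * (l / r))) u / stepSize r l) ^ 2)

lemma walkWeight_add_neg_le (x : H) (l : ℕ) (v : ℕ → H) (u : H) :
    walkWeight r x l v u + walkWeight r x l v (-u) ≤ 5 / 4 := by
  have he : Real.exp (-2) ≤ 1 / 4 := by
    have h1 := Real.add_one_le_exp (1 : ℝ)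
    have h2 : Real.exp 2 = Real.exp 1 * Real.exp 1 := by rw [← Real.exp_add]; norm_num
    rw [Real.exp_neg, one_div]
    exact inv_anti₀ (by norm_num) (by nlinarith)
  have key : ∀ t : ℝ, 0 ≤ t →
      Real.exp (-2 * (1 - t) ^ 2) + Real.exp (-2 * (1 + t) ^ 2) ≤ 5 / 4 := by
    intro t ht
    have h1 : Real.exp (-2 * (1 - t) ^ 2) ≤ 1 := by
      rw [Real.exp_le_one_iff]; nlinarith [sq_nonneg (1 - t)]
    have h2 : Real.exp (-2 * (1 + t) ^ 2) ≤ Real.exp (-2) := by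
      rw [Real.exp_le_exp]; nlinarith
    linarith
  simp only [walkWeight, inner_neg_right, neg_div, sub_neg_eq_add]
  set t := inner ℝ (x - walk r v (r * (l / r))) u / stepSize r l
  rcases le_total 0 t with h | h
  · exact key t h
  · have := key (-t) (by linarith)
    rw [sub_neg_eq_add, ← sub_eq_add_neg] at this
    linarith

lemma prod_walkWeight_ge (hr : 0 < r) {v : ℕ → H} {S : ℕ}
    (hv : ∀ σ < S, Orthonormal ℝ fun j : Fin r => v (r * σ + j)) {x : H}
    (hx : ‖x - walk r v (r * S)‖ ≤ 9 / 16 * √r * (1 / 9) ^ S) :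
    (31 / 32 : ℝ) ^ (r * S) ≤ ∏ l ∈ Finset.range (r * S), walkWeight r x l v (v l) := by
  have hsum : ∀ T ≤ S, ∑ l ∈ Finset.range (r * T),
      (1 - inner ℝ (x - walk r v (r * (l / r))) (v l) / stepSize r l) ^ 2 ≤
        ((r * T : ℕ) : ℝ) / 64 := by
    intro T hT
    induction T with
    | zero => simp
    | succ T ih =>
      have h1 := sum_sq_inner_le hr hv hx (σ := T) (by omega)
      rw [Nat.mul_succ, Finset.sum_range_add, Finset.sum_range (n := r)]
      have h2 : ∀ j : Fin r, (1 - inner ℝ (x - walk r v (r * ((r * T + j) / r)))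
          (v (r * T + j)) / stepSize r (r * T + j)) ^ 2 =
          (1 - inner ℝ (x - walk r v (r * T)) (v (r * T + j)) / (1 / 2 * (1 / 9) ^ T)) ^ 2 := by
        intro j
        rw [stepSize_block hr T j.2, Nat.mul_add_div hr, Nat.div_eq_of_lt j.2, add_zero]
      simp only [h2]
      have h3 := ih (by omega)
      push_cast at h3 ⊢
      linarith
  have h31 : (31 / 32 : ℝ) ≤ Real.exp (-(1 / 32)) := by
    have := Real.add_one_le_exp (-(1 / 32) : ℝ)
    linarith
  calc (31 / 32 : ℝ) ^ (r * S) ≤ Real.exp (-(1 / 32)) ^ (r * S) :=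
        pow_le_pow_left₀ (by norm_num) h31 _
    _ = Real.exp ((r * S : ℕ) * -(1 / 32)) := (Real.exp_nat_mul _ _).symm
    _ ≤ _ := by
      simp only [walkWeight]
      rw [← Real.exp_sum, Real.exp_le_exp, ← Finset.mul_sum]
      have := hsum S le_rfl
      linarith

lemma walk_congr {v v' : ℕ → H} {t : ℕ} (h : ∀ j < t, v j = v' j) : walk r v t = walk r v' t :=
  Finset.sum_congr rfl fun l hl => by rw [h l (Finset.mem_range.1 hl)]

lemma walkWeight_congr (x : H) {l : ℕ} {v v' : ℕ → H} (u : H) (h : ∀ j < l, v j = v' j) :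
    walkWeight r x l v u = walkWeight r x l v' u := by
  rw [walkWeight, walkWeight, walk_congr fun j hj => h j (hj.trans_le (Nat.mul_div_le l r))]

end MultiscaleWalk

section FoldedTree

/-- The triangle wave of period two and slope one, which folds the line onto the unit interval. -/
noncomputable def triangleWave (t : ℝ) : unitInterval :=
  ⟨Real.arccos (Real.cos (Real.pi * t)) / Real.pi,
    div_nonneg (Real.arccos_nonneg _) Real.pi_pos.le,
    div_le_one_of_le₀ (Real.arccos_le_pi _) Real.pi_pos.le⟩

lemma continuous_triangleWave : Continuous triangleWave :=
  ((Real.continuous_arccos.comp (Real.continuous_cos.comp (by fun_prop))).div_const _).subtype_mk _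

lemma abs_triangleWave_sub {s t : ℝ} (h : ⌊s⌋ = ⌊t⌋) :
    |(triangleWave s : ℝ) - triangleWave t| = |s - t| := by
  have hpi := Real.pi_pos
  have key : ∀ t : ℝ, (triangleWave t : ℝ) =
      if Even ⌊t⌋ then Int.fract t else 1 - Int.fract t := by
    intro t
    have h0 := Int.fract_nonneg t
    have h1 := (Int.fract_lt_one t).le
    have harc : Real.arccos (Real.cos (Real.pi * Int.fract t)) = Real.pi * Int.fract t :=
      Real.arccos_cos (by positivity) (by nlinarith)
    have hcos : Real.cos (Real.pi * t) = (-1) ^ ⌊t⌋ * Real.cos (Real.pi * Int.fract t) := by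
      rw [← Real.cos_add_int_mul_pi]
      congr 1
      nth_rewrite 1 [← Int.fract_add_floor t]
      ring
    simp only [triangleWave, hcos]
    split_ifs with he
    · rw [he.neg_one_zpow, one_mul, harc]
      field_simp
    · rw [(Int.not_even_iff_odd.1 he).neg_one_zpow, neg_one_mul, Real.arccos_neg, harc]
      field_simp
  rw [key, key, h, Int.fract, Int.fract, h]
  split_ifs
  · congr 1; ring
  · rw [abs_sub_comm]; congr 1; ring

variable {n : ℕ}

/-- Radial truncation of a vector to the Euclidean unit ball. -/
noncomputable def truncateVec (u : Fin n → ℝ) : EuclideanSpace ℝ (Fin n) :=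
  (max ‖WithLp.toLp 2 u‖ 1)⁻¹ • WithLp.toLp 2 u

lemma continuous_truncateVec : Continuous (truncateVec (n := n)) := by
  have h : Continuous fun u : Fin n → ℝ => (WithLp.toLp 2 u : EuclideanSpace ℝ (Fin n)) :=
    PiLp.continuous_toLp 2 _
  exact ((h.norm.max continuous_const).inv₀ fun u =>
    (lt_of_lt_of_le one_pos (le_max_right _ _)).ne').smul h

lemma truncateVec_neg (u : Fin n → ℝ) : truncateVec (-u) = -truncateVec u := by
  simp [truncateVec, WithLp.toLp_neg]

lemma norm_truncateVec {u : Fin n → ℝ} (hu : ‖u‖ = 1) : ‖truncateVec u‖ = 1 := by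
  have h : 1 ≤ ‖(WithLp.toLp 2 u : EuclideanSpace ℝ (Fin n))‖ := by
    rw [← hu, pi_norm_le_iff_of_nonneg (norm_nonneg _)]
    exact fun i => PiLp.norm_apply_le (WithLp.toLp 2 u : EuclideanSpace ℝ (Fin n)) i
  rw [truncateVec, max_eq_left h, norm_smul, norm_inv, norm_norm, inv_mul_cancel₀ (by positivity)]

/-- A continuous map from a cube to a space of dimension smaller by `r` takes the same value
at the `2 ^ (r * S)` endpoints of some walks which rarely end close to each other. -/
theorem exists_separated_fiber {d m r : ℕ} (hmr : m + r = d + 1) (hr : 0 < r) (S : ℕ)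
    {f : (Fin (d + 1) → unitInterval) → Fin m → ℝ} (hf : Continuous f) :
    ∃ X : (Fin (r * S) → Bool) → EuclideanSpace ℝ (Fin (d + 1)),
      (∀ s s', f (fun i => triangleWave (X s i)) = f (fun i => triangleWave (X s' i))) ∧
      (∀ s, ‖X s‖ ≤ 9 / 16 * √r) ∧
      ∀ (x : EuclideanSpace ℝ (Fin (d + 1))) (A : Finset (Fin (r * S) → Bool)),
        (∀ s ∈ A, ‖x - X s‖ ≤ 9 / 16 * √r * (1 / 9) ^ S) → (A.card : ℝ) ≤ (4 / 3) ^ (r * S) := by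
  set h : (ℕ → Fin (d + 1) → ℝ) → ℕ → EuclideanSpace ℝ (Fin (d + 1)) :=
    fun p l => truncateVec (p l) with hh
  have hcongr : ∀ l (p p' : ℕ → Fin (d + 1) → ℝ), (∀ j < l, p j = p' j) →
      ∀ j < l, h p j = h p' j := fun l p p' hp j hj => by simp only [hh, hp j hj]
  obtain ⟨P, hPf, hPn, hPO, hPw⟩ := exists_balanced_tree (d := d) (r * S)
    (F := fun p i => if hi : (i : ℕ) < m then
      f (fun j => triangleWave (walk r (h p) (r * S) j)) ⟨i, hi⟩ else 0)
    (O := fun l p u i => if m ≤ i ∧ (i - m : ℕ) < l % r then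
      inner ℝ (truncateVec u) (truncateVec (p (l - 1 - (i - m)))) else 0)
    (by
      have hwalk : Continuous fun p => walk r (h p) (r * S) :=
        continuous_finsetSum _ fun l _ => (continuous_truncateVec.comp
          (continuous_apply l)).const_smul (stepSize r l)
      refine continuous_pi fun i => ?_
      split_ifs with hi
      · refine (continuous_apply _).comp (hf.comp (continuous_pi fun j =>
          continuous_triangleWave.comp ?_))
        exact (PiLp.continuous_apply 2 _ j).comp hwalk
      · exact continuous_const)
    (by
      intro l
      refine continuous_pi fun i => ?_
      split_ifs
      · exact (continuous_truncateVec.comp continuous_snd).inner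
          (continuous_truncateVec.comp ((continuous_apply _).comp continuous_fst))
      · exact continuous_const)
    (by
      intro i
      by_cases hi : (i : ℕ) < m
      · exact Or.inr fun l p u => if_neg fun h => by omega
      · exact Or.inl fun p => dif_neg hi)
    (by
      intro l p u
      funext i
      simp only [Pi.neg_apply, truncateVec_neg, inner_neg_left]
      split_ifs <;> simp)
    (by
      intro l p p' u hp
      funext i
      split_ifs with hi
      · have := Nat.mod_le l r
        rw [hp _ (by omega)]
      · rfl)
  have hon : ∀ s, ∀ σ < S, Orthonormal ℝ fun j : Fin r => h (P s) (r * σ + j) := by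
    intro s σ hσ
    have hlt : ∀ j : Fin r, r * σ + j < r * S := fun j =>
      calc r * σ + j < r * (σ + 1) := by rw [Nat.mul_succ]; have := j.2; omega
        _ ≤ r * S := Nat.mul_le_mul_left r hσ
    have key : ∀ i j : Fin r, i < j →
        inner ℝ (h (P s) (r * σ + j)) (h (P s) (r * σ + i)) = (0 : ℝ) := by
      intro i j hij
      have hij' : (i : ℕ) < j := hij
      have hj := j.2
      have hmod : (r * σ + j) % r = j := by rw [Nat.mul_add_mod, Nat.mod_eq_of_lt hj]
      have := congrFun (hPO s _ (hlt j)) ⟨m + (j - 1 - i), by omega⟩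
      simp only [Pi.zero_apply, hmod] at this
      rw [if_pos (by omega), show r * σ + j - 1 - (m + (j - 1 - i) - m) = r * σ + i by omega]
        at this
      exact this
    refine ⟨fun j => norm_truncateVec (hPn s _ (hlt j)), fun i j hij => ?_⟩
    rcases lt_or_gt_of_ne hij with h1 | h1
    · rw [real_inner_comm]
      exact key i j h1
    · exact key j i h1
  refine ⟨fun s => walk r (h (P s)) (r * S), fun s s' => ?_, fun s => ?_, fun x A hA => ?_⟩
  · funext i
    have := congrFun (hPf s s') ⟨i, by omega⟩
    simpa using this
  · have := norm_walk_sub_le hr (Nat.zero_le S) (hon s)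
    simp only [mul_zero, pow_zero] at this
    have h0 : walk r (h (P s)) 0 = 0 := by simp [walk]
    rw [h0, sub_zero] at this
    refine this.trans ?_
    have h1 : (0 : ℝ) ≤ (1 / 9) ^ S := by positivity
    have h2 := Real.sqrt_nonneg (r : ℝ)
    nlinarith
  · have hsum := hPw (fun l p u => walkWeight r x l (h p) (truncateVec u)) (5 / 4)
      (fun l p u => (Real.exp_pos _).le)
      (fun l p p' u hp => walkWeight_congr x _ (hcongr l p p' hp))
      (fun l p u _ => by rw [truncateVec_neg]; exact walkWeight_add_neg_le x l (h p) _)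
    have hle : (A.card : ℝ) * (31 / 32) ^ (r * S) ≤ (5 / 4) ^ (r * S) := by
      refine le_trans ?_ hsum
      rw [← nsmul_eq_mul, ← Finset.sum_const]
      refine (Finset.sum_le_sum fun s hs => prod_walkWeight_ge hr (hon s) (hA s hs)).trans ?_
      exact Finset.sum_le_univ_sum_of_nonneg fun s =>
        Finset.prod_nonneg fun l _ => (Real.exp_pos _).le
    rw [← le_div_iff₀ (by positivity), ← div_pow] at hle
    exact hle.trans (pow_le_pow_left₀ (by norm_num) (by norm_num) _)

end FoldedTree

section Counting

lemma sum_half_pow_natAbs_le (M : ℕ) :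
    ∑ b ∈ Finset.Icc (-(M : ℤ)) M, (1 / 2 : ℝ) ^ b.natAbs ≤ 3 - 2 * (1 / 2) ^ M := by
  induction M with
  | zero => norm_num
  | succ M ih =>
    have h : Finset.Icc (-((M + 1 : ℕ) : ℤ)) ((M + 1 : ℕ) : ℤ) =
        insert (-((M + 1 : ℕ) : ℤ)) (insert ((M + 1 : ℕ) : ℤ) (Finset.Icc (-(M : ℤ)) M)) := by
      ext b
      simp only [Finset.mem_insert, Finset.mem_Icc]
      omega
    rw [h, Finset.sum_insert (by simp; omega), Finset.sum_insert (by simp), Int.natAbs_neg,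
      Int.natAbs_natCast]
    refine (add_le_add_right (add_le_add_right ih _) _).trans (le_of_eq ?_)
    ring

/-- An `ℓ¹`-ball of radius `2 * n` in `ℤ ^ n` has at most `12 ^ n` points. -/
lemma card_le_of_sum_natAbs_le {n : ℕ} (B : Finset (Fin n → ℤ))
    (hB : ∀ v ∈ B, ∑ i, (v i).natAbs ≤ 2 * n) : B.card ≤ 12 ^ n := by
  have hsub : B ⊆ Fintype.piFinset fun _ : Fin n =>
      Finset.Icc (-((2 * n : ℕ) : ℤ)) (2 * n : ℕ) := by
    intro v hv
    rw [Fintype.mem_piFinset]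
    intro i
    have h1 := (Finset.single_le_sum (f := fun i => (v i).natAbs) (fun _ _ => Nat.zero_le _)
      (Finset.mem_univ i)).trans (hB v hv)
    rw [Finset.mem_Icc]
    omega
  have hsum : (B.card : ℝ) * (1 / 4) ^ n ≤ 3 ^ n := by
    calc (B.card : ℝ) * (1 / 4) ^ n = ∑ _v ∈ B, (1 / 2 : ℝ) ^ (2 * n) := by
          rw [Finset.sum_const, nsmul_eq_mul, pow_mul]; norm_num
      _ ≤ ∑ v ∈ B, ∏ i, (1 / 2 : ℝ) ^ (v i).natAbs := by
          refine Finset.sum_le_sum fun v hv => ?_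
          rw [Finset.prod_pow_eq_pow_sum]
          exact pow_le_pow_of_le_one (by norm_num) (by norm_num) (hB v hv)
      _ ≤ ∑ v ∈ Fintype.piFinset fun _ : Fin n =>
            Finset.Icc (-((2 * n : ℕ) : ℤ)) (2 * n : ℕ), ∏ i, (1 / 2 : ℝ) ^ (v i).natAbs :=
          Finset.sum_le_sum_of_subset_of_nonneg hsub fun v _ _ => by positivity
      _ = ∏ _i : Fin n, ∑ b ∈ Finset.Icc (-((2 * n : ℕ) : ℤ)) (2 * n : ℕ),
            (1 / 2 : ℝ) ^ b.natAbs :=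
          (Finset.prod_univ_sum (fun _ : Fin n => Finset.Icc (-((2 * n : ℕ) : ℤ)) (2 * n : ℕ))
            fun _ b => (1 / 2 : ℝ) ^ b.natAbs).symm
      _ ≤ ∏ _i : Fin n, (3 : ℝ) := by
          refine Finset.prod_le_prod (fun _ _ => by positivity) fun _ _ => ?_
          have h1 := sum_half_pow_natAbs_le (2 * n)
          have h2 : (0 : ℝ) ≤ (1 / 2) ^ (2 * n) := by positivity
          linarith
      _ = 3 ^ n := by simp
  have h4 : (B.card : ℝ) ≤ 12 ^ n := by
    calc (B.card : ℝ) = B.card * (1 / 4) ^ n * 4 ^ n := by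
          rw [mul_assoc, ← mul_pow]; norm_num
      _ ≤ 3 ^ n * 4 ^ n := by gcongr
      _ = 12 ^ n := by rw [← mul_pow]; norm_num
  exact_mod_cast h4

lemma sum_natAbs_floor_le {n : ℕ} (x : EuclideanSpace ℝ (Fin n)) (hx : ‖x‖ ≤ √n) :
    ∑ i, ⌊x i⌋.natAbs ≤ 2 * n := by
  have h1 : ∑ i, x i ^ 2 ≤ (n : ℝ) := by
    rw [← EuclideanSpace.real_norm_sq_eq, ← Real.sq_sqrt (Nat.cast_nonneg n)]
    gcongr
  have h2 : ∀ i, ((⌊x i⌋.natAbs : ℕ) : ℝ) ≤ 3 / 2 + x i ^ 2 / 2 := by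
    intro i
    rw [Nat.cast_natAbs, Int.cast_abs]
    have h3 := Int.floor_le (x i)
    have h4 := Int.lt_floor_add_one (x i)
    rw [abs_le]
    constructor <;> nlinarith [sq_nonneg (x i + 1), sq_nonneg (x i - 1)]
  have h3 : ((∑ i, ⌊x i⌋.natAbs : ℕ) : ℝ) ≤ 2 * n := by
    rw [Nat.cast_sum]
    refine (Finset.sum_le_sum fun i _ => h2 i).trans ?_
    rw [Finset.sum_add_distrib, ← Finset.sum_div (f := fun i => x i ^ 2), Finset.sum_const,
      Finset.card_univ, Fintype.card_fin, nsmul_eq_mul]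
    linarith
  exact_mod_cast h3

/-- A continuous map from a cube to a space of dimension smaller by `r` has a fiber that
needs many pieces of small diameter to be covered. -/
theorem exists_large_fiber {d m r : ℕ} (hmr : m + r = d + 1) (hr : 0 < r) (S : ℕ)
    {f : (Fin (d + 1) → unitInterval) → Fin m → ℝ} (hf : Continuous f) :
    ∃ x₀, ∀ (K : ℕ) (ε : ℝ) (U : Fin K → Set (Fin (d + 1) → unitInterval)),
      ε * √(d + 1 : ℕ) ≤ 9 / 16 * √r * (1 / 9) ^ S →
      (∀ k, ∀ x ∈ U k, ∀ y ∈ U k, ∀ i, |(x i : ℝ) - y i| ≤ ε) →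
      f ⁻¹' {f x₀} ⊆ ⋃ k, U k → (3 / 2 : ℝ) ^ (r * S) ≤ K * 12 ^ (d + 1) := by
  obtain ⟨X, hX, hXn, hXs⟩ := exists_separated_fiber hmr hr S hf
  refine ⟨fun i => triangleWave (X (fun _ => false) i), fun K ε U hε hU hcov => ?_⟩
  have hex : ∀ s, ∃ k, (fun i => triangleWave (X s i)) ∈ U k := fun s =>
    Set.mem_iUnion.1 (hcov (hX s _))
  choose col hcol using hex
  classical
  set B : Finset (Fin (d + 1) → ℤ) := Finset.univ.image fun s i => ⌊X s i⌋ with hBdef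
  have hB : B.card ≤ 12 ^ (d + 1) := by
    refine card_le_of_sum_natAbs_le B fun v hv => ?_
    obtain ⟨s, -, rfl⟩ := Finset.mem_image.1 hv
    refine sum_natAbs_floor_le (X s) ((hXn s).trans ?_)
    have h1 : √(r : ℝ) ≤ √(d + 1 : ℕ) := Real.sqrt_le_sqrt (by exact_mod_cast (by omega))
    have h2 := Real.sqrt_nonneg (r : ℝ)
    linarith
  have hclass : ∀ p : Fin K × (Fin (d + 1) → ℤ),
      ((Finset.univ.filter fun s => (col s, fun i => ⌊X s i⌋) = p).card : ℝ) ≤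
        (4 / 3) ^ (r * S) := by
    intro p
    rcases (Finset.univ.filter fun s => (col s, fun i => ⌊X s i⌋) = p).eq_empty_or_nonempty with
      h0 | ⟨t, ht⟩
    · rw [h0, Finset.card_empty, Nat.cast_zero]
      positivity
    · refine hXs (X t) _ fun s hs => le_trans ?_ hε
      have hts := (Finset.mem_filter.1 ht).2.trans (Finset.mem_filter.1 hs).2.symm
      rw [Prod.mk.injEq] at hts
      have hcoord : ∀ i, |X t i - X s i| ≤ ε := by
        intro i
        rw [← abs_triangleWave_sub (congrFun hts.2 i)]
        exact hU (col t) _ (hcol t) _ (hts.1 ▸ hcol s) i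
      have hε0 : 0 ≤ ε := (abs_nonneg _).trans (hcoord 0)
      rw [EuclideanSpace.norm_eq, ← Real.sqrt_sq hε0, ← Real.sqrt_mul (sq_nonneg ε)]
      refine Real.sqrt_le_sqrt ?_
      calc ∑ i, ‖(X t - X s) i‖ ^ 2 ≤ ∑ _i : Fin (d + 1), ε ^ 2 :=
            Finset.sum_le_sum fun i _ => by
              rw [PiLp.sub_apply, Real.norm_eq_abs]
              exact pow_le_pow_left₀ (abs_nonneg _) (hcoord i) 2
        _ = ε ^ 2 * (d + 1 : ℕ) := by simp [mul_comm]
  have htotal : (2 : ℝ) ^ (r * S) ≤ K * 12 ^ (d + 1) * (4 / 3) ^ (r * S) := by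
    have h1 := Finset.card_eq_sum_card_fiberwise (s := Finset.univ)
      (t := (Finset.univ : Finset (Fin K)) ×ˢ B) (f := fun s => (col s, fun i => ⌊X s i⌋))
      (fun s _ => Finset.mem_coe.2 (Finset.mem_product.2 ⟨Finset.mem_univ _,
        Finset.mem_image_of_mem _ (Finset.mem_univ s)⟩))
    rw [Finset.card_univ, Fintype.card_fun, Fintype.card_bool, Fintype.card_fin] at h1
    have h2 := congrArg (Nat.cast : ℕ → ℝ) h1
    rw [Nat.cast_pow, Nat.cast_ofNat, Nat.cast_sum] at h2
    rw [h2]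
    refine (Finset.sum_le_sum fun p _ => hclass p).trans ?_
    rw [Finset.sum_const, Finset.card_product, Finset.card_univ, Fintype.card_fin, nsmul_eq_mul]
    gcongr
    exact_mod_cast Nat.mul_le_mul_left K hB
  rw [← div_le_iff₀ (by positivity), ← div_pow] at htotal
  norm_num at htotal ⊢
  exact htotal

end Counting

section CoveringNumbers

variable {X : Type*} {ρ : X → X → ℝ}

lemma lt_of_mem_of_setEDiam_lt {U : Set X} {ε : ℝ} (hU : setEDiam ρ U < ENNReal.ofReal ε)
    {x y : X} (hx : x ∈ U) (hy : y ∈ U) : ρ x y < ε := by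
  have h : ENNReal.ofReal (ρ x y) ≤ setEDiam ρ U :=
    (le_iSup₂ (f := fun y (_ : y ∈ U) => ENNReal.ofReal (ρ x y)) y hy).trans
      (le_iSup₂ (f := fun x (_ : x ∈ U) => ⨆ y ∈ U, ENNReal.ofReal (ρ x y)) x hx)
  have h1 := h.trans_lt hU
  have hε : 0 < ε := ENNReal.ofReal_pos.1 (bot_le.trans_lt h1)
  exact (ENNReal.ofReal_lt_ofReal_iff hε).1 h1

/-- Finitely many small `ρ`-open sets cover a compact space. -/
lemma exists_finite_cover [TopologicalSpace X] [CompactSpace X]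
    (hcomm : ∀ x y, ρ x y = ρ y x) (htri : ∀ x y z, ρ x z ≤ ρ x y + ρ y z)
    (hnhds : ∀ x, ∀ δ > 0, ∀ᶠ y in 𝓝 x, ρ x y < δ) {ε : ℝ} (hε : 0 < ε) :
    ∃ (n : ℕ) (U : Fin n → Set X), (∀ i, ROpen ρ (U i)) ∧
      (∀ i, setEDiam ρ (U i) < ENNReal.ofReal ε) ∧ Set.univ ⊆ ⋃ i, U i := by
  obtain ⟨t, -, ht⟩ := isCompact_univ.elim_nhds_subcover (fun x => {y | ρ x y < ε / 3})
    fun x _ => hnhds x (ε / 3) (by positivity)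
  refine ⟨t.card, fun i => {y | ρ (t.equivFin.symm i) y < ε / 3}, fun i y hy => ?_,
    fun i => ?_, fun y _ => ?_⟩
  · refine ⟨ε / 3 - ρ (t.equivFin.symm i) y, sub_pos.2 hy, fun z hz => ?_⟩
    have h1 := htri (t.equivFin.symm i) y z
    change ρ (t.equivFin.symm i) z < ε / 3
    linarith
  · refine lt_of_le_of_lt (iSup₂_le fun y hy => iSup₂_le fun z hz => ENNReal.ofReal_le_ofReal ?_)
      ((ENNReal.ofReal_lt_ofReal_iff hε).2 (show 2 * ε / 3 < ε by linarith))
    have h1 := htri y (t.equivFin.symm i) z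
    rw [hcomm y (t.equivFin.symm i)] at h1
    have h2 : ρ (t.equivFin.symm i) y < ε / 3 := hy
    have h3 : ρ (t.equivFin.symm i) z < ε / 3 := hz
    linarith
  · obtain ⟨x, hx, hy⟩ := Set.mem_iUnion₂.1 (ht (Set.mem_univ y))
    exact Set.mem_iUnion.2 ⟨t.equivFin ⟨x, hx⟩, by simpa using hy⟩

variable {Y : Type*} {ε : ℝ}

lemma log_covNum_le_supLogCov (hcov : ∃ (n : ℕ) (U : Fin n → Set X), (∀ i, ROpen ρ (U i)) ∧
    (∀ i, setEDiam ρ (U i) < ENNReal.ofReal ε) ∧ Set.univ ⊆ ⋃ i, U i) (π : X → Y) (y : Y) :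
    Real.log (covNum ρ ε (π ⁻¹' {y})) ≤ supLogCov π ρ ε := by
  obtain ⟨n, U, hU, hd, hc⟩ := hcov
  refine le_ciSup (f := fun y => Real.log (covNum ρ ε (π ⁻¹' {y}) : ℝ))
    ⟨Real.log n, ?_⟩ y
  rintro _ ⟨z, rfl⟩
  have h : covNum ρ ε (π ⁻¹' {z}) ≤ n :=
    Nat.sInf_le ⟨U, hU, hd, (Set.subset_univ _).trans hc⟩
  rcases Nat.eq_zero_or_pos (covNum ρ ε (π ⁻¹' {z})) with h0 | h0
  · simpa [h0] using Real.log_natCast_nonneg n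
  · exact Real.log_le_log (by exact_mod_cast h0) (by exact_mod_cast h)

lemma exists_cover_card_covNum (hcov : ∃ (n : ℕ) (U : Fin n → Set X), (∀ i, ROpen ρ (U i)) ∧
    (∀ i, setEDiam ρ (U i) < ENNReal.ofReal ε) ∧ Set.univ ⊆ ⋃ i, U i) (E : Set X) :
    ∃ U : Fin (covNum ρ ε E) → Set X, (∀ i, setEDiam ρ (U i) < ENNReal.ofReal ε) ∧
      E ⊆ ⋃ i, U i := by
  obtain ⟨n, U, hU, hd, hc⟩ := hcov
  obtain ⟨V, -, hV, hE⟩ := Nat.sInf_mem (s := {n : ℕ | ∃ U : Fin n → Set X,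
    (∀ i, ROpen ρ (U i)) ∧ (∀ i, setEDiam ρ (U i) < ENNReal.ofReal ε) ∧ E ⊆ ⋃ i, U i})
    ⟨n, U, hU, hd, (Set.subset_univ _).trans hc⟩
  exact ⟨V, hV, hE⟩

end CoveringNumbers

section DynamicalMetric

variable {X : Type*} {T : X → X} {d : X → X → ℝ} {N : ℕ}

lemma le_dynDist {n : ℕ} (hn : n < N) (x y : X) : d (T^[n] x) (T^[n] y) ≤ dynDist T d N x y := by
  refine le_csSup (Set.Finite.bddAbove ?_) ⟨n, hn, rfl⟩
  refine ((Set.finite_lt_nat N).image fun n => d (T^[n] x) (T^[n] y)).subset ?_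
  rintro _ ⟨n, hn, rfl⟩
  exact ⟨n, hn, rfl⟩

lemma dynDist_le {x y : X} {c : ℝ} (hc : 0 ≤ c) (h : ∀ n < N, d (T^[n] x) (T^[n] y) ≤ c) :
    dynDist T d N x y ≤ c := by
  refine Real.sSup_le ?_ hc
  rintro _ ⟨n, hn, rfl⟩
  exact h n hn

lemma dynDist_nonneg (hd : ∀ x y, 0 ≤ d x y) (x y : X) : 0 ≤ dynDist T d N x y := by
  refine Real.sSup_nonneg ?_
  rintro _ ⟨n, -, rfl⟩
  exact hd _ _

lemma dynDist_comm (hd : ∀ x y, d x y = d y x) (x y : X) :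
    dynDist T d N x y = dynDist T d N y x := by
  simp only [dynDist, hd]

lemma dynDist_triangle (hd : ∀ x y, 0 ≤ d x y) (htri : ∀ x y z, d x z ≤ d x y + d y z)
    (x y z : X) : dynDist T d N x z ≤ dynDist T d N x y + dynDist T d N y z :=
  dynDist_le (add_nonneg (dynDist_nonneg hd x y) (dynDist_nonneg hd y z)) fun _ hn =>
    (htri _ _ _).trans (add_le_add (le_dynDist hn x y) (le_dynDist hn y z))

lemma eventually_dynDist_lt [TopologicalSpace X] (hT : Continuous T) (hself : ∀ x, d x x = 0)
    (hd : Continuous fun p : X × X => d p.1 p.2) (x : X) {δ : ℝ} (hδ : 0 < δ) :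
    ∀ᶠ y in 𝓝 x, dynDist T d N x y < δ := by
  have h : ∀ᶠ y in 𝓝 x, ∀ n ∈ {n | n < N}, d (T^[n] x) (T^[n] y) < δ / 2 := by
    rw [eventually_all_finite (Set.finite_lt_nat N)]
    intro n _
    have hc : Continuous fun y => d (T^[n] x) (T^[n] y) :=
      hd.comp (continuous_const.prodMk (hT.iterate n))
    refine hc.continuousAt.eventually_lt continuousAt_const ?_
    rw [hself]
    positivity
  filter_upwards [h] with y hy
  exact (dynDist_le (by positivity) fun n hn => (hy n hn).le).trans_lt (half_lt_self hδ)

end DynamicalMetric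

section FullShiftMetric

variable {a : ℕ}

lemma cubeDist_nonneg (x y : Cube a) : 0 ≤ cubeDist x y := norm_nonneg _

lemma abs_sub_le_cubeDist (x y : Cube a) (i : Fin a) : |(x i : ℝ) - y i| ≤ cubeDist x y :=
  norm_le_pi_norm ((fun i => (x i : ℝ)) - fun i => (y i : ℝ)) i

lemma cubeDist_le_one (x y : Cube a) : cubeDist x y ≤ 1 := by
  refine (pi_norm_le_iff_of_nonneg zero_le_one).2 fun i => ?_
  have h1 := (x i).2
  have h2 := (y i).2
  rw [Pi.sub_apply, Real.norm_eq_abs, abs_le]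
  constructor <;> linarith [h1.1, h1.2, h2.1, h2.2]

lemma summable_two_zpow_neg_abs : Summable fun n : ℤ => (2 : ℝ) ^ (-|n|) := by
  have h : ∀ n : ℕ, (2 : ℝ) ^ (-(n : ℤ)) = (1 / 2) ^ n := fun n => by
    rw [zpow_neg, zpow_natCast, one_div, inv_pow]
  refine summable_int_iff_summable_nat_and_neg.2 ⟨?_, ?_⟩ <;>
    simpa only [abs_neg, Nat.abs_cast, h] using summable_geometric_two

lemma norm_shiftDist_term_le (x y : FullShift a) (n : ℤ) :
    ‖(2 : ℝ) ^ (-|n|) * cubeDist (x n) (y n)‖ ≤ (2 : ℝ) ^ (-|n|) := by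
  have h : (0 : ℝ) < 2 ^ (-|n|) := by positivity
  rw [Real.norm_of_nonneg (mul_nonneg h.le (cubeDist_nonneg _ _))]
  exact mul_le_of_le_one_right h.le (cubeDist_le_one _ _)

lemma summable_shiftDist (x y : FullShift a) :
    Summable fun n : ℤ => (2 : ℝ) ^ (-|n|) * cubeDist (x n) (y n) :=
  summable_two_zpow_neg_abs.of_norm_bounded (norm_shiftDist_term_le x y)

lemma shiftDist_nonneg (x y : FullShift a) : 0 ≤ shiftDist x y :=
  tsum_nonneg fun _ => mul_nonneg (by positivity) (cubeDist_nonneg _ _)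

lemma shiftDist_self (x : FullShift a) : shiftDist x x = 0 := by
  simp [shiftDist, cubeDist]

lemma shiftDist_comm (x y : FullShift a) : shiftDist x y = shiftDist y x := by
  simp only [shiftDist, cubeDist, norm_sub_rev]

lemma shiftDist_triangle (x y z : FullShift a) :
    shiftDist x z ≤ shiftDist x y + shiftDist y z := by
  rw [shiftDist, shiftDist, shiftDist,
    ← (summable_shiftDist x y).tsum_add (summable_shiftDist y z)]
  refine (summable_shiftDist x z).tsum_le_tsum (fun n => ?_)
    ((summable_shiftDist x y).add (summable_shiftDist y z))
  rw [← mul_add]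
  exact mul_le_mul_of_nonneg_left (norm_sub_le_norm_sub_add_norm_sub _ _ _) (by positivity)

lemma continuous_shiftDist :
    Continuous fun p : FullShift a × FullShift a => shiftDist p.1 p.2 := by
  have h : ∀ n : ℤ, Continuous fun p : FullShift a × FullShift a => cubeDist (p.1 n) (p.2 n) := by
    intro n
    unfold cubeDist
    fun_prop
  exact continuous_tsum (fun n => continuous_const.mul (h n)) summable_two_zpow_neg_abs
    fun n p => norm_shiftDist_term_le p.1 p.2 n

lemma cubeDist_zero_le_shiftDist (x y : FullShift a) : cubeDist (x 0) (y 0) ≤ shiftDist x y := by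
  have h := (summable_shiftDist x y).le_tsum 0
    fun n _ => mul_nonneg (by positivity) (cubeDist_nonneg _ _)
  simpa [shiftDist] using h

lemma continuous_shift {α : Type*} [TopologicalSpace α] :
    Continuous (shift : (ℤ → α) → ℤ → α) :=
  continuous_pi fun n => continuous_apply (n + 1)

lemma iterate_shift_apply {α : Type*} (n : ℕ) (x : ℤ → α) (k : ℤ) :
    shift^[n] x k = x (k + n) := by
  induction n generalizing k with
  | zero => simp
  | succ n ih =>
    rw [Function.iterate_succ_apply', shift, ih]
    congr 1
    push_cast
    ring

lemma exists_finite_cover_dynDist (a N : ℕ) {ε : ℝ} (hε : 0 < ε) :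
    ∃ (n : ℕ) (U : Fin n → Set (FullShift a)),
      (∀ i, ROpen (dynDist shift shiftDist N) (U i)) ∧
      (∀ i, setEDiam (dynDist shift shiftDist N) (U i) < ENNReal.ofReal ε) ∧
      Set.univ ⊆ ⋃ i, U i :=
  exists_finite_cover (dynDist_comm shiftDist_comm)
    (dynDist_triangle shiftDist_nonneg shiftDist_triangle)
    (fun x _ hδ => eventually_dynDist_lt continuous_shift shiftDist_self continuous_shiftDist x hδ)
    hε

end FullShiftMetric

section PeriodicPoints

/-- The `N`-periodic point of the full shift with prescribed coordinates on a period. -/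
def periodicPoint {a N n : ℕ} (e : ZMod N × Fin a ≃ Fin n) (x : Fin n → unitInterval) :
    FullShift a :=
  fun i j => x (e (i, j))

variable {a b N n : ℕ}

lemma continuous_periodicPoint (e : ZMod N × Fin a ≃ Fin n) : Continuous (periodicPoint e) :=
  continuous_pi fun _ => continuous_pi fun _ => continuous_apply _

lemma iterate_shift_periodicPoint (e : ZMod N × Fin a ≃ Fin n) (x : Fin n → unitInterval) :
    shift^[N] (periodicPoint e x) = periodicPoint e x := by
  funext i j
  rw [iterate_shift_apply]
  simp [periodicPoint]

lemma abs_sub_le_dynDist_periodicPoint [NeZero N] (e : ZMod N × Fin a ≃ Fin n)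
    (x y : Fin n → unitInterval) (k : Fin n) :
    |(x k : ℝ) - y k| ≤
      dynDist shift shiftDist N (periodicPoint e x) (periodicPoint e y) := by
  refine le_trans ?_ (le_dynDist (ZMod.val_lt (e.symm k).1) _ _)
  refine le_trans ?_ (cubeDist_zero_le_shiftDist _ _)
  refine le_trans (le_of_eq ?_) (abs_sub_le_cubeDist _ _ (e.symm k).2)
  simp [iterate_shift_apply, periodicPoint]

lemma apply_val_intCast {α : Type*} [NeZero N] {y : ℤ → α} (hy : shift^[N] y = y) (i : ℤ) :
    y ((i : ZMod N).val : ℤ) = y i := by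
  have hper : Function.Periodic y (N : ℤ) := fun k => by
    conv_rhs => rw [← hy, iterate_shift_apply]
  have h := hper.sub_zsmul_eq (x := i) (i / N)
  rwa [smul_eq_mul, mul_comm, ← Int.emod_def, ← ZMod.val_intCast] at h

/-- An equivariant map from the full shift on `[0,1]^a` to the full shift on `[0,1]^b` has
fibers of exponentially large cardinality at any small scale if `b < a`. -/
lemma log_le_supLogCov (hab : b < a) {π : FullShift a → FullShift b} (hcont : Continuous π)
    (hequiv : ∀ x, π (shift x) = shift (π x)) (S : ℕ) {ε : ℝ} (hε : 0 < ε)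
    (hεS : ε * a ≤ 9 / 16 * (1 / 9) ^ S) {N : ℕ} (hN : 0 < N) :
    N * (S * Real.log (3 / 2) - a * Real.log 12) ≤
      supLogCov π (dynDist shift shiftDist N) ε := by
  have : NeZero N := ⟨hN.ne'⟩
  obtain ⟨d, hd⟩ : ∃ d, a * N = d + 1 :=
    Nat.exists_eq_succ_of_ne_zero (Nat.mul_pos (by omega) hN).ne'
  have hr : N ≤ (a - b) * N := Nat.le_mul_of_pos_left N (by omega)
  have hmr : b * N + (a - b) * N = d + 1 := by
    rw [← hd, ← Nat.add_mul, Nat.add_sub_cancel' hab.le]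
  have e : ZMod N × Fin a ≃ Fin (d + 1) := Fintype.equivOfCardEq (by
    rw [Fintype.card_prod, ZMod.card, Fintype.card_fin, Fintype.card_fin, ← hd, mul_comm])
  have e' : ZMod N × Fin b ≃ Fin (b * N) := Fintype.equivOfCardEq (by
    rw [Fintype.card_prod, ZMod.card, Fintype.card_fin, Fintype.card_fin, mul_comm])
  have hinv : ∀ x, shift^[N] (π (periodicPoint e x)) = π (periodicPoint e x) := fun x => by
    rw [← (Function.Semiconj.iterate_right (f := π) (ga := shift) (gb := shift) hequiv N).eq,
      iterate_shift_periodicPoint]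
  obtain ⟨x₀, hx₀⟩ := exists_large_fiber hmr (hN.trans_le hr) S
    (f := fun x k => (π (periodicPoint e x) ((e'.symm k).1.val : ℤ) (e'.symm k).2 : ℝ))
    (continuous_pi fun k => continuous_subtype_val.comp ((continuous_apply _).comp
      ((continuous_apply _).comp (hcont.comp (continuous_periodicPoint e)))))
  have hcov := exists_finite_cover_dynDist a N hε
  refine le_trans ?_ (log_covNum_le_supLogCov hcov π (π (periodicPoint e x₀)))
  obtain ⟨U, hU, hc⟩ := exists_cover_card_covNum hcov (π ⁻¹' {π (periodicPoint e x₀)})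
  have hpow := hx₀ _ ε (fun k => periodicPoint e ⁻¹' U k) ?_
    (fun k x hx y hy i => (abs_sub_le_dynDist_periodicPoint e x y i).trans
      (lt_of_mem_of_setEDiam_lt (hU k) hx hy).le) ?_
  · generalize covNum (dynDist shift shiftDist N) ε (π ⁻¹' {π (periodicPoint e x₀)}) = K at hpow ⊢
    have hK : (K : ℝ) ≠ 0 := by
      rintro h0
      rw [h0, zero_mul] at hpow
      exact absurd hpow (not_le.2 (by positivity))
    have hlog := Real.log_le_log (by positivity) hpow
    rw [Real.log_mul hK (by positivity), Real.log_pow, Real.log_pow, ← hd, Nat.cast_mul,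
      Nat.cast_mul a] at hlog
    have h1 : 0 ≤ Real.log (3 / 2) := Real.log_nonneg (by norm_num)
    have h2 : (N : ℝ) * (S * Real.log (3 / 2)) ≤ ((a - b) * N : ℕ) * S * Real.log (3 / 2) := by
      rw [mul_assoc]
      gcongr
    linarith
  · rw [← hd, Nat.cast_mul, Real.sqrt_mul (Nat.cast_nonneg a)]
    have h1 : √(a : ℝ) ≤ a := by
      refine Real.sqrt_le_iff.2 ⟨Nat.cast_nonneg a, ?_⟩
      have : (1 : ℝ) ≤ a := by exact_mod_cast (by omega : 1 ≤ a)
      nlinarith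
    have h2 : √(N : ℝ) ≤ √((a - b) * N : ℕ) := Real.sqrt_le_sqrt (by exact_mod_cast hr)
    calc ε * (√a * √N) ≤ ε * (a * √((a - b) * N : ℕ)) := by gcongr
      _ = ε * a * √((a - b) * N : ℕ) := by ring
      _ ≤ 9 / 16 * (1 / 9) ^ S * √((a - b) * N : ℕ) := by gcongr
      _ = 9 / 16 * √((a - b) * N : ℕ) * (1 / 9) ^ S := by ring
  · intro x hx
    have hx' : periodicPoint e x ∈ π ⁻¹' {π (periodicPoint e x₀)} := by
      change π (periodicPoint e x) = π (periodicPoint e x₀)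
      funext i j
      rw [← apply_val_intCast (hinv x) i, ← apply_val_intCast (hinv x₀) i]
      have := congrFun hx (e' ((i : ZMod N), j))
      simp only [Equiv.symm_apply_apply] at this
      exact Subtype.ext this
    have := hc hx'
    rwa [Set.mem_iUnion] at this ⊢

end PeriodicPoints

/-- For `a > b`, every equivariant continuous map between the full shifts
`([0,1]^a)^ℤ → ([0,1]^b)^ℤ` has infinite topological conditional entropy. -/
theorem stmt_0 (a b : ℕ) (hab : b < a) (π : FullShift a → FullShift b)
    (hcont : Continuous π) (hequiv : ∀ x, π (shift x) = shift (π x)) :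
    condEntropy π shift shiftDist = ⊤ := by
  refine EReal.eq_top_iff_forall_lt _ |>.2 fun c => ?_
  have hlog : 0 < Real.log (3 / 2) := Real.log_pos (by norm_num)
  obtain ⟨S, hS⟩ := exists_nat_gt ((c + a * Real.log 12) / Real.log (3 / 2))
  rw [div_lt_iff₀ hlog] at hS
  have ha : (0 : ℝ) < a := by exact_mod_cast (by omega : 0 < a)
  refine lt_of_lt_of_le (b := ((S * Real.log (3 / 2) - a * Real.log 12 : ℝ) : EReal))
    (EReal.coe_lt_coe_iff.2 (by linarith)) (le_limsup_of_frequently_le (Eventually.frequently ?_))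
  filter_upwards [Ioo_mem_nhdsGT (show (0 : ℝ) < 9 / 16 * (1 / 9) ^ S / a by positivity)]
    with ε hε
  refine le_liminf_of_le (h := ?_)
  filter_upwards [eventually_gt_atTop 0] with N hN
  rw [EReal.coe_le_coe_iff, le_div_iff₀ (by exact_mod_cast hN), mul_comm]
  exact log_le_supLogCov hab hcont hequiv S hε.1 ((lt_div_iff₀ ha).1 hε.2).le hN
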